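/- arXiv:1007.1694 — 2 statements merged into one kernel-verified Lean document; each statement's English description precedes it below -/
import Mathlib

section
/- There is no total computable function which, given as input a dimension d ∈ ℕ, a componentwise nonnegative vector z₀ ∈ ℚ^d, a vector θ ∈ ℚ^d, and a completely-S matrix R ∈ ℚ^{d×d}, outputs 1 if the fluid model (z₀,θ,R) is stable and 0 otherwise. In other words, stability of a fluid model of a Skorokhod problem, with the starting state part of the input, is algorithmically undecidable. -/
open scoped BigOperators

/-- A Skorokhod solution for the matrix `R` and input path `x`:
continuous `y, z` on `[0,∞)` with `z = x + R y`, `z ≥ 0`, `y 0 = 0`,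
each `y j` nondecreasing, and `y j` does not increase while `z j > 0`
(the Lebesgue–Stieltjes measure of `y j` vanishes on `{s | z s j > 0}`). -/
def IsSkorokhodSolution {n : Type*} [Fintype n] (R : Matrix n n ℝ)
    (x y z : ℝ → n → ℝ) : Prop :=
  ContinuousOn y (Set.Ici 0) ∧
  ContinuousOn z (Set.Ici 0) ∧
  (∀ t : ℝ, 0 ≤ t → z t = x t + R.mulVec (y t)) ∧
  (∀ t : ℝ, 0 ≤ t → ∀ j, 0 ≤ z t j) ∧
  (y 0 = 0) ∧
  (∀ j, MonotoneOn (fun t => y t j) (Set.Ici 0)) ∧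
  (∀ j, ∀ s₁ s₂ : ℝ, 0 ≤ s₁ → s₁ ≤ s₂ →
      (∀ s ∈ Set.Ioo s₁ s₂, 0 < z s j) → y s₂ j = y s₁ j)

/-- `R` is an S-matrix: some nonnegative `w` with `R w > 0` componentwise. -/
def IsSMatrix {n : Type*} [Fintype n] (R : Matrix n n ℝ) : Prop :=
  ∃ w : n → ℝ, (∀ i, 0 ≤ w i) ∧ (∀ i, 0 < R.mulVec w i)

/-- `R` is completely-S: every (nonempty) principal submatrix is an S-matrix. -/
def IsCompletelyS {n : Type*} [Fintype n] [DecidableEq n] (R : Matrix n n ℝ) : Prop :=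
  ∀ I : Finset n, I.Nonempty →
    IsSMatrix (R.submatrix (fun a : I => (a : n)) (fun a : I => (a : n)))

/-- Stability of the fluid model `(z₀, θ, R)`: every Skorokhod solution for
`x t = z₀ + θ t` satisfies `z t → 0` as `t → ∞`. -/
def FluidStable {n : Type*} [Fintype n] (z0 θv : n → ℝ) (R : Matrix n n ℝ) : Prop :=
  ∀ y z : ℝ → n → ℝ,
    IsSkorokhodSolution R (fun t i => z0 i + θv i * t) y z →
    Filter.Tendsto z Filter.atTop (nhds 0)

/-- `f` is active at rate `r` on `(s₁, s₂)`. -/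
def ActiveAtRate (f : ℝ → ℝ) (r s₁ s₂ : ℝ) : Prop :=
  ∀ s ∈ Set.Ioo s₁ s₂, f s - f s₁ = r * (s - s₁)

/-- `f` is active at unit rate on `(s₁, s₂)`. -/
def UnitActive (f : ℝ → ℝ) (s₁ s₂ : ℝ) : Prop := ActiveAtRate f 1 s₁ s₂

/-- `f` is passive (constant) on `(s₁, s₂)`. -/
def Passive (f : ℝ → ℝ) (s₁ s₂ : ℝ) : Prop := ∀ s ∈ Set.Ioo s₁ s₂, f s = f s₁

/-- A counter machine with `m` states: update map with moves in
`{(-1,0),(0,-1),(0,0),(1,0),(0,1)}`, never decrementing a zero counter. -/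
structure CounterMachine (m : ℕ) where
  Γ : Fin m → Bool → Bool → Fin m × ℤ × ℤ
  moves : ∀ i b c, ((Γ i b c).2.1, (Γ i b c).2.2) ∈
      ({(-1,0), (0,-1), (0,0), (1,0), (0,1)} : Set (ℤ × ℤ))
  consistent : ∀ i b c, (b = false → 0 ≤ (Γ i b c).2.1) ∧ (c = false → 0 ≤ (Γ i b c).2.2)

/-- One step of the counter machine on a configuration. -/
def CounterMachine.step {m : ℕ} (M : CounterMachine m) :
    Fin m × ℕ × ℕ → Fin m × ℕ × ℕ := fun cfg =>
  let r := M.Γ cfg.1 (decide (0 < cfg.2.1)) (decide (0 < cfg.2.2))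
  (r.1, ((cfg.2.1 : ℤ) + r.2.1).toNat, ((cfg.2.2 : ℤ) + r.2.2).toNat)

/-- Index set of the associated Skorokhod problem: groups A (5), B (m), C (2),
D (2), E (4m), F (4m); total dimension 5m + 9. -/
inductive Idx (m : ℕ) where
  | A : Fin 5 → Idx m
  | B : Fin m → Idx m
  | C : Fin 2 → Idx m
  | D : Fin 2 → Idx m
  | E : Fin m → Bool → Bool → Idx m
  | F : Fin m → Bool → Bool → Idx m
  deriving DecidableEq, Fintype

/-- Numeric value of a bit. -/
def bnum (b : Bool) : ℝ := if b then 1 else 0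

/-- Real indicator of a decidable proposition. -/
def indC (P : Prop) [Decidable P] : ℝ := if P then 1 else 0

/-- The 5×5 block AA. -/
def AAmat : Matrix (Fin 5) (Fin 5) ℝ :=
  !![1,2,1,1,0; 0,1,2,1,1; 1,0,1,2,1; 1,1,0,1,2; 2,1,1,0,1]

/-- The reflection matrix `R` associated with the counter machine `M`. -/
def Rmat {m : ℕ} (M : CounterMachine m) : Matrix (Idx m) (Idx m) ℝ :=
  fun p q => match p, q with
  | .A k, .A l => AAmat k l
  | .B _, .A l => if l = 0 then -1 else 0
  | .B j, .B j' => if j' = j then 1 else 0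
  | .B j, .E i b c => if (M.Γ i b c).1 = j then 0 else 1
  | .C _, .A l => if l = 0 ∨ l = 3 then -1 else 0
  | .C k, .C k' => if k' = k then 1 else 0
  | .C k, .D k' => if k' = k then 1 else 0
  | .C k, .E i b c =>
      (if k = 0 then ((M.Γ i b c).2.1 : ℝ) else ((M.Γ i b c).2.2 : ℝ)) + 1
  | .D _, .A l => if l = 1 then -1 else 0
  | .D k, .C k' => if k' = k then 1 else 0
  | .D k, .D k' => if k' = k then 1 else 0
  | .E _ b c, .A l => if l = 0 then -(bnum b) - bnum c else if l = 2 then -1 else 0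
  | .E i _ _, .B j => if j = i then -1 else 0
  | .E _ b c, .C k => if k = 0 then 2 * bnum b - 1 else 2 * bnum c - 1
  | .E i b c, .E i' b' c' => if i' = i ∧ b' = b ∧ c' = c then 1 else 0
  | .E i b c, .F i' b' c' => if i' = i ∧ b' = b ∧ c' = c then 1 else 0
  | .F _ b c, .A l => if l = 0 then -(bnum b) - bnum c
      else if l = 2 then -1 else if l = 3 then -4 else if l = 4 then 4 else 0
  | .F i _ _, .B j => if j = i then -1 else 0
  | .F _ b c, .C k => if k = 0 then 2 * bnum b - 1 else 2 * bnum c - 1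
  | .F i b c, .E i' b' c' => if i' = i ∧ b' = b ∧ c' = c then 1 else 0
  | .F i b c, .F i' b' c' => if i' = i ∧ b' = b ∧ c' = c then 1 else 0
  | _, _ => 0

/-- The modified reflection matrix `R*` with halting state `i*`. -/
def RmatStar {m : ℕ} (M : CounterMachine m) (istar : Fin m) :
    Matrix (Idx m) (Idx m) ℝ :=
  fun p q => match p, q with
  | .A k, .B j => if j = istar ∧ (k = 2 ∨ k = 3 ∨ k = 4) then -1 else 0
  | .E i b c, .B j =>
      if j = istar then -3 + bnum b + bnum c else if j = i then -1 else 0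
  | .F i b c, .B j =>
      if j = istar then -4 + bnum b + bnum c else if j = i then -1 else 0
  | p, q => Rmat M p q

/-- The drift vector θ: −1 on the A-coordinates and 0 elsewhere. -/
def thetaVec (m : ℕ) : Idx m → ℝ := fun p => match p with
  | .A _ => -1
  | _ => 0

/-- The encoding `z^{i,C₁,C₂}` of a configuration as a state of the
Skorokhod problem. -/
def encCfg {m : ℕ} (i : Fin m) (C₁ C₂ : ℕ) : Idx m → ℝ := fun p => match p with
  | .A k => if k = 0 ∨ k = 4 then 0 else 1
  | .B j => if j = i then 0 else 1
  | .C k => if k = 0 then (C₁ : ℝ) else (C₂ : ℝ)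
  | .D _ => 0
  | .E _ _ _ => 3
  | .F _ _ _ => 4

/-- The linear input path `x t = z^{i,C₁,C₂} + θ t`. -/
def fluidX {m : ℕ} (i : Fin m) (C₁ C₂ : ℕ) : ℝ → Idx m → ℝ :=
  fun t p => encCfg i C₁ C₂ p + thetaVec m p * t

/-- The quantity Υ(i′,b,c) of the paper (for current configuration (i,C₁,C₂)). -/
def Upsilon {m : ℕ} (i : Fin m) (C₁ C₂ : ℕ) (i' : Fin m) (b c : Bool) : ℝ :=
  -(bnum b) - bnum c + (2 * bnum b - 1) * indC (C₁ = 0)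
    + (2 * bnum c - 1) * indC (C₂ = 0) - indC (i' = i)


theorem sk_oneD (r t u : ℝ) (hr : 0 < r) (htu : t ≤ u) (y z y' z' : ℝ → ℝ)
    (hy : ContinuousOn y (Set.Icc t u)) (hy' : ContinuousOn y' (Set.Icc t u))
    (hm : MonotoneOn y' (Set.Icc t u))
    (hc : ∀ s₁, t ≤ s₁ → s₁ ≤ u → (∀ s ∈ Set.Ioo s₁ u, 0 < z s) → y u = y s₁)
    (hz' : ∀ v ∈ Set.Icc t u, 0 ≤ z' v)
    (hd : ∀ v ∈ Set.Icc t u, z v - z' v = r * (y v - y' v))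
    (h0 : y t = y' t) : y u ≤ y' u := by
  by_contra hlt
  push Not at hlt
  have hcl : IsClosed {v ∈ Set.Icc t u | y v ≤ y' v} :=
    isClosed_Icc.isClosed_le hy hy'
  have hcomp : IsCompact {v ∈ Set.Icc t u | y v ≤ y' v} :=
    isCompact_Icc.of_isClosed_subset hcl (fun v hv => hv.1)
  obtain ⟨s, hs, hmax⟩ := hcomp.exists_isGreatest ⟨t, ⟨le_refl t, htu⟩, h0.le⟩
  have hpos : ∀ v ∈ Set.Ioo s u, 0 < z v := by
    intro v hv
    have hvI : v ∈ Set.Icc t u := ⟨hs.1.1.trans hv.1.le, hv.2.le⟩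
    have h1 : y' v < y v := by
      by_contra hcon
      push Not at hcon
      have := hmax ⟨hvI, hcon⟩
      linarith [hv.1]
    have h2 := hd v hvI
    have h3 := hz' v hvI
    have : 0 < r * (y v - y' v) := mul_pos hr (by linarith)
    linarith
  have h1 := hc s hs.1.1 hs.1.2 hpos
  have h2 := hm hs.1 ⟨htu, le_refl u⟩ hs.1.2
  have h3 := hs.2
  linarith

theorem sk_unique {ι : Type*} [Fintype ι] (R : Matrix ι ι ℝ) (x y z y' z' : ℝ → ι → ℝ)
    (h : IsSkorokhodSolution R x y z) (h' : IsSkorokhodSolution R x y' z')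
    (hdiag : ∀ j, 0 < R j j)
    (hac : ∀ t : ℝ, 0 ≤ t → ∃ rank : ι → ℕ, ∀ j k, j ≠ k → z t j = 0 → z t k = 0 →
      R j k ≠ 0 → rank k < rank j) :
    ∀ t : ℝ, 0 ≤ t → y t = y' t := by
  classical
  obtain ⟨hy, hz, he, hn, h0, hm, hc⟩ := h
  obtain ⟨hy', hz', he', hn', h0', hm', hc'⟩ := h'
  have key : ∀ T : ℝ, 0 ≤ T → Set.Icc 0 T ⊆ {t | y t = y' t} := by
    intro T hT
    apply IsClosed.Icc_subset_of_forall_mem_nhdsWithin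
    · have : {t | y t = y' t} ∩ Set.Icc 0 T = {t ∈ Set.Icc 0 T | y t = y' t} := by
        ext; simp [and_comm]
      rw [this]
      have h1 := hy.mono (show Set.Icc 0 T ⊆ Set.Ici 0 from fun v hv => hv.1)
      have h2 := hy'.mono (show Set.Icc 0 T ⊆ Set.Ici 0 from fun v hv => hv.1)
      have h3 : IsClosed (Set.Icc 0 T ∩ (fun t => (y t, y' t)) ⁻¹' (Set.diagonal (ι → ℝ))) :=
        (h1.prodMk h2).preimage_isClosed_of_isClosed isClosed_Icc isClosed_diagonal
      convert h3 using 1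
      ext v; simp [Set.mem_diagonal_iff]
    · simp [h0, h0']
    · rintro t ⟨heq, ht0, htT⟩
      have heq : y t = y' t := heq
      have hzz : z t = z' t := by rw [he t ht0, he' t ht0, heq]
      obtain ⟨rank, hrank⟩ := hac t ht0
      -- positivity neighbourhoods
      have hpos : ∀ᶠ v in nhdsWithin t (Set.Ici t), ∀ j, 0 < z t j → 0 < z v j ∧ 0 < z' v j := by
        rw [Filter.eventually_all]
        intro j
        by_cases hj : 0 < z t j
        · have c1 : ContinuousWithinAt (fun v => z v j) (Set.Ici t) t :=
            ((continuous_apply j).continuousAt.comp_continuousWithinAt (hz t ht0)).mono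
              (Set.Ici_subset_Ici.2 ht0)
          have c2 : ContinuousWithinAt (fun v => z' v j) (Set.Ici t) t :=
            ((continuous_apply j).continuousAt.comp_continuousWithinAt (hz' t ht0)).mono
              (Set.Ici_subset_Ici.2 ht0)
          have e1 := c1.eventually (lt_mem_nhds hj)
          have e2 := c2.eventually (lt_mem_nhds (show 0 < z' t j by rw [← hzz]; exact hj))
          filter_upwards [e1, e2] with v h1 h2 _ using ⟨h1, h2⟩
        · exact Filter.Eventually.of_forall (fun v hv => absurd hv hj)
      obtain ⟨u, hu, hU⟩ := (mem_nhdsGE_iff_exists_Ico_subset' (show t < t + 1 by linarith)).1 hpos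
      have hU : ∀ v, t ≤ v → v < u → ∀ j, 0 < z t j → 0 < z v j ∧ 0 < z' v j :=
        fun v h1 h2 => hU ⟨h1, h2⟩
      have P : ∀ n j, (0 < z t j ∨ rank j < n) → ∀ v, t ≤ v → v < u → y v j = y' v j := by
        intro n
        induction n with
        | zero =>
          rintro j (hj | hj) v hv1 hv2
          · have e1 := hc j t v ht0 hv1 (fun s hs => (hU s hs.1.le (hs.2.trans hv2) j hj).1)
            have e2 := hc' j t v ht0 hv1 (fun s hs => (hU s hs.1.le (hs.2.trans hv2) j hj).2)
            rw [e1, e2, heq]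
          · omega
        | succ n ih =>
          intro j hj w hw1 hw2
          by_cases hj0 : 0 < z t j
          · exact ih j (Or.inl hj0) w hw1 hw2
          have hjz : z t j = 0 := le_antisymm (not_lt.1 hj0) (hn t ht0 j)
          have hjr : rank j < n + 1 := by tauto
          have hd : ∀ v, t ≤ v → v < u → z v j - z' v j = R j j * (y v j - y' v j) := by
            intro v hv1 hv2
            have hv0 : 0 ≤ v := ht0.trans hv1
            rw [he v hv0, he' v hv0]
            simp only [Pi.add_apply, Matrix.mulVec, dotProduct]
            have : ∑ k, R j k * y v k - ∑ k, R j k * y' v k = R j j * (y v j - y' v j) := by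
              rw [← Finset.sum_sub_distrib]
              rw [Finset.sum_eq_single j]
              · ring
              · intro k _ hkj
                by_cases hR : R j k = 0
                · simp [hR]
                · have : y v k = y' v k := by
                    apply ih k _ v hv1 hv2
                    by_cases hk : 0 < z t k
                    · exact Or.inl hk
                    · right
                      have := hrank j k (Ne.symm hkj) hjz
                        (le_antisymm (not_lt.1 hk) (hn t ht0 k)) hR
                      omega
                  rw [this]; ring
              · simp
            linarith
          have sub : Set.Icc t w ⊆ Set.Ici 0 := fun v hv => ht0.trans hv.1
          have cy : ContinuousOn (fun v => y v j) (Set.Icc t w) :=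
            (continuous_apply j).comp_continuousOn (hy.mono sub)
          have cy' : ContinuousOn (fun v => y' v j) (Set.Icc t w) :=
            (continuous_apply j).comp_continuousOn (hy'.mono sub)
          apply le_antisymm
          · refine sk_oneD (R j j) t w (hdiag j) hw1 (fun v => y v j) (fun v => z v j)
              (fun v => y' v j) (fun v => z' v j) cy cy' ((hm' j).mono sub)
              (fun s hs1 hs2 hp => hc j s w (ht0.trans hs1) hs2 hp)
              (fun v hv => hn' v (sub hv) j)
              (fun v hv => hd v hv.1 (lt_of_le_of_lt hv.2 hw2)) (by simp [heq])
          · refine sk_oneD (R j j) t w (hdiag j) hw1 (fun v => y' v j) (fun v => z' v j)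
              (fun v => y v j) (fun v => z v j) cy' cy ((hm j).mono sub)
              (fun s hs1 hs2 hp => hc' j s w (ht0.trans hs1) hs2 hp)
              (fun v hv => hn v (sub hv) j)
              (fun v hv => ?_) (by simp [heq])
            have := hd v hv.1 (lt_of_le_of_lt hv.2 hw2)
            show z' v j - z v j = R j j * (y' v j - y v j)
            linarith
      have : Set.Ioo t u ∈ nhdsWithin t (Set.Ioi t) := Ioo_mem_nhdsGT hu
      filter_upwards [this] with v hv
      ext j
      exact P (rank j + 1) j (Or.inr (Nat.lt_succ_self _)) v hv.1.le hv.2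
  intro t ht
  exact key t ht ⟨ht, le_refl t⟩

/-- Criterion for complete-S. -/
theorem sk_completelyS {ι : Type*} [Fintype ι] [DecidableEq ι] (R : Matrix ι ι ℝ) (w : ι → ℝ)
    (hw : ∀ i, 0 < w i)
    (h : ∀ i, ∑ j ∈ Finset.univ.erase i, max (-(R i j)) 0 * w j < R i i * w i) :
    IsCompletelyS R := by
  intro I hI
  refine ⟨fun a => w a, fun a => (hw a).le, fun a => ?_⟩
  have h1 : (R.submatrix (fun a : I => (a : ι)) (fun a : I => (a : ι))).mulVec
      (fun a => w a) a = ∑ j ∈ I, R a j * w j := by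
    simp only [Matrix.mulVec, dotProduct, Matrix.submatrix_apply]
    exact (Finset.sum_coe_sort I (fun j => R a j * w j))
  rw [h1, ← Finset.add_sum_erase I _ a.2]
  have h2 : ∑ j ∈ I.erase a, -(R a j * w j) ≤
      ∑ j ∈ Finset.univ.erase (a : ι), max (-(R a j)) 0 * w j := by
    calc ∑ j ∈ I.erase a, -(R a j * w j) ≤ ∑ j ∈ I.erase a, max (-(R a j)) 0 * w j := by
          apply Finset.sum_le_sum
          intro j _
          have := le_max_left (-(R a j)) 0
          nlinarith [hw j]
      _ ≤ _ := by
          apply Finset.sum_le_sum_of_subset_of_nonneg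
          · exact Finset.erase_subset_erase _ (Finset.subset_univ _)
          · intro j _ _
            exact mul_nonneg (le_max_right _ _) (hw j).le
  rw [Finset.sum_neg_distrib] at h2
  have := h a
  linarith


/-- A piecewise linear trajectory given by its nodes. -/
structure SkTraj {ι : Type*} [Fintype ι] (R : Matrix ι ι ℝ) (θ : ι → ℝ)
    (Z v : ℕ → ι → ℝ) (τ T : ℕ → ℝ) : Prop where
  Znn : ∀ m j, 0 ≤ Z m j
  vnn : ∀ m j, 0 ≤ v m j
  τpos : ∀ m, 0 < τ m
  T0 : T 0 = 0
  Ts : ∀ m, T (m + 1) = T m + τ m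
  Tinf : Filter.Tendsto T Filter.atTop Filter.atTop
  step : ∀ m j, Z (m + 1) j = Z m j + τ m * (θ j + R.mulVec (v m) j)
  comp : ∀ m j, v m j ≠ 0 → Z m j = 0 ∧ Z (m + 1) j = 0
  diag : ∀ j, 0 < R j j
  acyc : ∀ m, ∃ rank : ι → ℕ, ∀ j k, j ≠ k → Z m j = 0 → Z m k = 0 →
      R j k ≠ 0 → rank k < rank j

namespace SkTraj

variable {ι : Type*} [Fintype ι] {R : Matrix ι ι ℝ} {θ : ι → ℝ}
  {Z v : ℕ → ι → ℝ} {τ T : ℕ → ℝ}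

def clamp (τ T : ℕ → ℝ) (m : ℕ) (t : ℝ) : ℝ := max 0 (min (t - T m) (τ m))

theorem mono (h : SkTraj R θ Z v τ T) : StrictMono T :=
  strictMono_nat_of_lt_succ (fun m => by rw [h.Ts]; linarith [h.τpos m])

theorem clamp_zero (m : ℕ) (t : ℝ) (ht : t ≤ T m) : clamp τ T m t = 0 :=
  max_eq_left ((min_le_left _ _).trans (by linarith))

theorem clamp_mid (m : ℕ) (t : ℝ) (h1 : T m ≤ t) (h2 : t ≤ T m + τ m) :
    clamp τ T m t = t - T m := by
  unfold clamp
  rw [min_eq_left (by linarith), max_eq_right (by linarith)]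

theorem clamp_full (m : ℕ) (t : ℝ) (h0 : 0 < τ m) (h2 : T m + τ m ≤ t) :
    clamp τ T m t = τ m := by
  unfold clamp
  rw [min_eq_right (by linarith), max_eq_right h0.le]

theorem clamp_mono (m : ℕ) : Monotone (clamp τ T m) := by
  intro a b hab
  exact max_le_max le_rfl (min_le_min (by linarith) le_rfl)

theorem clamp_cont (m : ℕ) : Continuous (clamp τ T m) := by
  unfold clamp; fun_prop

/-- Truncated sums. -/
def ysum (v : ℕ → ι → ℝ) (τ T : ℕ → ℝ) (N : ℕ) (t : ℝ) : ι → ℝ :=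
  fun j => ∑ m ∈ Finset.range N, v m j * clamp τ T m t

theorem ex_N (h : SkTraj R θ Z v τ T) (t : ℝ) : ∃ N, t ≤ T N :=
  (h.Tinf.eventually_ge_atTop t).exists

theorem ysum_eq (h : SkTraj R θ Z v τ T) {N N' : ℕ} {t : ℝ} (h1 : t ≤ T N) (h2 : t ≤ T N') :
    ysum v τ T N t = ysum v τ T N' t := by
  wlog hle : N ≤ N' generalizing N N'
  · exact (this h2 h1 (by omega)).symm
  ext j
  unfold ysum
  apply Finset.sum_subset (Finset.range_subset_range.2 hle)
  intro m _ hm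
  have : N ≤ m := by simpa using hm
  rw [clamp_zero m t (h1.trans (h.mono.monotone this)), mul_zero]

noncomputable def yy (h : SkTraj R θ Z v τ T) (t : ℝ) : ι → ℝ :=
  ysum v τ T (Classical.choose (h.ex_N t)) t

theorem yy_eq (h : SkTraj R θ Z v τ T) {N : ℕ} {t : ℝ} (h1 : t ≤ T N) :
    h.yy t = ysum v τ T N t :=
  h.ysum_eq (Classical.choose_spec (h.ex_N t)) h1

noncomputable def zz (h : SkTraj R θ Z v τ T) (t : ℝ) : ι → ℝ :=
  fun j => Z 0 j + θ j * t + R.mulVec (h.yy t) j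

theorem yy_cont (h : SkTraj R θ Z v τ T) : Continuous h.yy := by
  rw [continuous_iff_continuousAt]
  intro t
  obtain ⟨N, hN⟩ := h.ex_N (t + 1)
  have hc : Continuous (ysum v τ T N) := by
    apply continuous_pi
    intro j
    unfold ysum
    apply continuous_finsetSum
    intro m _
    exact continuous_const.mul (clamp_cont m)
  apply hc.continuousAt.congr
  filter_upwards [Iio_mem_nhds (show t < t + 1 by linarith)] with s hs
  exact (h.yy_eq (le_trans (le_of_lt hs) hN)).symm

theorem Z_eq (h : SkTraj R θ Z v τ T) (m : ℕ) (j : ι) :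
    Z m j = Z 0 j + θ j * T m + R.mulVec (fun k => ∑ i ∈ Finset.range m, v i k * τ i) j := by
  induction m with
  | zero => simp [h.T0, Matrix.mulVec, dotProduct]
  | succ m ih =>
    rw [h.step, ih, h.Ts]
    simp only [Matrix.mulVec, dotProduct, Finset.sum_range_succ, mul_add, Finset.sum_add_distrib,
      Finset.mul_sum]
    have : ∀ k, R j k * (v m k * τ m) = τ m * (R j k * v m k) := fun k => by ring
    simp only [this]
    ring

theorem zz_mid (h : SkTraj R θ Z v τ T) (m : ℕ) (t : ℝ) (h1 : T m ≤ t) (h2 : t ≤ T (m + 1))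
    (j : ι) : h.zz t j = Z m j + (t - T m) * (θ j + R.mulVec (v m) j) := by
  rw [h.Z_eq m j]
  unfold zz
  rw [h.yy_eq h2]
  have : ysum v τ T (m + 1) t =
      fun k => (∑ i ∈ Finset.range m, v i k * τ i) + v m k * (t - T m) := by
    ext k
    unfold ysum
    rw [Finset.sum_range_succ, clamp_mid m t h1 (by rw [← h.Ts]; exact h2)]
    congr 1
    apply Finset.sum_congr rfl
    intro i hi
    have hi : i < m := by simpa using hi
    rw [clamp_full i t (h.τpos i)]
    rw [← h.Ts]
    exact (h.mono.monotone hi).trans h1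
  rw [this]
  simp only [Matrix.mulVec, dotProduct, mul_add, Finset.sum_add_distrib, Finset.mul_sum]
  have : ∀ k, R j k * (v m k * (t - T m)) = (t - T m) * (R j k * v m k) := fun k => by ring
  simp only [this]
  ring

theorem zz_conv (h : SkTraj R θ Z v τ T) (m : ℕ) (t : ℝ) (h1 : T m ≤ t) (h2 : t ≤ T (m + 1)) :
    ∃ l : ℝ, 0 ≤ l ∧ l ≤ 1 ∧ (t < T (m + 1) → l < 1) ∧ 
      ∀ j, h.zz t j = (1 - l) * Z m j + l * Z (m + 1) j := by
  have hp := h.τpos m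
  have hT := h.Ts m
  refine ⟨(t - T m) / τ m, div_nonneg (by linarith) hp.le, ?_, ?_, ?_⟩
  · rw [div_le_one hp]; linarith
  · intro; rw [div_lt_one hp]; linarith
  · intro j
    rw [h.zz_mid m t h1 h2 j, h.step m j]
    field_simp
    ring

theorem ex_seg (h : SkTraj R θ Z v τ T) (t : ℝ) (ht : 0 ≤ t) (M : ℕ) (hM : T M ≤ t) :
    ∃ m, M ≤ m ∧ T m ≤ t ∧ t < T (m + 1) := by
  have hex : ∃ N, t < T N := (h.Tinf.eventually_gt_atTop t).exists
  classical
  have h1 := Nat.find_spec hex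
  have hpos : M < Nat.find hex := by
    by_contra hcon
    have := h.mono.monotone (not_lt.1 hcon)
    linarith
  refine ⟨Nat.find hex - 1, by omega, ?_, ?_⟩
  · exact not_lt.1 (Nat.find_min hex (show Nat.find hex - 1 < Nat.find hex by omega))
  · rw [show Nat.find hex - 1 + 1 = Nat.find hex by omega]; exact h1

theorem zz_zero_of_v (h : SkTraj R θ Z v τ T) (m : ℕ) (t : ℝ) (h1 : T m ≤ t)
    (h2 : t ≤ T (m + 1)) (j : ι) (hv : v m j ≠ 0) : h.zz t j = 0 := by
  obtain ⟨l, _, _, _, hl⟩ := h.zz_conv m t h1 h2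
  rw [hl j, (h.comp m j hv).1, (h.comp m j hv).2]; ring

theorem isSol (h : SkTraj R θ Z v τ T) :
    IsSkorokhodSolution R (fun t i => Z 0 i + θ i * t) h.yy h.zz := by
  refine ⟨h.yy_cont.continuousOn, ?_, ?_, ?_, ?_, ?_, ?_⟩
  · apply Continuous.continuousOn
    apply continuous_pi
    intro j
    unfold zz
    simp only [Matrix.mulVec, dotProduct]
    have := h.yy_cont
    have : ∀ k, Continuous fun t => h.yy t k := fun k => (continuous_apply k).comp this
    fun_prop
  · intro t _
    rfl
  · intro t ht j
    obtain ⟨m, _, h1, h2⟩ := h.ex_seg t ht 0 (by rw [h.T0]; exact ht)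
    obtain ⟨l, l0, l1, _, hl⟩ := h.zz_conv m t h1 h2.le
    rw [hl j]
    exact add_nonneg (mul_nonneg (by linarith) (h.Znn _ _)) (mul_nonneg l0 (h.Znn _ _))
  · rw [h.yy_eq (N := 0) (by rw [h.T0])]
    ext j; simp [ysum]
  · intro j s _ t _ hst
    obtain ⟨N, hN⟩ := h.ex_N t
    simp only
    rw [h.yy_eq hN, h.yy_eq (hst.trans hN)]
    exact Finset.sum_le_sum (fun m _ => mul_le_mul_of_nonneg_left (clamp_mono m hst) (h.vnn m j))
  · intro j s₁ s₂ h0 h12 hpos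
    obtain ⟨N, hN⟩ := h.ex_N s₂
    rw [h.yy_eq hN, h.yy_eq (h12.trans hN)]
    apply Finset.sum_congr rfl
    intro m _
    by_cases hv : v m j = 0
    · simp [hv]
    congr 1
    rcases h12.eq_or_lt with heq | hlt
    · rw [heq]
    have hp := h.τpos m
    have hT := h.Ts m
    by_cases c1 : s₂ ≤ T m
    · rw [clamp_zero m _ c1, clamp_zero m _ (h12.trans c1)]
    by_cases c2 : T m + τ m ≤ s₁
    · rw [clamp_full m _ hp c2, clamp_full m _ hp (c2.trans h12)]
    push Not at c1 c2
    exfalso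
    have hA : max s₁ (T m) < min s₂ (T m + τ m) := by
      rw [max_lt_iff, lt_min_iff, lt_min_iff]
      exact ⟨⟨hlt, c2⟩, c1, by linarith⟩
    obtain ⟨p, hp1, hp2⟩ := exists_between hA
    rw [max_lt_iff] at hp1
    rw [lt_min_iff] at hp2
    have h1 := hpos p ⟨hp1.1, hp2.1⟩
    have h2 := h.zz_zero_of_v m p hp1.2.le (by rw [hT]; exact hp2.2.le) j hv
    linarith

theorem sol_unique (h : SkTraj R θ Z v τ T) (y z : ℝ → ι → ℝ)
    (hs : IsSkorokhodSolution R (fun t i => Z 0 i + θ i * t) y z) (t : ℝ) (ht : 0 ≤ t) :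
    z t = h.zz t := by
  have hyy := sk_unique R _ h.yy h.zz y z h.isSol hs h.diag ?_ t ht
  · rw [hs.2.2.1 t ht, h.isSol.2.2.1 t ht, hyy]
  · intro t ht
    obtain ⟨m, _, h1, h2⟩ := h.ex_seg t ht 0 (by rw [h.T0]; exact ht)
    obtain ⟨l, l0, l1, l2, hl⟩ := h.zz_conv m t h1 h2.le
    obtain ⟨rank, hr⟩ := h.acyc m
    have l2 := l2 h2
    have hz : ∀ j, h.zz t j = 0 → Z m j = 0 := by
      intro j hj
      rw [hl j] at hj
      have a1 := h.Znn m j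
      have a2 := mul_nonneg l0 (h.Znn (m + 1) j)
      have a3 := mul_nonneg (show 0 ≤ 1 - l by linarith) a1
      have a4 : (1 - l) * Z m j = 0 := by linarith
      rcases mul_eq_zero.1 a4 with a | a
      · linarith
      · exact a
    exact ⟨rank, fun j k hjk h1 h2 h3 => hr j k hjk (hz j h1) (hz k h2) h3⟩

theorem stable_iff (h : SkTraj R θ Z v τ T) :
    FluidStable (Z 0) θ R ↔ Filter.Tendsto Z Filter.atTop (nhds 0) := by
  constructor
  · intro hst
    have h1 := hst h.yy h.zz h.isSol
    have h2 := h1.comp h.Tinf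
    refine h2.congr ?_
    intro m
    ext j
    simp only [Function.comp]
    rw [h.zz_mid m (T m) le_rfl (h.mono.monotone (Nat.le_succ m)) j]
    simp
  · intro hZ y z hs
    rw [tendsto_pi_nhds] at hZ ⊢
    intro j
    have hZj := hZ j
    rw [Metric.tendsto_atTop] at hZj ⊢
    intro ε hε
    obtain ⟨M, hM⟩ := hZj ε hε
    refine ⟨T M, fun t ht => ?_⟩
    have ht0 : 0 ≤ t := by
      have := h.mono.monotone (Nat.zero_le M)
      rw [h.T0] at this
      linarith
    rw [h.sol_unique y z hs t ht0]
    obtain ⟨m, hm, h1, h2⟩ := h.ex_seg t ht0 M ht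
    obtain ⟨l, l0, l1, _, hl⟩ := h.zz_conv m t h1 h2.le
    have b1 := hM m hm
    have b2 := hM (m + 1) (by omega)
    have c1 := h.Znn m j
    have c2 := h.Znn (m + 1) j
    simp only [Pi.zero_apply, Real.dist_eq, sub_zero] at b1 b2 ⊢
    rw [abs_of_nonneg c1] at b1
    rw [abs_of_nonneg c2] at b2
    rw [hl j, abs_of_nonneg (by
      exact add_nonneg (mul_nonneg (by linarith) c1) (mul_nonneg l0 c2))]
    rcases l0.eq_or_lt with hl0 | hl0
    · rw [← hl0]; linarith
    · nlinarith

/-- Transport along an equivalence. -/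
theorem pull {κ : Type*} [Fintype κ] (e : κ ≃ ι) (h : SkTraj R θ Z v τ T) :
    SkTraj (fun i j => R (e i) (e j)) (fun i => θ (e i)) (fun m i => Z m (e i))
      (fun m i => v m (e i)) τ T where
  Znn m j := h.Znn m (e j)
  vnn m j := h.vnn m (e j)
  τpos := h.τpos
  T0 := h.T0
  Ts := h.Ts
  Tinf := h.Tinf
  step m j := by
    rw [h.step m (e j)]
    simp only [Matrix.mulVec, dotProduct]
    rw [Equiv.sum_comp e (fun k => R (e j) k * v m k)]
  comp m j := h.comp m (e j)
  diag j := h.diag (e j)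
  acyc m := by
    obtain ⟨rank, hr⟩ := h.acyc m
    exact ⟨fun i => rank (e i), fun j k hjk => hr (e j) (e k) (fun hh => hjk (e.injective hh))⟩

end SkTraj

theorem sk_completelyS_pull {ι κ : Type*} [Fintype ι] [DecidableEq ι] [Fintype κ] [DecidableEq κ]
    (e : κ ≃ ι) (R : Matrix ι ι ℝ) (w : ι → ℝ)
    (hw : ∀ i, 0 < w i)
    (h : ∀ i, ∑ j ∈ Finset.univ.erase i, max (-(R i j)) 0 * w j < R i i * w i) :
    IsCompletelyS (fun i j => R (e i) (e j)) := by
  apply sk_completelyS _ (fun i => w (e i)) (fun i => hw (e i))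
  intro i
  refine lt_of_eq_of_lt ?_ (h (e i))
  apply Finset.sum_equiv e
  · intro j; simp
  · intro j _; rfl


set_option linter.unusedSectionVars false
set_option linter.unnecessarySeqFocus false
set_option linter.unusedVariables false

/-- Abstract fluid machine with states `S` and counters `K`. -/
structure FM (S K : Type) where
  nxt : S → S
  alt : K → S
  tst : K → S
  u : S → K → ℤ
  hv : S → Bool
  u_ge : ∀ q k, -1 ≤ u q k

namespace FM

abbrev Ix (S K : Type) := Fin 4 ⊕ (S ⊕ (K ⊕ S))

variable {S K : Type} [Fintype S] [Fintype K] [DecidableEq S] [DecidableEq K]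

def lam (F : Type) [Field F] (M : FM S K) (q : S) : F := if M.hv q then 1 / 2 else 1

def AA (F : Type) [Field F] : Fin 4 → Fin 4 → F :=
  ![![1, 2, 1, 0], ![0, 1, 2, 1], ![1, 0, 1, 2], ![2, 1, 0, 1]]

def RR (F : Type) [Field F] (M : FM S K) : Matrix (Ix S K) (Ix S K) F := fun p p' =>
  match p, p' with
  | .inl k, .inl l => AA F k l
  | .inl k, .inr (.inl q) => if M.hv q then ![0, 0, -1 / 2, -1 / 2] k else 0
  | .inr (.inl _), .inl l => ![1, 4, 2, 0] l
  | .inr (.inl j), .inr (.inl q) => if q = j then 1 else 0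
  | .inr (.inl j), .inr (.inr (.inr i)) => if i = j then 0 else 1
  | .inr (.inr (.inl k)), .inr (.inl q) => (M.u q k : F)
  | .inr (.inr (.inl k)), .inr (.inr (.inl k')) => if k' = k then 1 else 0
  | .inr (.inr (.inr _)), .inl l => ![1, 0, 0, 3] l
  | .inr (.inr (.inr j)), .inr (.inl q) =>
      -(if M.hv q then 1 else 0) - (if M.nxt q = j then M.lam F q else 0)
  | .inr (.inr (.inr j)), .inr (.inr (.inl k)) =>
      (if M.nxt (M.tst k) = j then 1 else 0) - (if M.alt k = j then 1 else 0)
  | .inr (.inr (.inr j)), .inr (.inr (.inr i)) => if i = j then 1 else 0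
  | _, _ => 0

def th (F : Type) [Field F] : Ix S K → F := fun p =>
  match p with
  | .inl _ => -1
  | .inr (.inl _) => -2
  | .inr (.inr (.inl _)) => 0
  | .inr (.inr (.inr _)) => -1

theorem RR_cast (M : FM S K) (i j : Ix S K) : ((M.RR ℚ i j : ℚ) : ℝ) = M.RR ℝ i j := by
  rcases i with k | q | k | q <;> rcases j with k' | q' | k' | q' <;>
    simp only [RR, lam, AA] <;> (try fin_cases k) <;> (try fin_cases k') <;>
    (try simp) <;> (try split_ifs) <;> (try norm_num)

theorem th_cast (i : Ix S K) : ((th ℚ i : ℚ) : ℝ) = th ℝ i := by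
  rcases i with k | q | k | q <;> simp [th]

abbrev vec (a : Fin 4 → ℝ) (b : S → ℝ) (c : K → ℝ) (d : S → ℝ) : Ix S K → ℝ :=
  Sum.elim a (Sum.elim b (Sum.elim c d))

theorem mul_A (M : FM S K) (a : Fin 4 → ℝ) (b : S → ℝ) (c : K → ℝ) (d : S → ℝ) (k : Fin 4) :
    (M.RR ℝ).mulVec (vec a b c d) (.inl k) = AA ℝ k 0 * a 0 + AA ℝ k 1 * a 1 + AA ℝ k 2 * a 2
      + AA ℝ k 3 * a 3 + ∑ q, (if M.hv q then ![0, 0, -1 / 2, -1 / 2] k else 0) * b q := by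
  simp [Matrix.mulVec, dotProduct, Fintype.sum_sum_type, Fin.sum_univ_four, RR]

theorem mul_B (M : FM S K) (a : Fin 4 → ℝ) (b : S → ℝ) (c : K → ℝ) (d : S → ℝ) (j : S) :
    (M.RR ℝ).mulVec (vec a b c d) (.inr (.inl j)) = a 0 + 4 * a 1 + 2 * a 2
      + b j + ∑ i, (if i = j then 0 else 1) * d i := by
  simp [Matrix.mulVec, dotProduct, Fintype.sum_sum_type, Fin.sum_univ_four, RR]
  ring

theorem mul_C (M : FM S K) (a : Fin 4 → ℝ) (b : S → ℝ) (c : K → ℝ) (d : S → ℝ) (k : K) :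
    (M.RR ℝ).mulVec (vec a b c d) (.inr (.inr (.inl k))) = ∑ q, (M.u q k : ℝ) * b q + c k := by
  simp [Matrix.mulVec, dotProduct, Fintype.sum_sum_type, RR]

theorem mul_N (M : FM S K) (a : Fin 4 → ℝ) (b : S → ℝ) (c : K → ℝ) (d : S → ℝ) (j : S) :
    (M.RR ℝ).mulVec (vec a b c d) (.inr (.inr (.inr j))) = a 0 + 3 * a 3
      + ∑ q, (-(if M.hv q then 1 else 0) - (if M.nxt q = j then M.lam ℝ q else 0)) * b q
      + ∑ k, ((if M.nxt (M.tst k) = j then 1 else 0) - (if M.alt k = j then 1 else 0)) * c k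
      + d j := by
  simp [Matrix.mulVec, dotProduct, Fintype.sum_sum_type, Fin.sum_univ_four, RR]
  ring

/-- Abstract run of the machine. -/
structure Run (M : FM S K) (q : ℕ → S) (x : ℕ → K → ℝ) (s : ℕ → ℝ) (φ : ℕ → Option K) : Prop where
  spos : ∀ n, 0 < s n
  xnn : ∀ n k, 0 ≤ x n k
  ssucc : ∀ n, s (n + 1) = s n * M.lam ℝ (q n)
  xsucc : ∀ n k, x (n + 1) k = x n k + s n * ((M.u (q n) k : ℝ) + if φ n = some k then 1 else 0)
  fire : ∀ n k, φ n = some k →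
    M.tst k = q n ∧ M.hv (q n) = false ∧ x n k = 0 ∧ x (n + 1) k = 0
  qnone : ∀ n, φ n = none → q (n + 1) = M.nxt (q n)
  qsome : ∀ n k, φ n = some k → q (n + 1) = M.alt k

def z0 (q : S) (x : K → ℝ) (s : ℝ) : Ix S K → ℝ :=
  vec ![0, s, s, 0] (fun j => if j = q then 0 else s) x (fun _ => 2 * s)
def z1 (q' : S) (x' : K → ℝ) (s' : ℝ) : Ix S K → ℝ :=
  vec ![0, 0, s', s'] (fun _ => 0) x' (fun j => 2 * s' - if j = q' then s' else 0)
def z2 (q' : S) (x' : K → ℝ) (s' : ℝ) : Ix S K → ℝ :=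
  vec ![s', 0, 0, s'] (fun _ => 2 * s') x' (fun j => s' - if j = q' then s' else 0)
def z3 (q' : S) (x' : K → ℝ) (s' : ℝ) : Ix S K → ℝ :=
  vec ![s', s', 0, 0] (fun j => 2 * s' + if j = q' then 0 else s') x' (fun _ => 0)
def v0 (q : S) (φ : Option K) : Ix S K → ℝ :=
  vec ![1, 0, 0, 0] (fun j => if j = q then 1 else 0) (fun k => if φ = some k then 1 else 0)
    (fun _ => 0)
def v1 : Ix S K → ℝ := vec ![0, 1, 0, 0] 0 0 0
def v2 (q' : S) : Ix S K → ℝ := vec ![0, 0, 1, 0] 0 0 (fun j => if j = q' then 1 else 0)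
def v3 : Ix S K → ℝ := vec ![0, 0, 0, 1] 0 0 0

variable {M : FM S K} {q : ℕ → S} {x : ℕ → K → ℝ} {s : ℕ → ℝ} {φ : ℕ → Option K}

theorem step0 (h : Run M q x s φ) (n : ℕ) (j : Ix S K) :
    z1 (q (n + 1)) (x (n + 1)) (s (n + 1)) j =
      z0 (q n) (x n) (s n) j + s n * (th ℝ j + (M.RR ℝ).mulVec (v0 (q n) (φ n)) j) := by
  have hs := h.ssucc n
  rcases j with k | j | k | j
  · rw [v0, mul_A]
    simp only [lam] at hs
    fin_cases k <;> simp [z1, z0, AA, th] <;> cases hh : M.hv (q n) <;> simp [hh] at hs ⊢ <;>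
      linarith
  · rw [v0, mul_B]
    by_cases hj : j = q n
    · simp [z1, z0, th, hj]; right; norm_num
    · simp [z1, z0, th, hj]; ring
  · rw [v0, mul_C]
    simp [z1, z0, th, h.xsucc n k]
  · rw [v0, mul_N]
    simp only [lam] at hs
    cases hφ : φ n with
    | none =>
      have hq := h.qnone n hφ
      rw [hq]
      by_cases hj : j = M.nxt (q n)
      · cases hh : M.hv (q n) <;> simp [z1, z0, th, hj, hh, lam] at hs ⊢ <;> linarith
      · have hj' : ¬ M.nxt (q n) = j := fun e => hj e.symm
        cases hh : M.hv (q n) <;> simp [z1, z0, th, hj, hj', hh, lam] at hs ⊢ <;> linarith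
    | some k =>
      have hq := h.qsome n k hφ
      obtain ⟨h1, h2, _, _⟩ := h.fire n k hφ
      rw [hq]
      simp [z1, z0, th, h2, lam, h1] at hs ⊢
      rw [hs]
      by_cases hj : j = M.alt k
      · simp [hj]; ring
      · have hj' : ¬ M.alt k = j := fun e => hj e.symm
        simp [hj, hj']

theorem step1 (q' : S) (x' : K → ℝ) (s' : ℝ) (j : Ix S K) :
    z2 q' x' s' j = z1 q' x' s' j + s' * (th ℝ j + (M.RR ℝ).mulVec v1 j) := by
  rcases j with k | j | k | j
  · rw [v1, mul_A]
    fin_cases k <;> simp [z1, z2, AA, th] <;> ring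
  · rw [v1, mul_B]; simp [z1, z2, th]; ring
  · rw [v1, mul_C]; simp [z1, z2, th]
  · rw [v1, mul_N]; simp [z1, z2, th]; ring

theorem step2 (q' : S) (x' : K → ℝ) (s' : ℝ) (j : Ix S K) :
    z3 q' x' s' j = z2 q' x' s' j + s' * (th ℝ j + (M.RR ℝ).mulVec (v2 q') j) := by
  rcases j with k | j | k | j
  · rw [v2, mul_A]
    fin_cases k <;> simp [z3, z2, AA, th] <;> ring
  · rw [v2, mul_B]; by_cases hj : j = q'
    · simp [z3, z2, th, hj]
    · have : ¬ q' = j := fun e => hj e.symm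
      simp [z3, z2, th, hj, this]
  · rw [v2, mul_C]; simp [z3, z2, th]
  · rw [v2, mul_N]; by_cases hj : j = q' <;> simp [z3, z2, th, hj]

theorem step3 (q' : S) (x' : K → ℝ) (s' : ℝ) (j : Ix S K) :
    z0 q' x' s' j = z3 q' x' s' j + s' * (th ℝ j + (M.RR ℝ).mulVec v3 j) := by
  rcases j with k | j | k | j
  · rw [v3, mul_A]
    fin_cases k <;> simp [z3, z0, AA, th] <;> ring
  · rw [v3, mul_B]; by_cases hj : j = q' <;> simp [z3, z0, th, hj] <;> ring
  · rw [v3, mul_C]; simp [z3, z0, th]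
  · rw [v3, mul_N]; simp [z3, z0, th]; ring

theorem z0nn (q' : S) (x' : K → ℝ) (s' : ℝ) (hs : 0 < s') (hx : ∀ k, 0 ≤ x' k) (j : Ix S K) :
    0 ≤ z0 q' x' s' j := by
  rcases j with k | j | k | j
  · fin_cases k <;> simp [z0] <;> linarith
  · by_cases hj : j = q' <;> simp [z0, hj] ; linarith
  · simp [z0, hx k]
  · simp [z0]; linarith
theorem z1nn (q' : S) (x' : K → ℝ) (s' : ℝ) (hs : 0 < s') (hx : ∀ k, 0 ≤ x' k) (j : Ix S K) :
    0 ≤ z1 q' x' s' j := by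
  rcases j with k | j | k | j
  · fin_cases k <;> simp [z1] <;> linarith
  · simp [z1]
  · simp [z1, hx k]
  · by_cases hj : j = q' <;> simp [z1, hj] <;> linarith
theorem z2nn (q' : S) (x' : K → ℝ) (s' : ℝ) (hs : 0 < s') (hx : ∀ k, 0 ≤ x' k) (j : Ix S K) :
    0 ≤ z2 q' x' s' j := by
  rcases j with k | j | k | j
  · fin_cases k <;> simp [z2] <;> linarith
  · simp [z2]; linarith
  · simp [z2, hx k]
  · by_cases hj : j = q' <;> simp [z2, hj] ; linarith
theorem z3nn (q' : S) (x' : K → ℝ) (s' : ℝ) (hs : 0 < s') (hx : ∀ k, 0 ≤ x' k) (j : Ix S K) :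
    0 ≤ z3 q' x' s' j := by
  rcases j with k | j | k | j
  · fin_cases k <;> simp [z3] <;> linarith
  · by_cases hj : j = q' <;> simp [z3, hj] <;> linarith
  · simp [z3, hx k]
  · simp [z3]

theorem comp0 (h : Run M q x s φ) (n : ℕ) (j : Ix S K) (hv : v0 (q n) (φ n) j ≠ 0) :
    z0 (q n) (x n) (s n) j = 0 ∧ z1 (q (n + 1)) (x (n + 1)) (s (n + 1)) j = 0 := by
  rcases j with k | j | k | j
  · fin_cases k <;> simp [v0, z0, z1] at hv ⊢
  · simp [v0, z0, z1] at hv ⊢; tauto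
  · simp [v0, z0, z1] at hv ⊢
    exact (h.fire n k hv).2.2
  · simp [v0] at hv
theorem comp1 (q' : S) (x' : K → ℝ) (s' : ℝ) (j : Ix S K) (hv : v1 j ≠ 0) :
    z1 q' x' s' j = 0 ∧ z2 q' x' s' j = 0 := by
  rcases j with k | j | k | j
  · fin_cases k <;> simp [v1, z2, z1] at hv ⊢
  all_goals simp [v1] at hv
theorem comp2 (q' : S) (x' : K → ℝ) (s' : ℝ) (j : Ix S K) (hv : v2 q' j ≠ 0) :
    z2 q' x' s' j = 0 ∧ z3 q' x' s' j = 0 := by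
  rcases j with k | j | k | j
  · fin_cases k <;> simp [v2, z2, z3] at hv ⊢
  · simp [v2] at hv
  · simp [v2] at hv
  · simp [v2, z2, z3] at hv ⊢; simp [hv]
theorem comp3 (q' : S) (x' : K → ℝ) (s' : ℝ) (j : Ix S K) (hv : v3 j ≠ 0) :
    z3 q' x' s' j = 0 ∧ z0 q' x' s' j = 0 := by
  rcases j with k | j | k | j
  · fin_cases k <;> simp [v3, z0, z3] at hv ⊢
  all_goals simp [v3] at hv

def rk (r : Fin 4 → ℕ) : Ix S K → ℕ :=
  Sum.elim r (Sum.elim (fun _ => 2) (Sum.elim (fun _ => 3) (fun _ => 4)))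

theorem ac0 (M : FM S K) (q' : S) (x' : K → ℝ) (s' : ℝ) (hs : 0 < s') (j k : Ix S K) (hjk : j ≠ k)
    (hj : z0 q' x' s' j = 0) (hk : z0 q' x' s' k = 0) (hR : M.RR ℝ j k ≠ 0) :
    rk ![0, 0, 0, 5] k < rk ![0, 0, 0, 5] j := by
  have := hs.ne'
  rcases j with a | a | a | a <;> rcases k with b | b | b | b <;>
    (try fin_cases a) <;> (try fin_cases b) <;> simp [RR, rk, AA, z0, this] at * <;> 
    (try exact absurd hR.symm hjk)
theorem ac1 (M : FM S K) (q' : S) (x' : K → ℝ) (s' : ℝ) (hs : 0 < s') (j k : Ix S K) (hjk : j ≠ k)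
    (hj : z1 q' x' s' j = 0) (hk : z1 q' x' s' k = 0) (hR : M.RR ℝ j k ≠ 0) :
    rk ![1, 0, 0, 0] k < rk ![1, 0, 0, 0] j := by
  have := hs.ne'
  have hN : ∀ b, 2 * s' - (if b = q' then s' else 0) ≠ 0 := by
    intro b; split_ifs <;> intro hh <;> linarith
  rcases j with a | a | a | a <;> rcases k with b | b | b | b <;>
    (try fin_cases a) <;> (try fin_cases b) <;> simp [RR, rk, AA, z1, this, hN] at * <;>
    (try exact absurd hR.symm hjk)
theorem ac2 (M : FM S K) (q' : S) (x' : K → ℝ) (s' : ℝ) (hs : 0 < s') (j k : Ix S K) (hjk : j ≠ k)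
    (hj : z2 q' x' s' j = 0) (hk : z2 q' x' s' k = 0) (hR : M.RR ℝ j k ≠ 0) :
    rk ![0, 1, 0, 0] k < rk ![0, 1, 0, 0] j := by
  have := hs.ne'
  rcases j with a | a | a | a <;> rcases k with b | b | b | b <;>
    (try fin_cases a) <;> (try fin_cases b) <;> simp [RR, rk, AA, z2, this] at * <;>
    (try exact absurd hR.symm hjk)
theorem ac3 (M : FM S K) (q' : S) (x' : K → ℝ) (s' : ℝ) (hs : 0 < s') (j k : Ix S K) (hjk : j ≠ k)
    (hj : z3 q' x' s' j = 0) (hk : z3 q' x' s' k = 0) (hR : M.RR ℝ j k ≠ 0) :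
    rk ![0, 0, 1, 0] k < rk ![0, 0, 1, 0] j := by
  have := hs.ne'
  have hN : ∀ b, 2 * s' + (if b = q' then 0 else s') ≠ 0 := by
    intro b; split_ifs <;> intro hh <;> linarith
  rcases j with a | a | a | a <;> rcases k with b | b | b | b <;>
    (try fin_cases a) <;> (try fin_cases b) <;> simp [RR, rk, AA, z3, this, hN] at * <;>
    (try exact absurd hR.symm hjk)

end FM

set_option linter.unusedSectionVars false
set_option linter.unnecessarySeqFocus false
set_option linter.unusedVariables false
namespace FM
variable {S K : Type} [Fintype S] [Fintype K] [DecidableEq S] [DecidableEq K]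
variable {M : FM S K} {q : ℕ → S} {x : ℕ → K → ℝ} {s : ℕ → ℝ} {φ : ℕ → Option K}

def Zp (q : ℕ → S) (x : ℕ → K → ℝ) (s : ℕ → ℝ) (n : ℕ) : ℕ → Ix S K → ℝ
  | 0 => z0 (q n) (x n) (s n)
  | 1 => z1 (q (n + 1)) (x (n + 1)) (s (n + 1))
  | 2 => z2 (q (n + 1)) (x (n + 1)) (s (n + 1))
  | _ => z3 (q (n + 1)) (x (n + 1)) (s (n + 1))

def Vp (q : ℕ → S) (φ : ℕ → Option K) (n : ℕ) : ℕ → Ix S K → ℝ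
  | 0 => v0 (q n) (φ n)
  | 1 => v1
  | 2 => v2 (q (n + 1))
  | _ => v3

def tp (s : ℕ → ℝ) (n : ℕ) : ℕ → ℝ
  | 0 => s n
  | _ => s (n + 1)

def Zm (q : ℕ → S) (x : ℕ → K → ℝ) (s : ℕ → ℝ) (m : ℕ) : Ix S K → ℝ := Zp q x s (m / 4) (m % 4)
def Vm (q : ℕ → S) (φ : ℕ → Option K) (m : ℕ) : Ix S K → ℝ := Vp q φ (m / 4) (m % 4)
def tm (s : ℕ → ℝ) (m : ℕ) : ℝ := tp s (m / 4) (m % 4)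

theorem ex4 (m : ℕ) : ∃ n, m = 4 * n ∨ m = 4 * n + 1 ∨ m = 4 * n + 2 ∨ m = 4 * n + 3 :=
  ⟨m / 4, by omega⟩

theorem Zm0 (n : ℕ) : Zm q x s (4 * n) = z0 (q n) (x n) (s n) := by
  unfold Zm; rw [show 4 * n / 4 = n by omega, show 4 * n % 4 = 0 by omega]; rfl
theorem Zm1 (n : ℕ) : Zm q x s (4 * n + 1) = z1 (q (n + 1)) (x (n + 1)) (s (n + 1)) := by
  unfold Zm; rw [show (4 * n + 1) / 4 = n by omega, show (4 * n + 1) % 4 = 1 by omega]; rfl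
theorem Zm2 (n : ℕ) : Zm q x s (4 * n + 2) = z2 (q (n + 1)) (x (n + 1)) (s (n + 1)) := by
  unfold Zm; rw [show (4 * n + 2) / 4 = n by omega, show (4 * n + 2) % 4 = 2 by omega]; rfl
theorem Zm3 (n : ℕ) : Zm q x s (4 * n + 3) = z3 (q (n + 1)) (x (n + 1)) (s (n + 1)) := by
  unfold Zm; rw [show (4 * n + 3) / 4 = n by omega, show (4 * n + 3) % 4 = 3 by omega]; rfl
theorem Zm4 (n : ℕ) : Zm q x s (4 * n + 3 + 1) = z0 (q (n + 1)) (x (n + 1)) (s (n + 1)) := by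
  rw [show 4 * n + 3 + 1 = 4 * (n + 1) by ring, Zm0]
theorem Vm0 (n : ℕ) : Vm q φ (4 * n) = v0 (q n) (φ n) := by
  unfold Vm; rw [show 4 * n / 4 = n by omega, show 4 * n % 4 = 0 by omega]; rfl
theorem Vm1 (n : ℕ) : Vm q φ (4 * n + 1) = v1 := by
  unfold Vm; rw [show (4 * n + 1) / 4 = n by omega, show (4 * n + 1) % 4 = 1 by omega]; rfl
theorem Vm2 (n : ℕ) : Vm q φ (4 * n + 2) = v2 (q (n + 1)) := by
  unfold Vm; rw [show (4 * n + 2) / 4 = n by omega, show (4 * n + 2) % 4 = 2 by omega]; rfl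
theorem Vm3 (n : ℕ) : Vm q φ (4 * n + 3) = v3 := by
  unfold Vm; rw [show (4 * n + 3) / 4 = n by omega, show (4 * n + 3) % 4 = 3 by omega]; rfl
theorem tm0 (n : ℕ) : tm s (4 * n) = s n := by
  unfold tm; rw [show 4 * n / 4 = n by omega, show 4 * n % 4 = 0 by omega]; rfl
theorem tm1 (n : ℕ) : tm s (4 * n + 1) = s (n + 1) := by
  unfold tm; rw [show (4 * n + 1) / 4 = n by omega, show (4 * n + 1) % 4 = 1 by omega]; rfl
theorem tm2 (n : ℕ) : tm s (4 * n + 2) = s (n + 1) := by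
  unfold tm; rw [show (4 * n + 2) / 4 = n by omega, show (4 * n + 2) % 4 = 2 by omega]; rfl
theorem tm3 (n : ℕ) : tm s (4 * n + 3) = s (n + 1) := by
  unfold tm; rw [show (4 * n + 3) / 4 = n by omega, show (4 * n + 3) % 4 = 3 by omega]; rfl

theorem tmpos (h : Run M q x s φ) (m : ℕ) : 0 < tm s m := by
  obtain ⟨n, rfl | rfl | rfl | rfl⟩ := ex4 m
  · rw [tm0]; exact h.spos _
  · rw [tm1]; exact h.spos _
  · rw [tm2]; exact h.spos _
  · rw [tm3]; exact h.spos _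

theorem sum_tm (h : Run M q x s φ) (n : ℕ) :
    ∑ i ∈ Finset.range n, s i ≤ ∑ i ∈ Finset.range (4 * n), tm s i := by
  induction n with
  | zero => simp
  | succ n ih =>
    rw [show 4 * (n + 1) = 4 * n + 3 + 1 by ring, Finset.sum_range_succ, Finset.sum_range_succ,
      Finset.sum_range_succ, Finset.sum_range_succ, Finset.sum_range_succ, tm0, tm1, tm2, tm3]
    linarith [h.spos (n + 1)]

theorem traj (h : Run M q x s φ)
    (hT : Filter.Tendsto (fun n => ∑ i ∈ Finset.range n, s i) Filter.atTop Filter.atTop) :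
    SkTraj (M.RR ℝ) (th ℝ) (Zm q x s) (Vm q φ) (tm s) (fun m => ∑ i ∈ Finset.range m, tm s i) where
  Znn m j := by
    obtain ⟨n, rfl | rfl | rfl | rfl⟩ := ex4 m
    · rw [Zm0]; exact z0nn _ _ _ (h.spos _) (h.xnn _) j
    · rw [Zm1]; exact z1nn _ _ _ (h.spos _) (h.xnn _) j
    · rw [Zm2]; exact z2nn _ _ _ (h.spos _) (h.xnn _) j
    · rw [Zm3]; exact z3nn _ _ _ (h.spos _) (h.xnn _) j
  vnn m j := by
    obtain ⟨n, rfl | rfl | rfl | rfl⟩ := ex4 m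
    · rw [Vm0]; rcases j with k | j | k | j <;> (try fin_cases k) <;> simp [v0] <;>
        split_ifs <;> norm_num
    · rw [Vm1]; rcases j with k | j | k | j <;> (try fin_cases k) <;> simp [v1]
    · rw [Vm2]; rcases j with k | j | k | j <;> (try fin_cases k) <;> simp [v2] <;>
        split_ifs <;> norm_num
    · rw [Vm3]; rcases j with k | j | k | j <;> (try fin_cases k) <;> simp [v3]
  τpos := tmpos h
  T0 := by simp
  Ts m := by simp [Finset.sum_range_succ]
  Tinf := by
    apply Filter.tendsto_atTop_atTop_of_monotone
    · apply monotone_nat_of_le_succ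
      intro m
      rw [Finset.sum_range_succ]
      linarith [tmpos h m]
    · intro b
      obtain ⟨n, hn⟩ := (hT.eventually_ge_atTop b).exists
      exact ⟨4 * n, hn.trans (sum_tm h n)⟩
  step m j := by
    obtain ⟨n, rfl | rfl | rfl | rfl⟩ := ex4 m
    · rw [Zm0, Zm1, tm0, Vm0]; exact step0 h n j
    · rw [Zm1, Zm2, tm1, Vm1]; exact step1 _ _ _ j
    · rw [Zm2, Zm3, tm2, Vm2]; exact step2 _ _ _ j
    · rw [Zm3, Zm4, tm3, Vm3]; exact step3 _ _ _ j
  comp m j hv := by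
    obtain ⟨n, rfl | rfl | rfl | rfl⟩ := ex4 m
    · rw [Vm0] at hv; rw [Zm0, Zm1]; exact comp0 h n j hv
    · rw [Vm1] at hv; rw [Zm1, Zm2]; exact comp1 _ _ _ j hv
    · rw [Vm2] at hv; rw [Zm2, Zm3]; exact comp2 _ _ _ j hv
    · rw [Vm3] at hv; rw [Zm3, Zm4]; exact comp3 _ _ _ j hv
  diag j := by
    rcases j with k | j | k | j <;> (try fin_cases k) <;> simp [RR, AA]
  acyc m := by
    obtain ⟨n, rfl | rfl | rfl | rfl⟩ := ex4 m
    · rw [Zm0]; exact ⟨_, fun j k => ac0 M _ _ _ (h.spos _) j k⟩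
    · rw [Zm1]; exact ⟨_, fun j k => ac1 M _ _ _ (h.spos _) j k⟩
    · rw [Zm2]; exact ⟨_, fun j k => ac2 M _ _ _ (h.spos _) j k⟩
    · rw [Zm3]; exact ⟨_, fun j k => ac3 M _ _ _ (h.spos _) j k⟩

def bd (x : ℕ → K → ℝ) (s : ℕ → ℝ) (n : ℕ) : ℝ := 3 * s n + ∑ k, x n k

theorem Zm_le (h : Run M q x s φ) (m : ℕ) (j : Ix S K) :
    Zm q x s m j ≤ bd x s (m / 4) + bd x s (m / 4 + 1) := by
  have hX : ∀ n k, x n k ≤ ∑ k, x n k := fun n k =>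
    Finset.single_le_sum (f := fun k => x n k) (fun k _ => h.xnn n k) (Finset.mem_univ k)
  have hX0 : ∀ n, 0 ≤ ∑ k, x n k := fun n => Finset.sum_nonneg (fun k _ => h.xnn n k)
  unfold bd
  obtain ⟨n, rfl | rfl | rfl | rfl⟩ := ex4 m
  · rw [Zm0, show 4 * n / 4 = n by omega]
    have s1 := h.spos n
    have s2 := h.spos (n + 1)
    have x1 := hX0 n
    have x2 := hX0 (n + 1)
    rcases j with k | j | k | j <;> (try fin_cases k) <;> simp [z0] <;> (try split_ifs) <;>
      (try linarith)
    linarith [hX n k]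
  · rw [Zm1, show (4 * n + 1) / 4 = n by omega]
    have s1 := h.spos n
    have s2 := h.spos (n + 1)
    have x1 := hX0 n
    have x2 := hX0 (n + 1)
    rcases j with k | j | k | j <;> (try fin_cases k) <;> simp [z1] <;> (try split_ifs) <;>
      (try linarith)
    linarith [hX (n + 1) k]
  · rw [Zm2, show (4 * n + 2) / 4 = n by omega]
    have s1 := h.spos n
    have s2 := h.spos (n + 1)
    have x1 := hX0 n
    have x2 := hX0 (n + 1)
    rcases j with k | j | k | j <;> (try fin_cases k) <;> simp [z2] <;> (try split_ifs) <;>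
      (try linarith)
    linarith [hX (n + 1) k]
  · rw [Zm3, show (4 * n + 3) / 4 = n by omega]
    have s1 := h.spos n
    have s2 := h.spos (n + 1)
    have x1 := hX0 n
    have x2 := hX0 (n + 1)
    rcases j with k | j | k | j <;> (try fin_cases k) <;> simp [z3] <;> (try split_ifs) <;>
      (try linarith)
    linarith [hX (n + 1) k]

theorem stable_of_run {κ : Type} [Fintype κ] (e : κ ≃ Ix S K) (h : Run M q x s φ)
    (hT : Filter.Tendsto (fun n => ∑ i ∈ Finset.range n, s i) Filter.atTop Filter.atTop)
    (hs : Filter.Tendsto s Filter.atTop (nhds 0))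
    (hx : ∀ k, Filter.Tendsto (fun n => x n k) Filter.atTop (nhds 0)) :
    FluidStable (fun i => z0 (q 0) (x 0) (s 0) (e i)) (fun i => th ℝ (e i))
      (fun i j => M.RR ℝ (e i) (e j)) := by
  have h1 := ((traj h hT).pull e)
  have h2 := h1.stable_iff
  have h3 : (fun i => Zm q x s 0 (e i)) = fun i => z0 (q 0) (x 0) (s 0) (e i) := by
    rw [show (0 : ℕ) = 4 * 0 from rfl, Zm0]
  rw [h3] at h2
  rw [h2, tendsto_pi_nhds]
  intro j
  have hb : Filter.Tendsto (bd x s) Filter.atTop (nhds 0) := by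
    have a1 : Filter.Tendsto (fun n => ∑ k, x n k) Filter.atTop (nhds (∑ k : K, (0 : ℝ))) :=
      tendsto_finsetSum _ (fun k _ => hx k)
    have a2 := (hs.const_mul 3).add a1
    have a3 : bd x s = fun n => 3 * s n + ∑ k, x n k := rfl
    rw [a3]
    simpa using a2
  have hdiv : Filter.Tendsto (fun m : ℕ => m / 4) Filter.atTop Filter.atTop :=
    Nat.tendsto_div_const_atTop (by norm_num)
  have hb1 := hb.comp hdiv
  have hb2 := hb.comp (Filter.tendsto_add_atTop_nat 1 |>.comp hdiv)
  have hb3 := hb1.add hb2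
  simp only [add_zero] at hb3
  exact squeeze_zero (fun m => h1.Znn m j) (fun m => Zm_le h m (e j)) hb3

theorem not_stable_of_run {κ : Type} [Fintype κ] (e : κ ≃ Ix S K) (h : Run M q x s φ)
    (hs : ∀ n, s n = 1) :
    ¬ FluidStable (fun i => z0 (q 0) (x 0) (s 0) (e i)) (fun i => th ℝ (e i))
      (fun i j => M.RR ℝ (e i) (e j)) := by
  have hT : Filter.Tendsto (fun n => ∑ i ∈ Finset.range n, s i) Filter.atTop Filter.atTop := by
    simp only [hs]
    simpa using tendsto_natCast_atTop_atTop
  have h1 := ((traj h hT).pull e)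
  have h2 := h1.stable_iff
  have h3 : (fun i => Zm q x s 0 (e i)) = fun i => z0 (q 0) (x 0) (s 0) (e i) := by
    rw [show (0 : ℕ) = 4 * 0 from rfl, Zm0]
  rw [h3] at h2
  rw [h2, tendsto_pi_nhds]
  intro hcon
  have h4 := hcon (e.symm (.inl 1))
  have h5 : Filter.Tendsto (fun n : ℕ => 4 * n) Filter.atTop Filter.atTop :=
    Filter.tendsto_id.const_mul_atTop' (by norm_num)
  have h6 := h4.comp h5
  have h7 : ((fun m => Zm q x s m (e (e.symm (.inl 1)))) ∘ fun n : ℕ => 4 * n) = fun _ => (1 : ℝ) := by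
    ext n
    simp [Zm0, z0, hs]
  rw [h7] at h6
  have := tendsto_nhds_unique h6 tendsto_const_nhds
  norm_num at this

def ww (S K : Type) [Fintype S] [Fintype K] : Ix S K → ℝ :=
  vec (fun _ => Fintype.card S + 1) (fun _ => 1) (fun _ => Fintype.card S + 1)
    (fun _ => 2 * Fintype.card S + Fintype.card K * (Fintype.card S + 1) + 1)

theorem completelyS {κ : Type} [Fintype κ] [DecidableEq κ] (e : κ ≃ Ix S K) (M : FM S K) :
    IsCompletelyS (fun i j => M.RR ℝ (e i) (e j)) := by
  apply sk_completelyS_pull e (M.RR ℝ) (ww S K)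
  · intro i
    rcases i with k | j | k | j <;> simp [ww] <;> positivity
  intro i
  have hdiag : M.RR ℝ i i = 1 := by
    rcases i with k | j | k | j <;> (try fin_cases k) <;> simp [RR, AA]
  rw [Finset.sum_erase _ (by rw [hdiag]; norm_num), hdiag, one_mul]
  have hS : ∀ (g : S → ℝ) (c : ℝ), (∀ q, g q ≤ c) → ∑ q, g q ≤ Fintype.card S * c := by
    intro g c hg
    calc ∑ q, g q ≤ ∑ q : S, c := Finset.sum_le_sum (fun q _ => hg q)
      _ = _ := by simp
  have hK : ∀ (g : K → ℝ) (c : ℝ), (∀ q, g q ≤ c) → ∑ q, g q ≤ Fintype.card K * c := by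
    intro g c hg
    calc ∑ q, g q ≤ ∑ q : K, c := Finset.sum_le_sum (fun q _ => hg q)
      _ = _ := by simp
  have hSn : (0 : ℝ) ≤ Fintype.card S := Nat.cast_nonneg _
  have hKn : (0 : ℝ) ≤ Fintype.card K := Nat.cast_nonneg _
  rw [Fintype.sum_sum_type, Fintype.sum_sum_type, Fintype.sum_sum_type]
  rcases i with k | j | k | j
  · have h1 := hS (fun q => max (-(M.RR ℝ (.inl k) (.inr (.inl q)))) 0 * ww S K (.inr (.inl q))) (1/2)
      (by intro q; fin_cases k <;> simp [RR, ww] <;> split_ifs <;> norm_num)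
    have h0 : ∑ l, max (-(M.RR ℝ (.inl k) (.inl l))) 0 * ww S K (.inl l) = 0 := by
      apply Finset.sum_eq_zero; intro l _
      fin_cases k <;> fin_cases l <;> simp [RR, AA]
    have h2 : ∑ l, max (-(M.RR ℝ (.inl k) (.inr (.inr (.inl l))))) 0 * ww S K (.inr (.inr (.inl l))) = 0 := by
      simp [RR]
    have h3 : ∑ l, max (-(M.RR ℝ (.inl k) (.inr (.inr (.inr l))))) 0 * ww S K (.inr (.inr (.inr l))) = 0 := by
      simp [RR]
    rw [h0, h2, h3]
    have : ww S K (.inl k) = Fintype.card S + 1 := rfl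
    rw [this]
    linarith
  · have h0 : ∑ l, max (-(M.RR ℝ (.inr (.inl j)) (.inl l))) 0 * ww S K (.inl l) = 0 := by
      apply Finset.sum_eq_zero; intro l _
      fin_cases l <;> simp [RR]
    have h1 : ∑ l, max (-(M.RR ℝ (.inr (.inl j)) (.inr (.inl l)))) 0 * ww S K (.inr (.inl l)) = 0 := by
      apply Finset.sum_eq_zero; intro l _
      simp only [RR]; split_ifs <;> simp
    have h2 : ∑ l, max (-(M.RR ℝ (.inr (.inl j)) (.inr (.inr (.inl l))))) 0 * ww S K (.inr (.inr (.inl l))) = 0 := by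
      simp [RR]
    have h3 : ∑ l, max (-(M.RR ℝ (.inr (.inl j)) (.inr (.inr (.inr l))))) 0 * ww S K (.inr (.inr (.inr l))) = 0 := by
      apply Finset.sum_eq_zero; intro l _
      simp only [RR]; split_ifs <;> simp
    rw [h0, h1, h2, h3]
    simp [ww]
  · have h0 : ∑ l, max (-(M.RR ℝ (.inr (.inr (.inl k))) (.inl l))) 0 * ww S K (.inl l) = 0 := by
      simp [RR]
    have h1 := hS (fun l => max (-(M.RR ℝ (.inr (.inr (.inl k))) (.inr (.inl l)))) 0 * ww S K (.inr (.inl l))) 1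
      (by
        intro l
        have : (-1 : ℝ) ≤ M.u l k := by exact_mod_cast M.u_ge l k
        simp [RR, ww]; linarith)
    have h2 : ∑ l, max (-(M.RR ℝ (.inr (.inr (.inl k))) (.inr (.inr (.inl l))))) 0 * ww S K (.inr (.inr (.inl l))) = 0 := by
      apply Finset.sum_eq_zero; intro l _
      simp only [RR]; split_ifs <;> simp
    have h3 : ∑ l, max (-(M.RR ℝ (.inr (.inr (.inl k))) (.inr (.inr (.inr l))))) 0 * ww S K (.inr (.inr (.inr l))) = 0 := by
      simp [RR]
    rw [h0, h2, h3]
    have : ww S K (.inr (.inr (.inl k))) = Fintype.card S + 1 := rfl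
    rw [this]
    linarith
  · have h0 : ∑ l, max (-(M.RR ℝ (.inr (.inr (.inr j))) (.inl l))) 0 * ww S K (.inl l) = 0 := by
      apply Finset.sum_eq_zero; intro l _
      fin_cases l <;> simp [RR]
    have h1 := hS (fun l => max (-(M.RR ℝ (.inr (.inr (.inr j))) (.inr (.inl l)))) 0 * ww S K (.inr (.inl l))) 2
      (by intro l; simp only [RR, ww, lam]; split_ifs <;> norm_num)
    have h2 := hK (fun l => max (-(M.RR ℝ (.inr (.inr (.inr j))) (.inr (.inr (.inl l))))) 0 * ww S K (.inr (.inr (.inl l)))) (Fintype.card S + 1)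
      (by
        intro l
        have hw : ww S K (.inr (.inr (.inl l))) = Fintype.card S + 1 := rfl
        rw [hw]
        have : max (-(M.RR ℝ (.inr (.inr (.inr j))) (.inr (.inr (.inl l))))) 0 ≤ 1 := by
          simp only [RR]; split_ifs <;> norm_num
        nlinarith)
    have h3 : ∑ l, max (-(M.RR ℝ (.inr (.inr (.inr j))) (.inr (.inr (.inr l))))) 0 * ww S K (.inr (.inr (.inr l))) = 0 := by
      apply Finset.sum_eq_zero; intro l _
      simp only [RR]; split_ifs <;> simp
    rw [h0, h3]
    have : ww S K (.inr (.inr (.inr j))) = 2 * Fintype.card S + Fintype.card K * (Fintype.card S + 1) + 1 := rfl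
    rw [this]
    linarith

end FM

set_option linter.unusedSectionVars false
set_option linter.unnecessarySeqFocus false
set_option linter.unusedVariables false
set_option linter.unusedSimpArgs false

/-- Instructions of a register machine with a global scale. -/
inductive Ins (Q : Type) where
  | inc (r : ℕ) (q : Q)
  | dec (r : ℕ) (q1 q2 : Q)
  | halve (q : Q)

namespace Ins

def map {Q Q' : Type} (f : Q → Q') : Ins Q → Ins Q'
  | inc r q => inc r (f q)
  | dec r q1 q2 => dec r (f q1) (f q2)
  | halve q => halve (f q)

def reg {Q : Type} : Ins Q → Option ℕ
  | dec r _ _ => some r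
  | _ => none

theorem reg_dec {Q : Type} (r : ℕ) (q1 q2 : Q) : (dec r q1 q2).reg = some r := rfl
theorem reg_inc {Q : Type} (r : ℕ) (q1 : Q) : (inc r q1).reg = none := rfl
theorem reg_halve {Q : Type} (q1 : Q) : (halve q1).reg = none := rfl

/-- The fluid machine of a register machine. -/
def fm {Q : Type} [DecidableEq Q] (I : Q → Ins Q) : FM (Q × Bool) Q where
  nxt p := match I p.1, p.2 with
    | inc _ q', false => (q', false)
    | dec _ _ _, false => (p.1, true)
    | halve q', false => (q', false)
    | dec _ q1 _, true => (q1, false)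
    | _, true => (p.1, false)
  alt k := match I k with
    | dec _ _ q2 => (q2, false)
    | _ => (k, false)
  tst k := (k, false)
  u p k := match I p.1, p.2 with
    | inc r _, false => if (I k).reg = some r then 1 else 0
    | dec _ _ _, false => if k = p.1 then -1 else 0
    | dec r _ _, true => if k ≠ p.1 ∧ (I k).reg = some r then -1 else 0
    | _, _ => 0
  hv p := match I p.1, p.2 with
    | halve _, false => true
    | _, _ => false
  u_ge p k := by
    rcases p with ⟨q, b⟩
    cases I q <;> cases b <;> simp only <;> (try split_ifs) <;> norm_num

/-- Data: registers and scale exponent. -/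
abbrev Dat := (ℕ → ℕ) × ℕ

/-- Configurations. -/
structure FC (Q : Type) where
  q : Q
  b : Bool
  d : Dat

def dinc (d : Dat) (r : ℕ) : Dat := (Function.update d.1 r (d.1 r + 1), d.2)
def ddec (d : Dat) (r : ℕ) : Dat := (Function.update d.1 r (d.1 r - 1), d.2)
def dhalve (d : Dat) : Dat := (fun r => 2 * d.1 r, d.2 + 1)
noncomputable def sc (d : Dat) : ℝ := (1 / 2) ^ d.2

def fstep {Q : Type} (I : Q → Ins Q) (c : FC Q) : FC Q :=
  match I c.q, c.b with
  | inc r q', false => ⟨q', false, dinc c.d r⟩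
  | dec r _ q2, false => if c.d.1 r = 0 then ⟨q2, false, c.d⟩ else ⟨c.q, true, ddec c.d r⟩
  | halve q', false => ⟨q', false, dhalve c.d⟩
  | dec _ q1 _, true => ⟨q1, false, c.d⟩
  | _, true => ⟨c.q, false, c.d⟩

def ffire {Q : Type} (I : Q → Ins Q) (c : FC Q) : Option Q :=
  match I c.q, c.b with
  | dec r _ _, false => if c.d.1 r = 0 then some c.q else none
  | _, _ => none

def fT {Q : Type} [DecidableEq Q] (I : Q → Ins Q) (c : FC Q) (k : Q) : ℕ :=
  match (I k).reg with
  | some r => c.d.1 r + (if c.b = true ∧ k ≠ c.q ∧ (I c.q).reg = some r then 1 else 0)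
  | none => 0

noncomputable def fx {Q : Type} [DecidableEq Q] (I : Q → Ins Q) (c : FC Q) (k : Q) : ℝ :=
  sc c.d * fT I c k

theorem sc_pos (d : Dat) : 0 < sc d := by unfold sc; positivity

section
variable {Q : Type} [DecidableEq Q] (I : Q → Ins Q)

theorem fstep_sc (c : FC Q) : sc (fstep I c).d = sc c.d * (fm I).lam ℝ (c.q, c.b) := by
  rcases c with ⟨q, b, d⟩
  cases hI : I q <;> cases b <;> simp [fstep, hI, fm, FM.lam, sc, dinc, ddec, dhalve, pow_succ]
  split_ifs <;> simp

theorem fstep_x (c : FC Q) (k : Q) : fx I (fstep I c) k = fx I c k +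
    sc c.d * (((fm I).u (c.q, c.b) k : ℝ) + if ffire I c = some k then 1 else 0) := by
  have h := fstep_sc I c
  unfold fx
  rw [h]
  rcases c with ⟨q, b, d⟩
  have hs := sc_pos d
  have key : (fm I).lam ℝ (q, b) * (fT I (fstep I ⟨q, b, d⟩) k : ℝ) = fT I ⟨q, b, d⟩ k +
      (((fm I).u (q, b) k : ℝ) + if ffire I ⟨q, b, d⟩ = some k then 1 else 0) := by
    cases b with
    | false =>
      cases hI : I q with
      | inc r q' =>
        cases hk : (I k).reg with
        | none => simp [fm, FM.lam, fstep, hI, fT, hk, ffire]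
        | some r' =>
          by_cases hr : r' = r
          · subst hr
            simp [fm, FM.lam, fstep, hI, fT, hk, ffire, dinc]
          · simp [fm, FM.lam, fstep, hI, fT, hk, ffire, dinc, hr]
      | halve q' =>
        cases hk : (I k).reg with
        | none => simp [fm, FM.lam, fstep, hI, fT, hk, ffire]
        | some r' => simp [fm, FM.lam, fstep, hI, fT, hk, ffire, dhalve]
      | dec r q1 q2 =>
        by_cases h0 : d.1 r = 0
        · by_cases hkq : k = q
          · subst hkq
            simp [fm, FM.lam, fstep, hI, fT, ffire, h0]
          · have hkq' : ¬ q = k := fun e => hkq e.symm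
            simp [fm, FM.lam, fstep, hI, fT, ffire, h0, hkq, hkq']
        · by_cases hkq : k = q
          · subst hkq
            have : 1 ≤ d.1 r := by omega
            simp [fm, FM.lam, fstep, hI, fT, ffire, h0, ddec, reg_dec, reg_inc, reg_halve, Nat.cast_sub this]
            ring
          · cases hk : (I k).reg with
            | none => simp [fm, FM.lam, fstep, hI, fT, hk, ffire, h0, hkq]
            | some r' =>
              by_cases hr : r = r'
              · subst hr
                have : 1 ≤ d.1 r := by omega
                simp [fm, FM.lam, fstep, hI, fT, hk, ffire, h0, hkq, ddec, reg_dec, reg_inc, reg_halve, Nat.cast_sub this]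
              · have hr' : ¬ r' = r := fun e => hr e.symm
                simp [fm, FM.lam, fstep, hI, fT, hk, ffire, h0, hkq, ddec, reg_dec, reg_inc, reg_halve, hr, hr']
    | true =>
      cases hI : I q with
      | inc r q' =>
        cases hk : (I k).reg with
        | none => simp [fm, FM.lam, fstep, hI, fT, hk, ffire]
        | some r' => simp [fm, FM.lam, fstep, hI, fT, hk, ffire, reg_dec, reg_inc, reg_halve]
      | halve q' =>
        cases hk : (I k).reg with
        | none => simp [fm, FM.lam, fstep, hI, fT, hk, ffire]
        | some r' => simp [fm, FM.lam, fstep, hI, fT, hk, ffire, reg_dec, reg_inc, reg_halve]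
      | dec r q1 q2 =>
        cases hk : (I k).reg with
        | none => simp [fm, FM.lam, fstep, hI, fT, hk, ffire]
        | some r' =>
          by_cases hr : r' = r
          · subst hr
            by_cases hkq : k = q
            · simp [fm, FM.lam, fstep, hI, fT, hk, ffire, reg_dec, reg_inc, reg_halve, hkq]
            · simp [fm, FM.lam, fstep, hI, fT, hk, ffire, reg_dec, reg_inc, reg_halve, hkq]
          · have hr' : ¬ r = r' := fun e => hr e.symm
            simp [fm, FM.lam, fstep, hI, fT, hk, ffire, reg_dec, reg_inc, reg_halve, hr, hr']
  simp only at h ⊢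
  linear_combination sc d * key

theorem run (c0 : FC Q) : FM.Run (fm I)
    (fun n => (((fstep I)^[n] c0).q, ((fstep I)^[n] c0).b))
    (fun n => fx I ((fstep I)^[n] c0)) (fun n => sc ((fstep I)^[n] c0).d)
    (fun n => ffire I ((fstep I)^[n] c0)) where
  spos n := sc_pos _
  xnn n k := mul_nonneg (sc_pos _).le (Nat.cast_nonneg _)
  ssucc n := by rw [Function.iterate_succ_apply', fstep_sc]
  xsucc n k := by rw [Function.iterate_succ_apply', fstep_x]
  fire n k := by
    rw [Function.iterate_succ_apply', fstep_x]
    generalize (fstep I)^[n] c0 = c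
    rcases c with ⟨q, b, d⟩
    intro hf
    rw [if_pos hf]
    simp only [ffire] at hf
    cases b <;> cases hI : I q <;> simp [hI] at hf
    obtain ⟨h1, rfl⟩ := hf
    simp [fm, hI, fx, fT, reg, h1]
  qnone n := by
    rw [Function.iterate_succ_apply']
    generalize (fstep I)^[n] c0 = c
    rcases c with ⟨q, b, d⟩
    cases b <;> cases hI : I q <;> simp [ffire, hI, fstep, fm]
    intro hr
    simp [hr]
  qsome n k := by
    rw [Function.iterate_succ_apply']
    generalize (fstep I)^[n] c0 = c
    rcases c with ⟨q, b, d⟩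
    cases b <;> cases hI : I q <;> simp [ffire, hI, fstep, fm]
    rintro hr rfl
    simp [hr, hI]

/-- Reachability with good intermediate configurations and a time lower bound. -/
def Reach (G : Dat → Prop) (t : ℝ) (c c' : FC Q) : Prop :=
  ∃ N, (fstep I)^[N] c = c' ∧ t ≤ ∑ i ∈ Finset.range N, sc ((fstep I)^[i] c).d ∧
    ∀ i < N, G ((fstep I)^[i] c).d

variable {I}
theorem Reach.trans {G : Dat → Prop} {t t' : ℝ} {c c' c'' : FC Q} (h : Reach I G t c c')
    (h' : Reach I G t' c' c'') : Reach I G (t + t') c c'' := by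
  obtain ⟨N, h1, h2, h3⟩ := h
  obtain ⟨N', h1', h2', h3'⟩ := h'
  have key : ∀ i, (fstep I)^[N + i] c = (fstep I)^[i] c' := by
    intro i
    rw [add_comm, Function.iterate_add_apply, h1]
  refine ⟨N + N', by rw [key, h1'], ?_, ?_⟩
  · rw [Finset.sum_range_add]
    simp only [key]
    linarith
  · intro i hi
    by_cases hN : i < N
    · exact h3 i hN
    · obtain ⟨j, rfl⟩ := Nat.exists_eq_add_of_le (not_lt.1 hN)
      rw [key]
      exact h3' j (by omega)

theorem Reach.mono {G G' : Dat → Prop} {t t' : ℝ} {c c' : FC Q} (h : Reach I G t c c')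
    (hG : ∀ d, G d → G' d) (ht : t' ≤ t) : Reach I G' t' c c' := by
  obtain ⟨N, h1, h2, h3⟩ := h
  exact ⟨N, h1, ht.trans h2, fun i hi => hG _ (h3 i hi)⟩

theorem Reach.one {G : Dat → Prop} {c c' : FC Q} (h : fstep I c = c') (hG : G c.d) :
    Reach I G (sc c.d) c c' :=
  ⟨1, by simpa using h, by simp, by
    intro i hi
    have : i = 0 := by omega
    subst this
    exact hG⟩
end

end Ins

set_option linter.unusedSectionVars false
set_option linter.unnecessarySeqFocus false
set_option linter.unusedVariables false
set_option linter.unusedSimpArgs false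

open Ins

/-- Structured programs. -/
inductive Prog where
  | inc (r : ℕ)
  | dec (r : ℕ)
  | halve
  | seq (P Q : Prog)
  | loop (r : ℕ) (P : Prog)

namespace Prog

def St : Prog → Type
  | inc _ => Unit
  | dec _ => Unit
  | halve => Unit
  | seq P Q => St P ⊕ St Q
  | loop _ P => Option (St P)

theorem finite_St : (P : Prog) → Finite (St P)
  | inc _ => inferInstanceAs (Finite Unit)
  | dec _ => inferInstanceAs (Finite Unit)
  | halve => inferInstanceAs (Finite Unit)
  | seq P Q => by
    have := finite_St P
    have := finite_St Q
    exact inferInstanceAs (Finite (St P ⊕ St Q))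
  | loop _ P => by
    have := finite_St P
    exact inferInstanceAs (Finite (Option (St P)))

noncomputable instance (P : Prog) : Fintype (St P) := by
  have := finite_St P
  exact Fintype.ofFinite _

noncomputable instance (P : Prog) : DecidableEq (St P) := Classical.decEq _

def start : (P : Prog) → St P
  | inc _ => ()
  | dec _ => ()
  | halve => ()
  | seq P _ => Sum.inl (start P)
  | loop _ _ => none

def instr : (P : Prog) → St P → Ins (Option (St P))
  | inc r => fun _ => .inc r none
  | dec r => fun _ => .dec r none none
  | halve => fun _ => .halve none
  | seq P Q => fun q => match q with
    | Sum.inl q => (instr P q).map (fun o => o.elim (some (Sum.inr (start Q))) (fun q => some (Sum.inl q)))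
    | Sum.inr q => (instr Q q).map (fun o => o.map Sum.inr)
  | loop r P => fun q => match q with
    | none => .dec r (some (some (start P))) none
    | some q => (instr P q).map (fun o => o.elim (some none) (fun q => some (some q)))

/-- `P` occurs inside the machine `I` via `f` with exit `x`. -/
def Emb (P : Prog) {Q : Type} (I : Q → Ins Q) (f : St P → Q) (x : Q) : Prop :=
  ∀ q, I (f q) = (instr P q).map (fun o => o.elim x f)

theorem map_map {A B C : Type} (i : Ins A) (f : A → B) (g : B → C) :
    (i.map f).map g = i.map (fun a => g (f a)) := by cases i <;> rfl

theorem Emb.left {P P' : Prog} {Q : Type} {I : Q → Ins Q} {f : St (seq P P') → Q} {x : Q}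
    (h : Emb (seq P P') I f x) : Emb P I (fun q => f (Sum.inl q)) (f (Sum.inr (start P'))) := by
  intro q
  have := h (Sum.inl q)
  rw [this]
  simp only [instr]
  rw [map_map]
  congr 1
  funext o
  cases o <;> rfl

theorem Emb.right {P P' : Prog} {Q : Type} {I : Q → Ins Q} {f : St (seq P P') → Q} {x : Q}
    (h : Emb (seq P P') I f x) : Emb P' I (fun q => f (Sum.inr q)) x := by
  intro q
  have := h (Sum.inr q)
  rw [this]
  simp only [instr]
  rw [map_map]
  congr 1
  funext o
  cases o <;> rfl

theorem Emb.body {r : ℕ} {P : Prog} {Q : Type} {I : Q → Ins Q} {f : St (loop r P) → Q} {x : Q}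
    (h : Emb (loop r P) I f x) : Emb P I (fun q => f (some q)) (f none) := by
  intro q
  have := h (some q)
  rw [this]
  simp only [instr]
  rw [map_map]
  congr 1
  funext o
  cases o <;> rfl

def mach (P : Prog) : St P → Ins (St P) := fun q => (instr P q).map (fun o => o.elim (start P) id)

theorem emb_mach (P : Prog) : Emb P (mach P) id (start P) := fun q => rfl

/-- Big step semantics with good states and elapsed time. -/
inductive Exec (G : Dat → Prop) : Prog → ℝ → Dat → Dat → Prop where
  | inc (r : ℕ) (d : Dat) : G d → Exec G (inc r) (sc d) d (dinc d r)
  | dec (r : ℕ) (d : Dat) : G d → Exec G (dec r) (sc d) d (ddec d r)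
  | halve (d : Dat) : G d → Exec G halve (sc d) d (dhalve d)
  | seq {P Q : Prog} {t t' : ℝ} {d d' d'' : Dat} : Exec G P t d d' → Exec G Q t' d' d'' →
      Exec G (seq P Q) (t + t') d d''
  | loop0 (r : ℕ) (P : Prog) (d : Dat) : G d → d.1 r = 0 → Exec G (loop r P) (sc d) d d
  | loopS {r : ℕ} {P : Prog} {t t' : ℝ} {d d' d'' : Dat} : G d → d.1 r ≠ 0 →
      Exec G P t (ddec d r) d' → Exec G (loop r P) t' d' d'' →
      Exec G (loop r P) (sc d + t + t') d d''

theorem ddec_zero (d : Dat) (r : ℕ) (h : d.1 r = 0) : ddec d r = d := by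
  unfold ddec
  rw [h]
  have : Function.update d.1 r (0 - 1) = d.1 := by
    rw [Function.update_eq_self_iff, h]
  rw [this]

section
variable {Q : Type} [DecidableEq Q] {I : Q → Ins Q} {G : Dat → Prop}

theorem reach_dec_pos (hG : ∀ d r, G d → G (ddec d r)) {q q1 q2 : Q} {r : ℕ}
    (h : I q = .dec r q1 q2) (d : Dat) (hd : G d) (h0 : d.1 r ≠ 0) :
    Reach I G (sc d) ⟨q, false, d⟩ ⟨q1, false, ddec d r⟩ := by
  have h1 : Reach I G (sc d) ⟨q, false, d⟩ ⟨q, true, ddec d r⟩ :=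
    Reach.one (by simp [fstep, h, h0]) hd
  have h2 : Reach I G (sc (ddec d r)) ⟨q, true, ddec d r⟩ ⟨q1, false, ddec d r⟩ :=
    Reach.one (by simp [fstep, h]) (hG _ _ hd)
  exact (h1.trans h2).mono (fun _ h => h) (by linarith [sc_pos (ddec d r)])

theorem reach_dec_zero {q q1 q2 : Q} {r : ℕ}
    (h : I q = .dec r q1 q2) (d : Dat) (hd : G d) (h0 : d.1 r = 0) :
    Reach I G (sc d) ⟨q, false, d⟩ ⟨q2, false, d⟩ :=
  Reach.one (by simp [fstep, h, h0]) hd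

theorem exec_reach (hG : ∀ d r, G d → G (ddec d r)) {P : Prog} {t : ℝ} {d d' : Dat}
    (h : Exec G P t d d') : ∀ (f : St P → Q) (x : Q), Emb P I f x →
    Reach I G t ⟨f (start P), false, d⟩ ⟨x, false, d'⟩ := by
  induction h with
  | inc r d hd =>
    intro f x hE
    have hI : I (f (start (.inc r))) = .inc r x := hE (start (.inc r))
    exact Reach.one (by simp [fstep, hI]) hd
  | dec r d hd =>
    intro f x hE
    have hI : I (f (start (.dec r))) = .dec r x x := hE (start (.dec r))
    by_cases h0 : d.1 r = 0
    · rw [ddec_zero d r h0]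
      exact reach_dec_zero hI d hd h0
    · exact reach_dec_pos hG hI d hd h0
  | halve d hd =>
    intro f x hE
    have hI : I (f (start .halve)) = .halve x := hE (start .halve)
    exact Reach.one (by simp [fstep, hI]) hd
  | seq h1 h2 ih1 ih2 =>
    intro f x hE
    exact (ih1 _ _ hE.left).trans (ih2 _ _ hE.right)
  | loop0 r P d hd h0 =>
    intro f x hE
    have hI : I (f (start (.loop r P))) = .dec r (f (some (start P))) x := hE (start (.loop r P))
    exact reach_dec_zero hI d hd h0
  | @loopS r P t t' d d' d'' hd h0 h1 h2 ih1 ih2 =>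
    intro f x hE
    have hI : I (f (start (.loop r P))) = .dec r (f (some (start P))) x := hE (start (.loop r P))
    exact ((reach_dec_pos hG hI d hd h0).trans (ih1 _ _ hE.body)).trans (ih2 _ _ hE)

/-- One full pass through a loop. -/
theorem loop_reach (hG : ∀ d r, G d → G (ddec d r)) {r : ℕ} {P : Prog} {t : ℝ} {d d' : Dat}
    (hd : G d) (h0 : d.1 r ≠ 0) (h : Exec G P t (ddec d r) d') (f : St (loop r P) → Q) (x : Q)
    (hE : Emb (loop r P) I f x) :
    Reach I G (sc d + t) ⟨f (start (loop r P)), false, d⟩ ⟨f (start (loop r P)), false, d'⟩ := by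
  have hI : I (f (start (.loop r P))) = .dec r (f (some (start P))) x := hE (start (.loop r P))
  exact (reach_dec_pos hG hI d hd h0).trans (exec_reach hG h _ _ hE.body)

theorem fstep_exp_mono (c : FC Q) : c.d.2 ≤ (fstep I c).d.2 := by
  rcases c with ⟨q, b, d⟩
  cases hI : I q <;> cases b <;> simp [fstep, hI, dinc, ddec, dhalve]
  split_ifs <;> simp

theorem exp_mono (c0 : FC Q) : Monotone (fun n => ((fstep I)^[n] c0).d.2) := by
  apply monotone_nat_of_le_succ
  intro n
  rw [Function.iterate_succ_apply']
  exact fstep_exp_mono _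

/-- Data bound. -/
def Gb (β : ℝ) (d : Dat) : Prop := sc d ≤ β ∧ ∀ r, sc d * d.1 r ≤ β

theorem Gb_dec (β : ℝ) (d : Dat) (r : ℕ) (h : Gb β d) : Gb β (ddec d r) := by
  refine ⟨h.1, fun r' => ?_⟩
  have h2 : ((ddec d r).1 r' : ℝ) ≤ d.1 r' := by
    unfold ddec
    by_cases hr : r' = r
    · subst hr; simp
    · simp [hr]
  have h1 : sc (ddec d r) = sc d := rfl
  rw [h1]
  exact (mul_le_mul_of_nonneg_left h2 (sc_pos d).le).trans (h.2 r')

theorem fx_le (β : ℝ) (c : FC Q) (h : Gb β c.d) (k : Q) : fx I c k ≤ 2 * β := by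
  have hs := sc_pos c.d
  unfold fx fT
  have h1 := h.1
  cases (I k).reg with
  | none => simp; linarith
  | some r =>
    have h2 := h.2 r
    simp only
    split_ifs
    · push_cast; linarith
    · push_cast; linarith

theorem reach_pos {t : ℝ} {c c' : FC Q} (ht : 0 < t) (h : Reach I G t c c') :
    ∃ N, 0 < N ∧ (fstep I)^[N] c = c' ∧ t ≤ ∑ i ∈ Finset.range N, sc ((fstep I)^[i] c).d ∧
    ∀ i < N, G ((fstep I)^[i] c).d := by
  obtain ⟨N, h1, h2, h3⟩ := h
  refine ⟨N, ?_, h1, h2, h3⟩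
  rcases Nat.eq_zero_or_pos N with rfl | h
  · simp at h2; linarith
  · exact h

/-- Infinitely many rounds. -/
theorem rounds {H : ℕ → FC Q} {β : ℕ → ℝ} {c0 : FC Q} {G0 : Dat → Prop} {t0 : ℝ} {τ : ℝ}
    (hτ : 0 < τ)
    (h0 : Reach I G0 t0 c0 (H 0)) (h : ∀ k, Reach I (Gb (β k)) τ (H k) (H (k + 1))) :
    ∃ M : ℕ → ℕ, StrictMono M ∧ (∀ k, (fstep I)^[M k] c0 = H k) ∧
      (∀ k : ℕ, k * τ ≤ ∑ i ∈ Finset.range (M k), sc ((fstep I)^[i] c0).d) ∧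
      (∀ k n, M k ≤ n → n < M (k + 1) → Gb (β k) ((fstep I)^[n] c0).d) := by
  obtain ⟨N0, h01, h02, h03⟩ := h0
  choose N hN1 hN2 hN3 hN4 using fun k => reach_pos hτ (h k)
  let M : ℕ → ℕ := fun k => N0 + ∑ i ∈ Finset.range k, N i
  have hMs : ∀ k, M (k + 1) = M k + N k := by
    intro k; simp only [M, Finset.sum_range_succ]; ring
  have hMH : ∀ k, (fstep I)^[M k] c0 = H k := by
    intro k
    induction k with
    | zero => simpa [M] using h01
    | succ k ih => rw [hMs, add_comm, Function.iterate_add_apply, ih, hN2]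
  have key : ∀ k i, (fstep I)^[M k + i] c0 = (fstep I)^[i] (H k) := by
    intro k i
    rw [add_comm, Function.iterate_add_apply, hMH]
  refine ⟨M, ?_, hMH, ?_, ?_⟩
  · apply strictMono_nat_of_lt_succ
    intro k
    rw [hMs]
    linarith [hN1 k]
  · intro k
    induction k with
    | zero =>
      simp only [Nat.cast_zero, zero_mul]
      exact Finset.sum_nonneg (fun i _ => (sc_pos _).le)
    | succ k ih =>
      rw [hMs, Finset.sum_range_add]
      simp only [key]
      push_cast
      linarith [hN3 k]
  · intro k n h1 h2
    obtain ⟨i, rfl⟩ := Nat.exists_eq_add_of_le h1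
    rw [key]
    exact hN4 k i (by rw [hMs] at h2; omega)

theorem halting_stable [Fintype Q] {κ : Type} [Fintype κ] (e : κ ≃ FM.Ix (Q × Bool) Q)
    {H : ℕ → FC Q} {β : ℕ → ℝ} {c0 : FC Q} {G0 : Dat → Prop} {t0 : ℝ} {τ : ℝ}
    (hτ : 0 < τ) (hβ : Antitone β) (hβ0 : Filter.Tendsto β Filter.atTop (nhds 0))
    (h0 : Reach I G0 t0 c0 (H 0)) (h : ∀ k, Reach I (Gb (β k)) τ (H k) (H (k + 1))) :
    FluidStable (fun i => FM.z0 (c0.q, c0.b) (fx I c0) (sc c0.d) (e i)) (fun i => FM.th ℝ (e i))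
      (fun i j => (fm I).RR ℝ (e i) (e j)) := by
  obtain ⟨M, hM, hMH, hMt, hMG⟩ := rounds hτ h0 h
  have hseg : ∀ k n, M k ≤ n → Gb (β k) ((fstep I)^[n] c0).d := by
    intro k n hn
    have hex : ∃ j, n < M j := ⟨n + 1, lt_of_lt_of_le (Nat.lt_succ_self n) (hM.id_le _)⟩
    classical
    have h1 := Nat.find_spec hex
    have hpos : k < Nat.find hex := by
      by_contra hcon
      have := hM.monotone (not_lt.1 hcon)
      omega
    have h2 := Nat.find_min hex (show Nat.find hex - 1 < Nat.find hex by omega)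
    have h3 := hMG (Nat.find hex - 1) n (not_lt.1 h2)
      (by rw [show Nat.find hex - 1 + 1 = Nat.find hex by omega]; exact h1)
    have h4 : β (Nat.find hex - 1) ≤ β k := hβ (by omega)
    exact ⟨h3.1.trans h4, fun r => (h3.2 r).trans h4⟩
  have hsmall : ∀ ε > 0, ∃ N, ∀ n ≥ N, Gb ε ((fstep I)^[n] c0).d := by
    intro ε hε
    obtain ⟨k, hk⟩ := (hβ0.eventually (gt_mem_nhds hε)).exists
    refine ⟨M k, fun n hn => ?_⟩
    have := hseg k n hn
    exact ⟨this.1.trans hk.le, fun r => (this.2 r).trans hk.le⟩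
  have hrun := run I c0
  refine FM.stable_of_run e hrun ?_ ?_ ?_
  · apply Filter.tendsto_atTop_atTop_of_monotone
    · apply monotone_nat_of_le_succ
      intro n
      rw [Finset.sum_range_succ]
      linarith [sc_pos ((fstep I)^[n] c0).d]
    · intro b
      obtain ⟨k, hk⟩ := exists_nat_ge (b / τ)
      refine ⟨M k, le_trans ?_ (hMt k)⟩
      rwa [div_le_iff₀ hτ] at hk
  · rw [Metric.tendsto_atTop]
    intro ε hε
    obtain ⟨N, hN⟩ := hsmall (ε / 2) (by linarith)
    refine ⟨N, fun n hn => ?_⟩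
    rw [Real.dist_eq, sub_zero, abs_of_pos (sc_pos _)]
    linarith [(hN n hn).1]
  · intro k
    rw [Metric.tendsto_atTop]
    intro ε hε
    obtain ⟨N, hN⟩ := hsmall (ε / 4) (by linarith)
    refine ⟨N, fun n hn => ?_⟩
    rw [Real.dist_eq, sub_zero, abs_of_nonneg (hrun.xnn n k)]
    linarith [fx_le (I := I) _ _ (hN n hn) k]

theorem looping_not_stable [Fintype Q] {κ : Type} [Fintype κ] (e : κ ≃ FM.Ix (Q × Bool) Q)
    {H : ℕ → FC Q} {c0 : FC Q} {G0 : Dat → Prop} {t0 : ℝ}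
    (h0 : Reach I G0 t0 c0 (H 0)) (h : ∀ k, Reach I (fun _ => True) 1 (H k) (H (k + 1)))
    (hH : ∀ k, (H k).d.2 = 0) :
    ¬ FluidStable (fun i => FM.z0 (c0.q, c0.b) (fx I c0) (sc c0.d) (e i)) (fun i => FM.th ℝ (e i))
      (fun i j => (fm I).RR ℝ (e i) (e j)) := by
  have hfreq : ∀ k : ℕ, ∃ n, k ≤ n ∧ (fstep I)^[n] c0 = H k := by
    intro k
    induction k with
    | zero =>
      obtain ⟨N, h1, _⟩ := h0
      exact ⟨N, Nat.zero_le _, h1⟩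
    | succ k ih =>
      obtain ⟨n, hn, hk⟩ := ih
      obtain ⟨N, hN, h1, _⟩ := reach_pos one_pos (h k)
      refine ⟨N + n, by omega, ?_⟩
      rw [Function.iterate_add_apply, hk, h1]
  refine FM.not_stable_of_run e (run I c0) ?_
  intro n
  obtain ⟨m, hm, hk⟩ := hfreq n
  have h1 := exp_mono (I := I) c0 hm
  simp only [hk, hH] at h1
  have h2 : ((fstep I)^[n] c0).d.2 = 0 := by omega
  simp [sc, h2]
end

end Prog

set_option linter.unusedSectionVars false
set_option linter.unnecessarySeqFocus false
set_option linter.unusedVariables false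
set_option linter.unusedSimpArgs false

open Ins

namespace Prog

/-- Terminating runs at scale one. -/
def R (P : Prog) (σ σ' : ℕ → ℕ) : Prop := ∃ t, Exec (fun _ => True) P t (σ, 0) (σ', 0)

theorem R.cast {P : Prog} {σ σ' τ : ℕ → ℕ} (h : R P σ σ') (e : σ' = τ) : R P σ τ := e ▸ h

theorem R_inc (r : ℕ) (σ : ℕ → ℕ) : R (inc r) σ (Function.update σ r (σ r + 1)) :=
  ⟨_, Exec.inc r (σ, 0) trivial⟩

theorem R_dec (r : ℕ) (σ : ℕ → ℕ) : R (dec r) σ (Function.update σ r (σ r - 1)) :=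
  ⟨_, Exec.dec r (σ, 0) trivial⟩

theorem R.seq {P Q : Prog} {σ σ' σ'' : ℕ → ℕ} (h : R P σ σ') (h' : R Q σ' σ'') :
    R (seq P Q) σ σ'' := by
  obtain ⟨t, h⟩ := h
  obtain ⟨t', h'⟩ := h'
  exact ⟨_, Exec.seq h h'⟩

theorem R_loop {r : ℕ} {P : Prog} (F : ℕ → ℕ → ℕ) (n : ℕ) (hr : ∀ m ≤ n, F m r = m)
    (hb : ∀ m < n, R P (Function.update (F (m + 1)) r m) (F m)) : R (loop r P) (F n) (F 0) := by
  induction n with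
  | zero => exact ⟨_, Exec.loop0 r P _ trivial (hr 0 le_rfl)⟩
  | succ n ih =>
    obtain ⟨t', h'⟩ := ih (fun m hm => hr m (by omega)) (fun m hm => hb m (by omega))
    obtain ⟨t, h⟩ := hb n (by omega)
    have h0 := hr (n + 1) le_rfl
    refine ⟨_, Exec.loopS (t := t) (d' := (F n, 0)) trivial (by simp [h0]) ?_ h'⟩
    simpa [ddec, h0] using h

def nop (r : ℕ) : Prog := seq (inc r) (dec r)

theorem R_nop (r : ℕ) (σ : ℕ → ℕ) : R (nop r) σ σ := by
  refine ((R_inc r σ).seq (R_dec r _)).cast ?_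
  simp

def clear (r : ℕ) : Prog := loop r (nop r)

theorem R_clear (r : ℕ) (σ : ℕ → ℕ) : R (clear r) σ (Function.update σ r 0) := by
  have h := R_loop (r := r) (P := nop r) (fun m => Function.update σ r m) (σ r)
    (fun m _ => by simp) (fun m _ => by simpa using R_nop r _)
  unfold clear
  simpa using h

def move (a c : ℕ) : Prog := loop a (inc c)

theorem R_move (a c : ℕ) (hac : a ≠ c) (σ : ℕ → ℕ) :
    R (move a c) σ (Function.update (Function.update σ c (σ c + σ a)) a 0) := by
  have h := R_loop (r := a) (P := inc c)
    (fun m => Function.update (Function.update σ c (σ c + (σ a - m))) a m) (σ a)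
    (fun m _ => by simp) (fun m hm => by
      refine (R_inc c _).cast ?_
      funext j
      simp only [Function.update_apply]
      grind)
  have h2 : (fun m => Function.update (Function.update σ c (σ c + (σ a - m))) a m) (σ a) = σ := by
    funext j
    simp only [Function.update_apply]
    grind
  beta_reduce at h2
  rw [h2] at h
  unfold move
  simpa using h

def copy (a c w : ℕ) : Prog := seq (loop a (seq (inc c) (inc w))) (move w a)

theorem R_copy (a c w : ℕ) (hac : a ≠ c) (haw : a ≠ w) (hcw : c ≠ w) (σ : ℕ → ℕ)
    (hc : σ c = 0) (hw : σ w = 0) : R (copy a c w) σ (Function.update σ c (σ a)) := by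
  have h := R_loop (r := a) (P := seq (inc c) (inc w))
    (fun m => Function.update (Function.update (Function.update σ c (σ a - m)) w (σ a - m)) a m) (σ a)
    (fun m _ => by simp) (fun m hm => by
      refine ((R_inc c _).seq (R_inc w _)).cast ?_
      funext j
      simp only [Function.update_apply]
      grind)
  have h2 : (fun m => Function.update (Function.update (Function.update σ c (σ a - m)) w (σ a - m)) a m)
      (σ a) = σ := by
    funext j
    simp only [Function.update_apply]
    grind
  beta_reduce at h2
  rw [h2] at h
  refine (h.seq (R_move w a haw.symm _)).cast ?_
  funext j
  simp only [Function.update_apply]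
  grind

def Comp {n : ℕ} (f : List.Vector ℕ n → ℕ) : Prop :=
  ∀ (inp : Fin n → ℕ) (out b : ℕ), (∀ i, inp i < b) → out < b → (∀ i, inp i ≠ out) →
    ∃ P, ∀ σ : ℕ → ℕ, σ out = 0 → (∀ j, b ≤ j → σ j = 0) →
      R P σ (Function.update σ out (f (List.Vector.ofFn (fun i => σ (inp i)))))

theorem comp_zero : Comp (n := 0) (fun _ => 0) := by
  intro inp out b h1 h2 h3
  refine ⟨nop out, fun σ hσ _ => (R_nop out σ).cast ?_⟩
  funext j
  simp only [Function.update_apply]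
  split_ifs with h
  · rw [h, hσ]
  · rfl

theorem comp_get {n : ℕ} (i : Fin n) : Comp (fun v => v.get i) := by
  intro inp out b h1 h2 h3
  refine ⟨copy (inp i) out b, fun σ hσ hb => ?_⟩
  have := h1 i
  refine (R_copy (inp i) out b (h3 i) (by omega) (by omega) σ hσ (hb b le_rfl)).cast ?_
  simp

theorem comp_succ : Comp (n := 1) (fun v => Nat.succ v.head) := by
  intro inp out b h1 h2 h3
  refine ⟨seq (copy (inp 0) out b) (inc out), fun σ hσ hb => ?_⟩
  have := h1 0
  refine ((R_copy (inp 0) out b (h3 0) (by omega) (by omega) σ hσ (hb b le_rfl)).seq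
    (R_inc out _)).cast ?_
  simp [List.Vector.ofFn]

def blk (σ : ℕ → ℕ) (b k : ℕ) (vals : ℕ → ℕ) : ℕ → ℕ :=
  fun j => if b ≤ j ∧ j < b + k then vals (j - b) else σ j

theorem clear_many (b k : ℕ) : ∃ P, ∀ (σ : ℕ → ℕ) , R P σ (blk σ b k (fun _ => 0)) := by
  induction k with
  | zero => exact ⟨nop 0, fun σ => (R_nop 0 σ).cast (by funext j; simp [blk])⟩
  | succ k ih =>
    obtain ⟨P, hP⟩ := ih
    refine ⟨seq P (clear (b + k)), fun σ => ((hP σ).seq (R_clear (b + k) _)).cast ?_⟩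
    funext j
    simp only [Function.update_apply, blk]
    grind

theorem comp_many {m n : ℕ} (g : Fin n → List.Vector ℕ m → ℕ) (hg : ∀ i, Comp (g i))
    (inp : Fin m → ℕ) (b : ℕ) (h1 : ∀ i, inp i < b) (k : ℕ) (hk : k ≤ n) :
    ∃ P, ∀ (σ vals : ℕ → ℕ), (∀ j, b ≤ j → σ j = 0) →
      (∀ i : Fin n, vals i = g i (List.Vector.ofFn (fun i => σ (inp i)))) →
      R P σ (blk σ b k vals) := by
  induction k with
  | zero => exact ⟨nop 0, fun σ vals _ _ => (R_nop 0 σ).cast (by funext j; simp [blk])⟩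
  | succ k ih =>
    obtain ⟨P, hP⟩ := ih (by omega)
    obtain ⟨P', hP'⟩ := hg ⟨k, hk⟩ inp (b + k) (b + n) (fun i => by have := h1 i; omega) (by omega)
      (fun i => by have := h1 i; omega)
    refine ⟨seq P P', fun σ vals hσ hv => ((hP σ vals hσ hv).seq (hP' _ ?_ ?_)).cast ?_⟩
    · simp [blk, hσ]
    · intro j hj
      simp only [blk]
      rw [if_neg (by omega)]
      exact hσ j (by omega)
    · have e : (fun i => blk σ b k vals (inp i)) = fun i => σ (inp i) := by
        funext i
        have := h1 i
        simp only [blk]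
        rw [if_neg (by omega)]
      rw [e]
      have := hv ⟨k, hk⟩
      simp only at this
      rw [← this]
      funext j
      simp only [Function.update_apply, blk]
      grind

theorem comp_comp {m n : ℕ} {f : List.Vector ℕ n → ℕ} (g : Fin n → List.Vector ℕ m → ℕ)
    (hf : Comp f) (hg : ∀ i, Comp (g i)) : Comp (fun a => f (List.Vector.ofFn fun i => g i a)) := by
  intro inp out b h1 h2 h3
  obtain ⟨P1, hP1⟩ := comp_many g hg inp b h1 n le_rfl
  obtain ⟨P2, hP2⟩ := hf (fun i => b + i) out (b + n) (fun i => by omega) (by omega)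
    (fun i => by omega)
  obtain ⟨P3, hP3⟩ := clear_many b n
  refine ⟨seq P1 (seq P2 P3), fun σ hσ hb => ?_⟩
  let vals : ℕ → ℕ := fun i => if h : i < n then g ⟨i, h⟩ (List.Vector.ofFn (fun i => σ (inp i))) else 0
  have hv : ∀ i : Fin n, vals i = g i (List.Vector.ofFn (fun i => σ (inp i))) := by
    intro i; simp [vals]
  have r1 := hP1 σ vals hb hv
  have r2 := hP2 (blk σ b n vals) (by simp only [blk]; rw [if_neg (by omega)]; exact hσ)
    (by intro j hj; simp only [blk]; rw [if_neg (by omega)]; exact hb j (by omega))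
  have e : (fun i : Fin n => blk σ b n vals (b + i)) =
      fun i => g i (List.Vector.ofFn (fun i => σ (inp i))) := by
    funext i
    rw [← hv]
    simp [blk]
  rw [e] at r2
  refine (r1.seq (r2.seq (hP3 _))).cast ?_
  funext j
  simp only [Function.update_apply, blk]
  have := hb j
  grind

theorem comp_prec {n : ℕ} {f : List.Vector ℕ n → ℕ} {g : List.Vector ℕ (n + 2) → ℕ}
    (hf : Comp f) (hg : Comp g) : Comp (fun v : List.Vector ℕ (n + 1) =>
      v.head.rec (f v.tail) fun y IH => g (y ::ᵥ IH ::ᵥ v.tail)) := by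
  intro inp out b h1 h2 h3
  obtain ⟨Pf, hPf⟩ := hf (fun i => inp i.succ) (b + 2) (b + 4) (fun i => by have := h1 i.succ; omega)
    (by omega) (fun i => by have := h1 i.succ; omega)
  obtain ⟨Pg, hPg⟩ := hg (Fin.cons (b + 1) (Fin.cons (b + 2) (fun i => inp i.succ))) (b + 3) (b + 4)
    (by
      intro i
      refine Fin.cases ?_ (fun i => ?_) i
      · simp
      refine Fin.cases ?_ (fun i => ?_) i
      · simp
      · have := h1 i.succ
        simp only [Fin.cons_succ]; omega)
    (by omega)
    (by
      intro i
      refine Fin.cases ?_ (fun i => ?_) i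
      · simp
      refine Fin.cases ?_ (fun i => ?_) i
      · simp
      · have := h1 i.succ
        simp only [Fin.cons_succ]; omega)
  have hi0 := h1 0
  refine ⟨seq (copy (inp 0) b (b + 4)) (seq Pf (seq
    (loop b (seq Pg (seq (clear (b + 2)) (seq (move (b + 3) (b + 2)) (inc (b + 1))))))
    (seq (move (b + 2) out) (clear (b + 1))))), fun σ hσ hb => ?_⟩
  set tl := List.Vector.ofFn (fun i : Fin n => σ (inp i.succ)) with htl
  let rc : ℕ → ℕ := fun y => Nat.rec (f tl) (fun y IH => g (y ::ᵥ IH ::ᵥ tl)) y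
  have hrc0 : rc 0 = f tl := rfl
  have hrcS : ∀ y, rc (y + 1) = g (y ::ᵥ rc y ::ᵥ tl) := fun y => rfl
  have hgoal : (List.Vector.ofFn fun i => σ (inp i)).head.rec
      (f (List.Vector.ofFn fun i => σ (inp i)).tail)
      (fun y IH => g (y ::ᵥ IH ::ᵥ (List.Vector.ofFn fun i => σ (inp i)).tail)) = rc (σ (inp 0)) := by
    have a1 : (List.Vector.ofFn fun i => σ (inp i)).head = σ (inp 0) := by simp [List.Vector.ofFn]
    have a2 : (List.Vector.ofFn fun i => σ (inp i)).tail = tl := by simp [List.Vector.ofFn, htl]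
    rw [a1, a2]
  simp only [hgoal]
  set x := σ (inp 0) with hx
  have r1 := R_copy (inp 0) b (b + 4) (by omega) (by omega) (by omega) σ (hb b le_rfl)
    (hb _ (by omega))
  have r2 := hPf (Function.update σ b x) (by
      simp only [Function.update_apply]; rw [if_neg (by omega)]; exact hb _ (by omega))
    (by intro j hj; simp only [Function.update_apply]; rw [if_neg (by omega)]; exact hb _ (by omega))
  have e2 : (fun i : Fin n => Function.update σ b x (inp i.succ)) = fun i => σ (inp i.succ) := by
    funext i
    have := h1 i.succ
    simp only [Function.update_apply]; rw [if_neg (by omega)]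
  rw [e2, ← htl, ← hrc0] at r2
  let F : ℕ → ℕ → ℕ := fun m => Function.update (Function.update (Function.update σ b m)
    (b + 1) (x - m)) (b + 2) (rc (x - m))
  have hFx : Function.update (Function.update σ b x) (b + 2) (rc 0) = F x := by
    funext j
    have := hb j
    simp only [F, Function.update_apply, Nat.sub_self]
    grind
  rw [hFx] at r2
  have r3 : R (loop b (seq Pg (seq (clear (b + 2)) (seq (move (b + 3) (b + 2)) (inc (b + 1))))))
      (F x) (F 0) := by
    apply R_loop F x
    · intro m _
      simp [F, Function.update_apply]
    · intro m hm
      have q1 := hPg (Function.update (F (m + 1)) b m)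
        (by have := hb (b + 3) (by omega); simp [F, Function.update_apply, this])
        (by intro j hj; have := hb j (by omega); simp only [F, Function.update_apply]
            rw [if_neg (by omega), if_neg (by omega), if_neg (by omega), if_neg (by omega)]; exact this)
      have e3 : g (List.Vector.ofFn fun i => Function.update (F (m + 1)) b m
          ((Fin.cons (b + 1) (Fin.cons (b + 2) (fun i => inp i.succ)) : Fin (n + 2) → ℕ) i)) =
          rc (x - m) := by
        rw [show x - m = (x - (m + 1)) + 1 by omega, hrcS]
        congr 1
        have t1 : (List.Vector.ofFn fun i => Function.update (F (m + 1)) b m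
          ((Fin.cons (b + 1) (Fin.cons (b + 2) (fun i => inp i.succ)) : Fin (n + 2) → ℕ) i)) =
          (Function.update (F (m + 1)) b m (b + 1)) ::ᵥ
          (Function.update (F (m + 1)) b m (b + 2)) ::ᵥ
          List.Vector.ofFn (fun i : Fin n => Function.update (F (m + 1)) b m (inp i.succ)) := by
          rfl
        rw [t1]
        have t2 : (fun i : Fin n => Function.update (F (m + 1)) b m (inp i.succ)) =
            fun i => σ (inp i.succ) := by
          funext i
          have := h1 i.succ
          simp only [F, Function.update_apply]
          rw [if_neg (by omega), if_neg (by omega), if_neg (by omega), if_neg (by omega)]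
        rw [t2, ← htl]
        simp [F, Function.update_apply]
      rw [e3] at q1
      refine (q1.seq ((R_clear (b + 2) _).seq ((R_move (b + 3) (b + 2) (by omega) _).seq
        (R_inc (b + 1) _)))).cast ?_
      funext j
      have := hb j
      simp only [F, Function.update_apply]
      grind
  refine (r1.seq (r2.seq (r3.seq ((R_move (b + 2) out (by omega) _).seq (R_clear (b + 1) _))))).cast ?_
  funext j
  have := hb j
  simp only [F, Function.update_apply, Nat.sub_zero]
  grind

theorem comp_all {n : ℕ} {f : List.Vector ℕ n → ℕ} (h : Nat.Primrec' f) : Comp f := by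
  induction h with
  | zero => exact comp_zero
  | succ => exact comp_succ
  | get i => exact comp_get i
  | comp g hf hg ihf ihg => exact comp_comp g ihf ihg
  | prec hf hg ihf ihg => exact comp_prec ihf ihg

end Prog

set_option linter.unusedSectionVars false
set_option linter.unnecessarySeqFocus false
set_option linter.unusedVariables false
set_option linter.unusedSimpArgs false

open Ins

namespace Prog

def st (x y w : ℕ) : ℕ → ℕ := fun r => if r = 0 then x else if r = 1 then y else if r = 2 then w else 0

/-- Timed runs. -/
def T (G : Dat → Prop) (P : Prog) (t : ℝ) (d d' : Dat) : Prop := ∃ t', t ≤ t' ∧ Exec G P t' d d'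

variable {G : Dat → Prop}

theorem T.seq {P Q : Prog} {t t' : ℝ} {d d' d'' : Dat} (h : T G P t d d') (h' : T G Q t' d' d'') :
    T G (seq P Q) (t + t') d d'' := by
  obtain ⟨s, hs, h⟩ := h
  obtain ⟨s', hs', h'⟩ := h'
  exact ⟨_, add_le_add hs hs', Exec.seq h h'⟩

theorem T.weak {P : Prog} {t t' : ℝ} {d d' : Dat} (h : T G P t d d') (ht : t' ≤ t) : T G P t' d d' := by
  obtain ⟨s, hs, h⟩ := h
  exact ⟨s, ht.trans hs, h⟩

theorem T_inc0 {x y w e : ℕ} (h : G (st x y w, e)) :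
    T G (inc 0) (sc (st x y w, e)) (st x y w, e) (st (x + 1) y w, e) := by
  refine ⟨_, le_rfl, ?_⟩
  convert Exec.inc 0 (st x y w, e) h using 1
  unfold dinc; congr 1; funext r; simp only [st, Function.update_apply]; grind

theorem T_inc1 {x y w e : ℕ} (h : G (st x y w, e)) :
    T G (inc 1) (sc (st x y w, e)) (st x y w, e) (st x (y + 1) w, e) := by
  refine ⟨_, le_rfl, ?_⟩
  convert Exec.inc 1 (st x y w, e) h using 1
  unfold dinc; congr 1; funext r; simp only [st, Function.update_apply]; grind

theorem T_inc2 {x y w e : ℕ} (h : G (st x y w, e)) :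
    T G (inc 2) (sc (st x y w, e)) (st x y w, e) (st x y (w + 1), e) := by
  refine ⟨_, le_rfl, ?_⟩
  convert Exec.inc 2 (st x y w, e) h using 1
  unfold dinc; congr 1; funext r; simp only [st, Function.update_apply]; grind

theorem ddec0 (x y w e : ℕ) : ddec (st (x + 1) y w, e) 0 = (st x y w, e) := by
  unfold ddec; congr 1; funext r; simp only [st, Function.update_apply]; grind

theorem ddec1 (x y w e : ℕ) : ddec (st x (y + 1) w, e) 1 = (st x y w, e) := by
  unfold ddec; congr 1; funext r; simp only [st, Function.update_apply]; grind

theorem ddec2 (x y w e : ℕ) : ddec (st x y (w + 1), e) 2 = (st x y w, e) := by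
  unfold ddec; congr 1; funext r; simp only [st, Function.update_apply]; grind

theorem T_halve {x y w e : ℕ} (h : G (st x y w, e)) :
    T G halve 0 (st x y w, e) (st (2 * x) (2 * y) (2 * w), e + 1) := by
  refine ⟨_, (sc_pos (st x y w, e)).le, ?_⟩
  convert Exec.halve (st x y w, e) h using 1
  unfold dhalve; congr 1; funext r; simp only [st]; split_ifs <;> rfl

theorem T_loop0 {r : ℕ} {P : Prog} {d : Dat} (h : G d) (h0 : d.1 r = 0) : T G (loop r P) 0 d d :=
  ⟨_, (sc_pos _).le, Exec.loop0 r P d h h0⟩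

theorem T_loopS {r : ℕ} {P : Prog} {t t' : ℝ} {d d1 d' d'' : Dat} (h : G d) (h0 : d.1 r ≠ 0)
    (hd : ddec d r = d1)
    (h1 : T G P t d1 d') (h2 : T G (loop r P) t' d' d'') : T G (loop r P) (t + t') d d'' := by
  obtain ⟨s, hs, h1⟩ := h1
  obtain ⟨s', hs', h2⟩ := h2
  subst hd
  exact ⟨_, by linarith [sc_pos d], Exec.loopS h h0 h1 h2⟩

/-- All bounded data at a given exponent are good. -/
def Bd (G : Dat → Prop) (B e : ℕ) : Prop := ∀ x y w, x ≤ B → y ≤ B → w ≤ B → G (st x y w, e)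

theorem T_xw {B e : ℕ} (hB : Bd G B e) : ∀ x y w : ℕ, x + w ≤ B → y ≤ B →
    T G (loop 0 (inc 2)) (x * (1 / 2 : ℝ) ^ e) (st x y w, e) (st 0 y (x + w), e)
  | 0, y, w, h, hy => by
    simpa using T_loop0 (P := inc 2) (hB 0 y w (by omega) hy (by omega)) rfl
  | x + 1, y, w, h, hy => by
    have := T_xw hB x y (w + 1) (by omega) hy
    have h1 := T_loopS (hB (x + 1) y w (by omega) hy (by omega)) (by simp [st]) (ddec0 _ _ _ _)
      (T_inc2 (hB x y w (by omega) hy (by omega))) this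
    rw [show x + (w + 1) = x + 1 + w by ring] at h1
    refine h1.weak ?_
    push_cast; simp only [sc]; linarith

theorem T_wx {B e : ℕ} (hB : Bd G B e) : ∀ w x y : ℕ, x + w ≤ B → y ≤ B →
    T G (loop 2 (inc 0)) 0 (st x y w, e) (st (x + w) y 0, e)
  | 0, x, y, h, hy => by
    simpa using T_loop0 (P := inc 0) (hB x y 0 (by omega) hy (by omega)) rfl
  | w + 1, x, y, h, hy => by
    have := T_wx hB w (x + 1) y (by omega) hy
    have h1 := T_loopS (hB x y (w + 1) (by omega) hy (by omega)) (by simp [st]) (ddec2 _ _ _ _)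
      (T_inc0 (hB x y w (by omega) hy (by omega))) this
    rw [show x + 1 + w = x + (w + 1) by ring] at h1
    refine h1.weak ?_
    have := sc_pos (st x y w, e); linarith

theorem T_wait {B e : ℕ} (hB : Bd G B e) (x : ℕ) (hx : x ≤ B) : ∀ y : ℕ, y ≤ B →
    T G (loop 1 (Prog.seq (loop 0 (inc 2)) (loop 2 (inc 0)))) (y * (x * (1 / 2 : ℝ) ^ e))
      (st x y 0, e) (st x 0 0, e)
  | 0, hy => by
    simpa using T_loop0 (P := (Prog.seq (loop 0 (inc 2)) (loop 2 (inc 0))))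
      (hB x 0 0 hx (by omega) (by omega)) rfl
  | y + 1, hy => by
    have := T_wait hB x hx y (by omega)
    have h1 := T_xw hB x y 0 (by omega) (by omega)
    have h2 := T_wx hB (x + 0) 0 y (by omega) (by omega)
    rw [show 0 + (x + 0) = x by ring] at h2
    have h3 := T_loopS (hB x (y + 1) 0 (by omega) hy (by omega)) (by simp [st]) (ddec1 _ _ _ _)
      (h1.seq h2) this
    refine h3.weak ?_
    push_cast; linarith

theorem T_split {B e : ℕ} (hB : Bd G B e) : ∀ n y w : ℕ, 2 * n ≤ B → y + n ≤ B → w + n ≤ B →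
    T G (loop 0 (Prog.seq (dec 0) (Prog.seq (inc 1) (inc 2)))) 0
      (st (2 * n) y w, e) (st 0 (y + n) (w + n), e)
  | 0, y, w, hn, hy, hw => by
    simpa using T_loop0 (P := (Prog.seq (dec 0) (Prog.seq (inc 1) (inc 2))))
      (hB 0 y w (by omega) (by omega) (by omega)) rfl
  | n + 1, y, w, hn, hy, hw => by
    have := T_split hB n (y + 1) (w + 1) (by omega) (by omega) (by omega)
    have h1 : T G (dec 0) 0 (st (2 * n + 1) y w, e) (st (2 * n) y w, e) := by
      refine ⟨_, (sc_pos (st (2 * n + 1) y w, e)).le, ?_⟩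
      have := Exec.dec (G := G) 0 (st (2 * n + 1) y w, e) (hB _ _ _ (by omega) (by omega) (by omega))
      rwa [ddec0] at this
    have h2 := T_inc1 (hB (2 * n) y w (by omega) (by omega) (by omega))
    have h3 := T_inc2 (hB (2 * n) (y + 1) w (by omega) (by omega) (by omega))
    have h4 := T_loopS (hB (2 * n + 1 + 1) y w (by omega) (by omega) (by omega)) (by simp [st])
      (ddec0 _ _ _ _) (h1.seq (h2.seq h3)) this
    rw [show y + 1 + n = y + (n + 1) by ring, show w + 1 + n = w + (n + 1) by ring] at h4
    refine h4.weak ?_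
    have := sc_pos (st (2 * n) y w, e)
    have := sc_pos (st (2 * n) (y + 1) w, e)
    linarith

def roundBody : Prog :=
  seq (inc 1) (seq (loop 1 (seq (loop 0 (inc 2)) (loop 2 (inc 0)))) (seq halve (seq halve
    (seq (loop 0 (seq (dec 0) (seq (inc 1) (inc 2)))) (loop 2 (inc 0))))))

theorem T_round {a e : ℕ} (h0 : Bd G a e) (h1 : Bd G (2 * a) (e + 1)) (h2 : Bd G (4 * a) (e + 2))
    (ha : 0 < a) :
    T G roundBody (a * (a * (1 / 2 : ℝ) ^ e)) (st a (a - 1) 0, e) (st (2 * a) (2 * a) 0, e + 2) := by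
  have r1 := T_inc1 (h0 a (a - 1) 0 (by omega) (by omega) (by omega))
  rw [show a - 1 + 1 = a by omega] at r1
  have r2 := T_wait h0 a le_rfl a le_rfl
  have r3 := T_halve (h0 a 0 0 (by omega) (by omega) (by omega))
  have r4 := T_halve (h1 (2 * a) (2 * 0) (2 * 0) (by omega) (by omega) (by omega))
  have r5 := T_split h2 (2 * a) 0 0 (by omega) (by omega) (by omega)
  have r6 := T_wx h2 (0 + 2 * a) 0 (0 + 2 * a) (by omega) (by omega)
  have r := r1.seq (r2.seq (r3.seq (r4.seq (r5.seq r6))))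
  simp only [zero_add] at r
  refine r.weak ?_
  have := sc_pos (st a (a - 1) 0, e)
  linarith

theorem round_bd (k j : ℕ) : Bd (Gb ((1 / 2 : ℝ) ^ k)) (2 ^ j * 2 ^ k) (2 * k + j) := by
  intro x y w hx hy hw
  have key : ∀ v : ℕ, v ≤ 2 ^ j * 2 ^ k → (1 / 2 : ℝ) ^ (2 * k + j) * v ≤ (1 / 2 : ℝ) ^ k := by
    intro v hv
    have hv' : (v : ℝ) ≤ 2 ^ j * 2 ^ k := by exact_mod_cast hv
    calc (1 / 2 : ℝ) ^ (2 * k + j) * v ≤ (1 / 2 : ℝ) ^ (2 * k + j) * (2 ^ j * 2 ^ k) := by gcongr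
      _ = (1 / 2 : ℝ) ^ k * ((1 / 2 * 2) ^ k * (1 / 2 * 2) ^ j) := by
        rw [mul_pow, mul_pow]; ring
      _ = _ := by norm_num
  refine ⟨?_, fun r => ?_⟩
  · have := key 1 (Nat.succ_le_of_lt (by positivity))
    simpa [sc] using this
  · apply key
    simp only [st]
    split_ifs <;> omega

theorem T_round' (k : ℕ) : T (Gb ((1 / 2 : ℝ) ^ k)) roundBody 1 (st (2 ^ k) (2 ^ k - 1) 0, 2 * k)
    (st (2 ^ (k + 1)) (2 ^ (k + 1)) 0, 2 * (k + 1)) := by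
  have h0 := round_bd k 0
  have h1 := round_bd k 1
  have h2 := round_bd k 2
  norm_num at h0 h1 h2
  have h := T_round (a := 2 ^ k) (e := 2 * k) h0 h1 h2 (by positivity)
  rw [show 2 * 2 ^ k = 2 ^ (k + 1) by ring, show 2 * k + 2 = 2 * (k + 1) by ring] at h
  refine h.weak (le_of_eq ?_)
  push_cast
  rw [pow_mul', ← mul_assoc, sq, ← mul_assoc]
  rw [show (2:ℝ) ^ k * 2 ^ k * (1 / 2) ^ k * (1 / 2) ^ k = (2 * (1/2)) ^ k * (2 * (1 / 2)) ^ k by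
    rw [mul_pow]; ring]
  norm_num

theorem round_reach {Q : Type} [DecidableEq Q] {I : Q → Ins Q} (f : St (loop 1 roundBody) → Q) (x : Q)
    (hE : Emb (loop 1 roundBody) I f x) (k : ℕ) :
    Reach I (Gb ((1 / 2 : ℝ) ^ k)) 1
      ⟨f (start (loop 1 roundBody)), false, (st (2 ^ k) (2 ^ k) 0, 2 * k)⟩
      ⟨f (start (loop 1 roundBody)), false, (st (2 ^ (k + 1)) (2 ^ (k + 1)) 0, 2 * (k + 1))⟩ := by
  obtain ⟨t, ht, h⟩ := T_round' k
  have hp : 0 < 2 ^ k := by positivity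
  have h0 := round_bd k 0
  norm_num at h0
  have hd : ddec (st (2 ^ k) (2 ^ k) 0, 2 * k) 1 = (st (2 ^ k) (2 ^ k - 1) 0, 2 * k) := by
    have := ddec1 (2 ^ k) (2 ^ k - 1) 0 (2 * k)
    rwa [show 2 ^ k - 1 + 1 = 2 ^ k by omega] at this
  rw [← hd] at h
  refine (loop_reach (Gb_dec _) (h0 _ _ _ le_rfl le_rfl (by omega)) (by simp [st]) h f x hE).mono
    (fun _ h => h) ?_
  have := sc_pos (st (2 ^ k) (2 ^ k) 0, 2 * k)
  linarith

end Prog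

set_option linter.unusedSectionVars false
set_option linter.unnecessarySeqFocus false
set_option linter.unusedVariables false
set_option linter.unusedSimpArgs false

open Ins

namespace Prog

theorem Exec.nonneg {G : Dat → Prop} {P : Prog} {t : ℝ} {d d' : Dat} (h : Exec G P t d d') : 0 ≤ t := by
  induction h with
  | inc r d _ => exact (sc_pos _).le
  | dec r d _ => exact (sc_pos _).le
  | halve d _ => exact (sc_pos _).le
  | seq _ _ h1 h2 => linarith
  | loop0 r P d _ _ => exact (sc_pos _).le
  | @loopS r P t t' d d' d'' _ _ _ _ h1 h2 => linarith [sc_pos d]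

def preludeProg (Pg : Prog) : Prog :=
  seq (loop 2 (seq (inc 1) Pg)) (seq (clear 0) (seq (clear 1) (seq (inc 0) (inc 1))))

def mainProg (Pg : Prog) : Prog := seq Pg (seq (preludeProg Pg) (loop 1 roundBody))

section
variable {Pg : Prog} {g : ℕ → ℕ → ℕ}

theorem R_search_step (hP : ∀ n k, R Pg (st n k 0) (st n k (g n k)))
    (n k : ℕ) : R (seq (inc 1) Pg) (st n k 0) (st n (k + 1) (g n (k + 1))) := by
  refine ((R_inc 1 _).cast ?_).seq (hP n (k + 1))
  funext r; simp only [st, Function.update_apply]; grind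

theorem R_search (hP : ∀ n k, R Pg (st n k 0) (st n k (g n k)))
    (n K : ℕ) (hK : g n K = 0) (hlt : ∀ k < K, g n k = 1) (j : ℕ) : ∀ k, k + j = K →
    R (loop 2 (seq (inc 1) Pg)) (st n k (g n k)) (st n K 0) := by
  induction j with
  | zero =>
    intro k hk
    obtain rfl : k = K := by omega
    rw [hK]
    exact ⟨_, Exec.loop0 _ _ _ trivial rfl⟩
  | succ j ih =>
    intro k hk
    rw [hlt k (by omega)]
    obtain ⟨t, h⟩ := R_search_step hP n k
    obtain ⟨t', h'⟩ := ih (k + 1) (by omega)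
    refine ⟨_, Exec.loopS (t := t) trivial (by simp [st]) ?_ h'⟩
    rw [ddec2]; exact h

theorem R_prelude (hP : ∀ n k, R Pg (st n k 0) (st n k (g n k)))
    (n K : ℕ) (hK : g n K = 0) (hlt : ∀ k < K, g n k = 1) :
    R (preludeProg Pg) (st n 0 (g n 0)) (st 1 1 0) := by
  have h1 := R_search hP n K hK hlt K 0 (by omega)
  refine h1.seq (((R_clear 0 _).seq ((R_clear 1 _).seq ((R_inc 0 _).seq (R_inc 1 _)))).cast ?_)
  funext r; simp only [st, Function.update_apply]; grind

theorem main_dich (hP : ∀ n k, R Pg (st n k 0) (st n k (g n k)))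
    (h01 : ∀ n k, g n k ≤ 1) (n : ℕ) {κ : Type} [Fintype κ]
    (e : κ ≃ FM.Ix (St (mainProg Pg) × Bool) (St (mainProg Pg))) :
    FluidStable (fun i => FM.z0 (start (mainProg Pg), false)
        (fx (mach (mainProg Pg)) ⟨start (mainProg Pg), false, (st n 0 0, 0)⟩) 1 (e i))
      (fun i => FM.th ℝ (e i))
      (fun i j => (fm (mach (mainProg Pg))).RR ℝ (e i) (e j)) ↔ ∃ k, g n k = 0 := by
  have hE := emb_mach (mainProg Pg)
  have hEr := hE.right
  have hs : sc (st n 0 0, 0) = 1 := by simp [sc]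
  obtain ⟨t0, h0⟩ := hP n 0
  have r0 := exec_reach (fun _ _ h => h) h0 _ _ hE.left
  constructor
  · intro hst
    by_contra hno
    push Not at hno
    have hg1 : ∀ k, g n k = 1 := fun k => by have := h01 n k; have := hno k; omega
    rw [← hs] at hst
    have hEs := hEr.left.left
    refine looping_not_stable (I := mach (mainProg Pg)) e
      (c0 := ⟨start (mainProg Pg), false, (st n 0 0, 0)⟩)
      (H := fun k => ⟨_, false, (st n k 1, 0)⟩) (hg1 0 ▸ r0) ?_ (fun _ => rfl) hst
    intro k
    obtain ⟨t, h⟩ := R_search_step hP n k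
    rw [hg1] at h
    have hdd : ddec (st n k 1, 0) 2 = (st n k 0, 0) := ddec2 n k 0 0
    rw [← hdd] at h
    refine (loop_reach (fun _ _ h => h) trivial (by simp [st]) h _ _ hEs).mono (fun _ h => h) ?_
    have : sc (st n k 1, 0) = 1 := by simp [sc]
    linarith [h.nonneg]
  · intro hex
    classical
    obtain ⟨t1, h1⟩ := R_prelude hP n (Nat.find hex) (Nat.find_spec hex) (fun k hk => by
      have := Nat.find_min hex hk
      have := h01 n k
      omega)
    have r1 := exec_reach (fun _ _ h => h) h1 _ _ hEr.left
    have hst := halting_stable (I := mach (mainProg Pg)) e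
      (c0 := ⟨start (mainProg Pg), false, (st n 0 0, 0)⟩)
      (H := fun k => ⟨_, false, (st (2 ^ k) (2 ^ k) 0, 2 * k)⟩) one_pos
      (β := fun k => (1 / 2 : ℝ) ^ k)
      (pow_right_anti₀ (by norm_num) (by norm_num))
      (tendsto_pow_atTop_nhds_zero_of_lt_one (by norm_num) (by norm_num))
      (r0.trans r1)
      (fun k => round_reach _ _ hEr.right k)
    rwa [hs] at hst
end

/-- The halting test as a 0/1-valued function. -/
def gfun (n k : ℕ) : ℕ := if ((Denumerable.ofNat Nat.Partrec.Code n).evaln k 0).isSome then 0 else 1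

theorem gfun_le (n k : ℕ) : gfun n k ≤ 1 := by unfold gfun; split_ifs <;> simp

theorem gfun_zero (n : ℕ) : (∃ k, gfun n k = 0) ↔
    ((Denumerable.ofNat Nat.Partrec.Code n).eval 0).Dom := by
  rw [Part.dom_iff_mem]
  constructor
  · rintro ⟨k, hk⟩
    unfold gfun at hk
    split_ifs at hk with h
    obtain ⟨x, hx⟩ := Option.isSome_iff_exists.1 h
    exact ⟨x, Nat.Partrec.Code.evaln_complete.2 ⟨k, hx⟩⟩
  · rintro ⟨x, hx⟩
    obtain ⟨k, hk⟩ := Nat.Partrec.Code.evaln_complete.1 hx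
    refine ⟨k, ?_⟩
    unfold gfun
    rw [Option.mem_def.1 hk]
    rfl

theorem gfun_prim : Primrec₂ gfun := by
  unfold gfun
  have h : Primrec (fun p : ℕ × ℕ => (Nat.Partrec.Code.evaln p.2
      (Denumerable.ofNat Nat.Partrec.Code p.1) 0)) :=
    Nat.Partrec.Code.primrec_evaln.comp
      ((Primrec.snd.pair ((Primrec.ofNat _).comp Primrec.fst)).pair (Primrec.const 0))
  have h2 : Primrec (fun p : ℕ × ℕ => ((Nat.Partrec.Code.evaln p.2
      (Denumerable.ofNat Nat.Partrec.Code p.1) 0)).isSome) := Primrec.option_isSome.comp h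
  exact (Primrec.cond h2 (Primrec.const 0) (Primrec.const 1)).of_eq (fun p => by
    beta_reduce
    cases (Nat.Partrec.Code.evaln p.2 (Denumerable.ofNat Nat.Partrec.Code p.1) 0).isSome <;> rfl)

theorem exists_prog : ∃ Pg, ∀ n k, R Pg (st n k 0) (st n k (gfun n k)) := by
  have h := comp_all (Nat.Primrec'.prim_iff₂.2 gfun_prim)
  obtain ⟨P, hP⟩ := h ![0, 1] 2 3 (by intro i; fin_cases i <;> simp) (by norm_num)
    (by intro i; fin_cases i <;> simp)
  refine ⟨P, fun n k => (hP (st n k 0) rfl ?_).cast ?_⟩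
  · intro j hj
    simp only [st]
    rw [if_neg (by omega), if_neg (by omega), if_neg (by omega)]
  · have : gfun (List.Vector.ofFn fun i => st n k 0 (![0, 1] i)).head
      (List.Vector.ofFn fun i => st n k 0 (![0, 1] i)).tail.head = gfun n k := by
      simp [List.Vector.ofFn, st]
    beta_reduce
    rw [this]
    funext r; simp only [st, Function.update_apply]; grind

end Prog

set_option linter.unusedSectionVars false
set_option linter.unnecessarySeqFocus false
set_option linter.unusedVariables false
set_option linter.unusedSimpArgs false

open Ins

namespace Prog

theorem encode_nat_rat (n : ℕ) : Encodable.encode (n : ℚ) = Nat.pair (2 * n) 1 := rfl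

theorem primrec_encode_list (d : ℕ) : ∀ c : Fin d → ℕ → ℕ, (∀ i, Primrec (c i)) →
    Primrec (fun n => Encodable.encode (List.ofFn (fun i => ((c i n : ℕ) : ℚ)))) := by
  induction d with
  | zero => intro c hc; simpa using Primrec.const _
  | succ d ih =>
    intro c hc
    simp only [List.ofFn_succ, Encodable.encode_list_cons, encode_nat_rat]
    exact Primrec.succ.comp (Primrec₂.natPair.comp
      (Primrec₂.natPair.comp (Primrec.nat_mul.comp (Primrec.const 2) (hc 0)) (Primrec.const 1))
      (ih (fun i => c i.succ) (fun i => hc i.succ)))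

def zN {Q : Type} [DecidableEq Q] (I : Q → Ins Q) (q : Q) (n : ℕ) : FM.Ix (Q × Bool) Q → ℕ :=
  Sum.elim ![0, 1, 1, 0] (Sum.elim (fun j => if j = (q, false) then 0 else 1)
    (Sum.elim (fun k => fT I ⟨q, false, (st n 0 0, 0)⟩ k) (fun _ => 2)))

theorem zN_cast {Q : Type} [DecidableEq Q] (I : Q → Ins Q) (q : Q) (n : ℕ) (i : FM.Ix (Q × Bool) Q) :
    (zN I q n i : ℝ) = FM.z0 (q, false) (fx I ⟨q, false, (st n 0 0, 0)⟩) 1 i := by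
  rcases i with i | j | k | j
  · fin_cases i <;> simp [zN, FM.z0, FM.vec]
  · simp [zN, FM.z0, FM.vec]
  · simp [zN, FM.z0, FM.vec, fx, sc]
  · simp [zN, FM.z0, FM.vec]

theorem zN_primrec {Q : Type} [DecidableEq Q] (I : Q → Ins Q) (q : Q) (i : FM.Ix (Q × Bool) Q) :
    Primrec (fun n => zN I q n i) := by
  rcases i with i | j | k | j
  · exact Primrec.const _
  · exact Primrec.const _
  · simp only [zN, Sum.elim_inr, Sum.elim_inl, fT, st]
    cases (I k).reg with
    | none => exact Primrec.const _
    | some r =>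
      by_cases h : r = 0
      · simp [h]
        exact Primrec.id
      · simpa [h] using Primrec.const _
  · exact Primrec.const _

end Prog

theorem undecidable_aux :
    ¬ ∃ f : ℕ → Bool, Computable f ∧
      ∀ (d : ℕ) (z₀ θv : Fin d → ℚ) (R : Matrix (Fin d) (Fin d) ℚ),
        (∀ i, 0 ≤ z₀ i) →
        IsCompletelyS (fun i j => ((R i j : ℚ) : ℝ)) →
        (f (Encodable.encode (d, List.ofFn z₀, List.ofFn θv,
              List.ofFn (fun i => List.ofFn (fun j => R i j)))) = true ↔
          FluidStable (fun i => ((z₀ i : ℚ) : ℝ)) (fun i => ((θv i : ℚ) : ℝ))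
            (fun i j => ((R i j : ℚ) : ℝ))) := by
  rintro ⟨f, hf, H⟩
  obtain ⟨Pg, hPg⟩ := Prog.exists_prog
  let P := Prog.mainProg Pg
  let I := Prog.mach P
  let d := Fintype.card (FM.Ix (Prog.St P × Bool) (Prog.St P))
  let e : Fin d ≃ FM.Ix (Prog.St P × Bool) (Prog.St P) := (Fintype.equivFin _).symm
  let z : ℕ → Fin d → ℚ := fun n i => ((Prog.zN I (Prog.start P) n (e i) : ℕ) : ℚ)
  let θv : Fin d → ℚ := fun i => FM.th ℚ (e i)
  let RR : Matrix (Fin d) (Fin d) ℚ := fun i j => (fm I).RR ℚ (e i) (e j)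
  have hR : (fun i j => ((RR i j : ℚ) : ℝ)) = fun i j => (fm I).RR ℝ (e i) (e j) := by
    funext i j; exact FM.RR_cast _ _ _
  have hθ : (fun i => ((θv i : ℚ) : ℝ)) = fun i => FM.th ℝ (e i) := by
    funext i; exact FM.th_cast _
  let enc : ℕ → ℕ := fun n => Encodable.encode (d, List.ofFn (z n), List.ofFn θv,
              List.ofFn (fun i => List.ofFn (fun j => RR i j)))
  have henc : Primrec enc := by
    have h := Prog.primrec_encode_list d (fun i n => Prog.zN I (Prog.start P) n (e i))
      (fun i => Prog.zN_primrec I _ _)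
    have h2 : Primrec (fun n => Nat.pair (Encodable.encode d) (Nat.pair
        (Encodable.encode (List.ofFn (z n))) (Encodable.encode (List.ofFn θv,
          List.ofFn (fun i => List.ofFn (fun j => RR i j)))))) :=
      Primrec₂.natPair.comp (Primrec.const _) (Primrec₂.natPair.comp h (Primrec.const _))
    exact h2
  have key : ∀ n, f (enc n) = true ↔
      ((Denumerable.ofNat Nat.Partrec.Code n).eval 0).Dom := by
    intro n
    have h1 := H d (z n) θv RR (fun i => Nat.cast_nonneg _) (by
      rw [hR]; exact FM.completelyS e (fm I))
    have hz : (fun i => ((z n i : ℚ) : ℝ)) = fun i => FM.z0 (Prog.start P, false)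
        (fx I ⟨Prog.start P, false, (Prog.st n 0 0, 0)⟩) 1 (e i) := by
      funext i
      rw [← Prog.zN_cast]
      simp [z]
    rw [hz, hR, hθ] at h1
    rw [← Prog.gfun_zero, ← Prog.main_dich hPg Prog.gfun_le n e]
    exact h1
  apply ComputablePred.halting_problem 0
  rw [ComputablePred.computable_iff]
  refine ⟨fun c => f (enc (Encodable.encode c)),
    hf.comp (henc.to_comp.comp Computable.encode), ?_⟩
  funext c
  have := key (Encodable.encode c)
  rw [Denumerable.ofNat_encode] at this
  exact propext this.symm

/-- There is no total computable function which, given a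
dimension `d`, a nonnegative `z₀ ∈ ℚ^d`, a drift `θ ∈ ℚ^d`, and a
completely-S matrix `R ∈ ℚ^{d×d}` (presented via a standard encoding),
outputs `true` iff the fluid model `(z₀,θ,R)` is stable. -/
theorem skorokhod_fluid_stability_undecidable :
    ¬ ∃ f : ℕ → Bool, Computable f ∧
      ∀ (d : ℕ) (z₀ θv : Fin d → ℚ) (R : Matrix (Fin d) (Fin d) ℚ),
        (∀ i, 0 ≤ z₀ i) →
        IsCompletelyS (fun i j => ((R i j : ℚ) : ℝ)) →
        (f (Encodable.encode (d, List.ofFn z₀, List.ofFn θv,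
              List.ofFn (fun i => List.ofFn (fun j => R i j)))) = true ↔
          FluidStable (fun i => ((z₀ i : ℚ) : ℝ)) (fun i => ((θv i : ℚ) : ℝ))
            (fun i j => ((R i j : ℚ) : ℝ))) := by
  exact undecidable_aux
end

section
/- Let d ∈ ℕ and R ∈ ℝ^{d×d}. Then the following are equivalent: (i) for every continuous x : [0,∞) → ℝ^d with x(0) ≥ 0 componentwise there exists a Skorokhod solution (y,z); (ii) R is a completely-S matrix. -/
open scoped BigOperators

section SkorokhodHelpers

open Filter Topology Matrix

/-- Reformulation of completely-S with globally indexed, normalized witnesses. -/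
def SkCS {d : ℕ} (R : Matrix (Fin d) (Fin d) ℝ) : Prop :=
  ∀ I : Finset (Fin d), ∃ w : Fin d → ℝ, (∀ i, 0 ≤ w i) ∧ (∀ i, i ∉ I → w i = 0) ∧
    ∀ i ∈ I, 1 ≤ (R *ᵥ w) i

lemma sk_restrict {d : ℕ} (R : Matrix (Fin d) (Fin d) ℝ) (I : Finset (Fin d))
    (w : Fin d → ℝ) (hw : ∀ i, i ∉ I → w i = 0) (i : I) :
    (R *ᵥ w) i = ((R.submatrix (fun a : I => (a : Fin d)) (fun a : I => (a : Fin d))) *ᵥ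
      (fun a : I => w a)) i := by
  simp only [Matrix.mulVec, dotProduct, Matrix.submatrix_apply]
  rw [Finset.sum_coe_sort I (fun j => R i j * w j)]
  symm
  apply Finset.sum_subset (Finset.subset_univ _)
  intro j _ hj
  rw [hw j hj, mul_zero]

lemma sk_cs_of {d : ℕ} {R : Matrix (Fin d) (Fin d) ℝ} (h : IsCompletelyS R) : SkCS R := by
  intro I
  rcases I.eq_empty_or_nonempty with rfl | hI
  · exact ⟨0, by simp, by simp, by simp⟩
  obtain ⟨v, hv0, hv⟩ := h I hI
  have : Nonempty I := hI.to_subtype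
  obtain ⟨i0, hi0⟩ := Finite.exists_min
    (fun i : I => ((R.submatrix (fun a : I => (a : Fin d)) (fun a : I => (a : Fin d))) *ᵥ v) i)
  set m := ((R.submatrix (fun a : I => (a : Fin d)) (fun a : I => (a : Fin d))) *ᵥ v) i0 with hm
  have hmpos : 0 < m := hv i0
  let w : Fin d → ℝ := fun i => if hi : i ∈ I then m⁻¹ * v ⟨i, hi⟩ else 0
  have hw0 : ∀ i, i ∉ I → w i = 0 := fun i hi => by simp [w, hi]
  refine ⟨w, ?_, hw0, ?_⟩
  · intro i
    by_cases hi : i ∈ I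
    · simp only [w, hi, dite_true]
      exact mul_nonneg (inv_nonneg.2 hmpos.le) (hv0 _)
    · simp [w, hi]
  · intro i hi
    have := sk_restrict R I w hw0 ⟨i, hi⟩
    have e : (fun a : I => w a) = m⁻¹ • v := by
      ext a
      simp [w]
    rw [e, Matrix.mulVec_smul] at this
    simp only at this
    rw [this, Pi.smul_apply, smul_eq_mul, inv_mul_eq_div, le_div_iff₀ hmpos, one_mul]
    exact hi0 ⟨i, hi⟩

lemma sk_semimono {d : ℕ} {R : Matrix (Fin d) (Fin d) ℝ} (h : SkCS R) :
    ∀ (n : ℕ) (u : Fin d → ℝ), (Finset.univ.filter (fun i => 0 < u i)).card ≤ n →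
      (∀ i, 0 ≤ u i) → u ≠ 0 → ∃ i, 0 < u i ∧ 0 < (R *ᵥ u) i := by
  intro n
  induction n with
  | zero =>
    intro u hc h0 hu
    exfalso
    apply hu
    ext i
    have : Finset.univ.filter (fun i => 0 < u i) = ∅ := Finset.card_eq_zero.1 (by omega)
    have hi : i ∉ Finset.univ.filter (fun i => 0 < u i) := by rw [this]; simp
    simp only [Finset.mem_filter, Finset.mem_univ, true_and, not_lt] at hi
    exact le_antisymm hi (h0 i)
  | succ n ih =>
    intro u hc h0 hu
    by_contra hcon
    push Not at hcon
    set I := Finset.univ.filter (fun i => 0 < u i) with hI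
    have memI : ∀ i, i ∈ I ↔ 0 < u i := fun i => by simp [hI]
    obtain ⟨w, hw0, hwI, hw1⟩ := h I
    have hIne : I.Nonempty := by
      by_contra hne
      apply hu
      ext i
      have : i ∉ I := fun hi => hne ⟨i, hi⟩
      rw [memI, not_lt] at this
      exact le_antisymm this (h0 i)
    set W := I.filter (fun i => 0 < w i) with hW
    have hWne : W.Nonempty := by
      by_contra hne
      have : w = 0 := by
        ext i
        by_cases hi : i ∈ I
        · have : i ∉ W := fun hi => hne ⟨i, hi⟩
          simp only [hW, Finset.mem_filter, hi, true_and, not_lt] at this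
          exact le_antisymm this (hw0 i)
        · exact hwI i hi
      obtain ⟨i, hi⟩ := hIne
      have := hw1 i hi
      simp_all
      linarith
    obtain ⟨i0, hi0, hmin⟩ := Finset.exists_min_image W (fun i => u i / w i) hWne
    have hi0I : i0 ∈ I := (Finset.mem_filter.1 hi0).1
    have hwi0 : 0 < w i0 := (Finset.mem_filter.1 hi0).2
    set t := u i0 / w i0 with ht
    have htpos : 0 < t := div_pos ((memI _).1 hi0I) hwi0
    set v : Fin d → ℝ := u - t • w with hv
    have hv0 : ∀ i, 0 ≤ v i := by
      intro i
      simp only [hv, Pi.sub_apply, Pi.smul_apply, smul_eq_mul, sub_nonneg]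
      rcases (hw0 i).eq_or_lt with hi | hi
      · rw [← hi, mul_zero]; exact h0 i
      · have hiI : i ∈ I := by
          by_contra hh
          rw [hwI i hh] at hi
          exact lt_irrefl _ hi
        exact (le_div_iff₀ hi).1 (hmin i (Finset.mem_filter.2 ⟨hiI, hi⟩))
    have hvu : ∀ i, v i ≤ u i := by
      intro i
      simp only [hv, Pi.sub_apply, Pi.smul_apply, smul_eq_mul]
      have := mul_nonneg htpos.le (hw0 i)
      linarith
    have hvi0 : v i0 = 0 := by
      simp only [hv, Pi.sub_apply, Pi.smul_apply, smul_eq_mul, ht]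
      field_simp
      ring
    have hRv : ∀ i ∈ I, (R *ᵥ v) i < 0 := by
      intro i hi
      have : R *ᵥ v = R *ᵥ u - t • (R *ᵥ w) := by
        rw [hv, Matrix.mulVec_sub, Matrix.mulVec_smul]
      rw [this, Pi.sub_apply, Pi.smul_apply, smul_eq_mul]
      have h1 := hcon i ((memI i).1 hi)
      have h2 := hw1 i hi
      nlinarith
    by_cases hvz : v = 0
    · have := hRv i0 hi0I
      rw [hvz] at this
      simp at this
    · obtain ⟨i, hi1, hi2⟩ := ih v (by
        have hss : Finset.univ.filter (fun i => 0 < v i) ⊂ I := by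
          rw [Finset.ssubset_iff_of_subset]
          · exact ⟨i0, hi0I, by simp [hvi0]⟩
          · intro i hi
            simp only [Finset.mem_filter, Finset.mem_univ, true_and] at hi
            exact (memI i).2 (lt_of_lt_of_le hi (hvu i))
        have := Finset.card_lt_card hss
        omega) hv0 hvz
      have := hRv i ((memI i).2 (lt_of_lt_of_le hi1 (hvu i)))
      linarith

lemma sk_mulVec_cont {d : ℕ} (R : Matrix (Fin d) (Fin d) ℝ) :
    Continuous (fun u : Fin d → ℝ => R *ᵥ u) :=
  Continuous.matrix_mulVec continuous_const continuous_id

lemma sk_mulVec_bound {d : ℕ} (R : Matrix (Fin d) (Fin d) ℝ) :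
    ∃ M : ℝ, 0 ≤ M ∧ ∀ u : Fin d → ℝ, ‖R *ᵥ u‖ ≤ M * ‖u‖ := by
  let L := LinearMap.toContinuousLinearMap (Matrix.mulVecLin R)
  exact ⟨‖L‖, norm_nonneg _, fun u => L.le_opNorm u⟩

lemma sk_coercive {d : ℕ} {R : Matrix (Fin d) (Fin d) ℝ} (h : SkCS R) (I : Finset (Fin d)) :
    ∃ C : ℝ, 0 ≤ C ∧ ∀ u : Fin d → ℝ, (∀ i, 0 ≤ u i) → (∀ i, i ∉ I → u i = 0) →
      ∀ K : ℝ, 0 ≤ K → (∀ i ∈ I, (R *ᵥ u) i ≤ K) → ‖u‖ ≤ C * K := by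
  let f : (Fin d → ℝ) → ℝ := fun u => ∑ i ∈ I, max 0 ((R *ᵥ u) i)
  have hf : Continuous f := by
    apply continuous_finsetSum
    intro i _
    exact continuous_const.max ((continuous_apply i).comp (sk_mulVec_cont R))
  let S : Set (Fin d → ℝ) := Metric.sphere 0 1 ∩ {u | (∀ i, 0 ≤ u i) ∧ ∀ i, i ∉ I → u i = 0}
  have hSc : IsCompact S := by
    apply (isCompact_sphere _ _).inter_right
    have e : {u : Fin d → ℝ | (∀ i, 0 ≤ u i) ∧ ∀ i, i ∉ I → u i = 0}
      = (⋂ i, {u | 0 ≤ u i}) ∩ ⋂ i, ⋂ (_ : i ∉ I), {u | u i = 0} := by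
      ext u; simp
    rw [e]
    apply IsClosed.inter
    · exact isClosed_iInter fun i => isClosed_le continuous_const (continuous_apply i)
    · exact isClosed_iInter fun i => isClosed_iInter fun _ =>
        isClosed_eq (continuous_apply i) continuous_const
  have hpos : ∀ u ∈ S, 0 < f u := by
    intro u hu
    have hune : u ≠ 0 := by
      intro h0
      have := hu.1
      simp [h0] at this
    obtain ⟨i, hi1, hi2⟩ := sk_semimono h _ u le_rfl hu.2.1 hune
    have hiI : i ∈ I := by
      by_contra hh
      rw [hu.2.2 i hh] at hi1
      exact lt_irrefl _ hi1
    apply Finset.sum_pos'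
    · intro j _; exact le_max_left _ _
    · exact ⟨i, hiI, lt_max_of_lt_right hi2⟩
  have key : ∃ c : ℝ, 0 < c ∧ ∀ u ∈ S, c ≤ f u := by
    rcases S.eq_empty_or_nonempty with hS | hS
    · exact ⟨1, one_pos, by simp [hS]⟩
    · obtain ⟨u0, hu0, hmin⟩ := hSc.exists_isMinOn hS hf.continuousOn
      exact ⟨f u0, hpos u0 hu0, fun u hu => hmin hu⟩
  obtain ⟨c, hc, hcS⟩ := key
  refine ⟨I.card / c, by positivity, ?_⟩
  intro u hu0 huI K hK hRu
  rcases eq_or_ne u 0 with rfl | hne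
  · simp only [norm_zero]; positivity
  have hn : 0 < ‖u‖ := norm_pos_iff.2 hne
  have hmem : ‖u‖⁻¹ • u ∈ S := by
    refine ⟨?_, ?_, ?_⟩
    · simp [norm_smul, hn.ne']
    · intro i
      exact mul_nonneg (inv_nonneg.2 hn.le) (hu0 i)
    · intro i hi
      simp [huI i hi]
  have h1 := hcS _ hmem
  have h2 : f (‖u‖⁻¹ • u) ≤ ∑ i ∈ I, ‖u‖⁻¹ * K := by
    apply Finset.sum_le_sum
    intro i hi
    rw [Matrix.mulVec_smul, Pi.smul_apply, smul_eq_mul]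
    apply max_le (by positivity)
    exact mul_le_mul_of_nonneg_left (hRu i hi) (inv_nonneg.2 hn.le)
  rw [Finset.sum_const, nsmul_eq_mul] at h2
  have h3 := h1.trans h2
  have h4 : (I.card : ℝ) * (‖u‖⁻¹ * K) = (I.card * K) / ‖u‖ := by field_simp
  rw [h4, le_div_iff₀ hn] at h3
  rw [div_mul_eq_mul_div, le_div_iff₀ hc]
  linarith

/-- Discrete oscillation inequality. -/
lemma sk_osc {d : ℕ} {R : Matrix (Fin d) (Fin d) ℝ} (h : SkCS R) (I : Finset (Fin d)) :
    ∃ C : ℝ, 0 ≤ C ∧ ∀ (x y z : ℕ → Fin d → ℝ) (ε : ℝ), 0 ≤ ε → Monotone y →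
      (∀ n, z n = x n + R *ᵥ y n) → (∀ n j, 0 ≤ z n j) →
      (∀ n j, ε < z n j → y (n + 1) j = y n j) →
      (∀ n j, z (n + 1) j ≤ z n j + ε) →
      ∀ a b : ℕ, a ≤ b → (∀ j, j ∉ I → y b j = y a j) →
      (∀ n m, a ≤ n → n ≤ b → a ≤ m → m ≤ b → ‖x n - x m‖ ≤ ε) →
      ‖y b - y a‖ ≤ C * ε := by
  obtain ⟨M, hM, hMb⟩ := sk_mulVec_bound R
  induction I using Finset.strongInduction with
  | H I ih =>
  have ih' : ∀ i : Fin d, ∃ C : ℝ, 0 ≤ C ∧ (i ∈ I →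
      ∀ (x y z : ℕ → Fin d → ℝ) (ε : ℝ), 0 ≤ ε → Monotone y →
      (∀ n, z n = x n + R *ᵥ y n) → (∀ n j, 0 ≤ z n j) →
      (∀ n j, ε < z n j → y (n + 1) j = y n j) →
      (∀ n j, z (n + 1) j ≤ z n j + ε) →
      ∀ a b : ℕ, a ≤ b → (∀ j, j ∉ I.erase i → y b j = y a j) →
      (∀ n m, a ≤ n → n ≤ b → a ≤ m → m ≤ b → ‖x n - x m‖ ≤ ε) →
      ‖y b - y a‖ ≤ C * ε) := by
    intro i
    by_cases hi : i ∈ I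
    · obtain ⟨C, hC, hh⟩ := ih (I.erase i) (Finset.erase_ssubset hi)
      exact ⟨C, hC, fun _ => hh⟩
    · exact ⟨0, le_rfl, fun hh => absurd hh hi⟩
  choose C' hC'0 hC' using ih'
  obtain ⟨c, hc, hco⟩ := sk_coercive h I
  set D := ∑ i, C' i with hD
  have hCD : ∀ i, C' i ≤ D := fun i =>
    Finset.single_le_sum (fun j _ => hC'0 j) (Finset.mem_univ i)
  have hD0 : 0 ≤ D := Finset.sum_nonneg fun j _ => hC'0 j
  refine ⟨D + c * (4 + M * D), by positivity, ?_⟩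
  intro x y z ε hε hmono hz hz0 hcomp hstep a b hab hout hx
  have ymono : ∀ p q, p ≤ q → ∀ j, y p j ≤ y q j := fun p q hpq j => hmono hpq j
  -- constancy while `z` is large
  have hconst : ∀ i p q, p ≤ q → (∀ n, p ≤ n → n < q → ε < z n i) → y q i = y p i := by
    intro i p q hpq
    induction q, hpq using Nat.le_induction with
    | base => intro _; rfl
    | succ q hq ihq =>
      intro hh
      rw [hcomp q i (hh q hq (Nat.lt_succ_self q))]
      exact ihq fun n h1 h2 => hh n h1 (by omega)
  -- application of the inductive hypothesis
  have hsub : ∀ i ∈ I, ∀ p, a ≤ p → p ≤ b → (∀ n, p ≤ n → n < b → ε < z n i) →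
      ‖y b - y p‖ ≤ D * ε := by
    intro i hi p hap hpb hh
    refine (hC' i hi x y z ε hε hmono hz hz0 hcomp hstep p b hpb ?_ ?_).trans
      (mul_le_mul_of_nonneg_right (hCD i) hε)
    · intro j hj
      by_cases hji : j = i
      · rw [hji]; exact hconst i p b hpb hh
      · have hjI : j ∉ I := fun hjI => hj (Finset.mem_erase.2 ⟨hji, hjI⟩)
        have := hout j hjI
        have h1 := ymono a p hap j
        have h2 := ymono p b hpb j
        linarith
    · intro n m h1 h2 h3 h4
      exact hx n m (by omega) h2 (by omega) h4
  by_cases hA : ∃ i ∈ I, ∀ n, a ≤ n → n < b → ε < z n i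
  · obtain ⟨i, hi, hh⟩ := hA
    have := hsub i hi a le_rfl hab hh
    have : 0 ≤ c * (4 + M * D) * ε := by positivity
    nlinarith
  push Not at hA
  have hzb : ∀ i ∈ I, z b i ≤ (3 + M * D) * ε := by
    intro i hi
    classical
    have hex : ∃ p, a ≤ p ∧ ∀ n, p ≤ n → n < b → ε < z n i := ⟨b, hab, fun n h1 h2 => by omega⟩
    obtain ⟨hpa, hp⟩ := Nat.find_spec hex
    have hpb : Nat.find hex ≤ b := Nat.find_min' hex ⟨hab, fun n h1 h2 => by omega⟩
    have hmin := fun m => Nat.find_min hex (m := m)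
    set p := Nat.find hex with hpdef
    have hap : a < p := by
      rcases hpa.eq_or_lt with he | hl
      · obtain ⟨n, h1, h2, h3⟩ := hA i hi
        have := hp n (by omega) h2
        linarith
      · exact hl
    have hprev : z (p - 1) i ≤ ε := by
      by_contra hlt
      push Not at hlt
      apply hmin (p - 1) (by omega)
      refine ⟨by omega, fun n h1 h2 => ?_⟩
      rcases h1.eq_or_lt with he | hl
      · rw [← he]; exact hlt
      · exact hp n (by omega) h2
    have hzp : z p i ≤ 2 * ε := by
      have := hstep (p - 1) i
      rw [Nat.sub_add_cancel (by omega)] at this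
      linarith
    have hy := hsub i hi p hpa hpb hp
    have e : z b i = z p i + (x b - x p) i + (R *ᵥ (y b - y p)) i := by
      rw [hz b, hz p, Matrix.mulVec_sub]
      simp only [Pi.add_apply, Pi.sub_apply]
      ring
    have h1 : (x b - x p) i ≤ ε :=
      (le_abs_self _).trans ((norm_le_pi_norm (x b - x p) i).trans
        (hx b p hab le_rfl hpa hpb))
    have h2 : (R *ᵥ (y b - y p)) i ≤ M * (D * ε) :=
      (le_abs_self _).trans ((norm_le_pi_norm (R *ᵥ (y b - y p)) i).trans
        ((hMb _).trans (mul_le_mul_of_nonneg_left hy hM)))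
    rw [e]
    linarith
  have := hco (y b - y a) (fun i => sub_nonneg.2 (ymono a b hab i))
    (fun i hi => sub_eq_zero.2 (hout i hi)) ((4 + M * D) * ε) (by positivity) (by
      intro i hi
      have e : (R *ᵥ (y b - y a)) i = z b i - z a i + (x a - x b) i := by
        rw [hz b, hz a, Matrix.mulVec_sub]
        simp only [Pi.add_apply, Pi.sub_apply]
        ring
      have h1 : (x a - x b) i ≤ ε :=
        (le_abs_self _).trans ((norm_le_pi_norm (x a - x b) i).trans
          (hx a b le_rfl hab hab le_rfl))
      have h2 := hzb i hi
      have h3 := hz0 a i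
      rw [e]
      linarith)
  have h5 : 0 ≤ D * ε := by positivity
  linarith

/-- Discrete approximation scheme. -/
lemma sk_scheme {d : ℕ} {R : Matrix (Fin d) (Fin d) ℝ} (h : SkCS R) :
    ∃ B : ℝ, 0 ≤ B ∧ ∀ (x : ℕ → Fin d → ℝ) (δ : ℝ), 0 ≤ δ → (∀ i, 0 ≤ x 0 i) →
      (∀ n, ‖x (n + 1) - x n‖ ≤ δ) →
      ∃ y z : ℕ → Fin d → ℝ, y 0 = 0 ∧ Monotone y ∧ (∀ n, z n = x n + R *ᵥ y n) ∧
        (∀ n j, 0 ≤ z n j) ∧ (∀ n j, B * δ < z n j → y (n + 1) j = y n j) ∧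
        (∀ n j, z (n + 1) j ≤ z n j + B * δ) := by
  classical
  choose w hw0 hwI hw1 using h
  obtain ⟨M, hM, hMb⟩ := sk_mulVec_bound R
  set K := ∑ I, M * ‖w I‖ with hK
  have hKb : ∀ I, ‖R *ᵥ w I‖ ≤ K := fun I => (hMb _).trans
    (Finset.single_le_sum (f := fun I => M * ‖w I‖) (fun J _ => by positivity)
      (Finset.mem_univ I))
  have hK0 : 0 ≤ K := Finset.sum_nonneg fun J _ => by positivity
  refine ⟨1 + K, by positivity, ?_⟩
  intro x δ hδ hx0 hx
  let J : (Fin d → ℝ) → Finset (Fin d) :=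
    fun v => Finset.univ.filter (fun j => v j ≤ (1 + K) * δ)
  let y : ℕ → Fin d → ℝ := fun n => Nat.rec (motive := fun _ => Fin d → ℝ) 0
    (fun n v => v + δ • w (J (x n + R *ᵥ v))) n
  have hy0 : y 0 = 0 := rfl
  have hys : ∀ n, y (n + 1) = y n + δ • w (J (x n + R *ᵥ y n)) := fun n => rfl
  have hzs : ∀ n, x (n + 1) + R *ᵥ y (n + 1) = (x n + R *ᵥ y n) + (x (n + 1) - x n)
      + δ • (R *ᵥ w (J (x n + R *ᵥ y n))) := by
    intro n
    rw [hys, Matrix.mulVec_add, Matrix.mulVec_smul]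
    abel
  have hxl : ∀ n j, |(x (n + 1) - x n) j| ≤ δ := fun n j =>
    (norm_le_pi_norm (x (n + 1) - x n) j).trans (hx n)
  have hRl : ∀ I j, |(R *ᵥ w I) j| ≤ K := fun I j =>
    (norm_le_pi_norm (R *ᵥ w I) j).trans (hKb I)
  refine ⟨y, fun n => x n + R *ᵥ y n, hy0, ?_, fun n => rfl, ?_, ?_, ?_⟩
  · apply monotone_nat_of_le_succ
    intro n j
    rw [hys, Pi.add_apply, Pi.smul_apply, smul_eq_mul]
    have := mul_nonneg hδ (hw0 (J (x n + R *ᵥ y n)) j)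
    linarith
  · intro n
    induction n with
    | zero => intro j; simp only [hy0, Matrix.mulVec_zero, add_zero]; exact hx0 j
    | succ n ihn =>
      intro j
      have hn := ihn j
      have h1 := (abs_le.1 (hxl n j)).1
      simp only [hzs n]
      rw [Pi.add_apply, Pi.add_apply, Pi.smul_apply, smul_eq_mul]
      by_cases hj : j ∈ J (x n + R *ᵥ y n)
      · have h2 := hw1 _ j hj
        have := mul_le_mul_of_nonneg_left h2 hδ
        simp only at hn
        linarith
      · have h2 := (abs_le.1 (hRl (J (x n + R *ᵥ y n)) j)).1
        have := mul_le_mul_of_nonneg_left h2 hδ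
        simp only [J, Finset.mem_filter, Finset.mem_univ, true_and, not_le] at hj
        linarith
  · intro n j hj
    have : j ∉ J (x n + R *ᵥ y n) := by
      simp only [J, Finset.mem_filter, Finset.mem_univ, true_and, not_le]
      exact hj
    rw [hys, Pi.add_apply, Pi.smul_apply, hwI _ j this, smul_zero, add_zero]
  · intro n j
    simp only [hzs n]
    rw [Pi.add_apply, Pi.add_apply, Pi.smul_apply, smul_eq_mul]
    have h1 := (abs_le.1 (hxl n j)).2
    have h2 := (abs_le.1 (hRl (J (x n + R *ᵥ y n)) j)).2
    have := mul_le_mul_of_nonneg_left h2 hδ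
    linarith

/-- Continuous-time approximate solutions on a finite horizon. -/
lemma sk_approx {d : ℕ} {R : Matrix (Fin d) (Fin d) ℝ} (h : SkCS R) :
    ∃ C : ℝ, 0 ≤ C ∧ ∀ x : ℝ → Fin d → ℝ, Continuous x → (∀ i, 0 ≤ x 0 i) →
      ∀ T : ℝ, 0 ≤ T → ∀ ε : ℝ, 0 < ε → ∃ y : ℝ → Fin d → ℝ, y 0 = 0 ∧ Monotone y ∧
        (∀ t, 0 ≤ t → t ≤ T → ∀ j, -ε ≤ (x t + R *ᵥ y t) j) ∧
        (∀ s t η, 0 ≤ s → s ≤ t → t ≤ T → 0 ≤ η → (∀ u, s ≤ u → u ≤ t → ‖x u - x s‖ ≤ η) →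
          ‖y t - y s‖ ≤ C * (η + ε)) ∧
        (∀ j s t, 0 ≤ s → s ≤ t → t ≤ T →
          (∀ u, s ≤ u → u ≤ t → ε < (x u + R *ᵥ y u) j) → y t j = y s j) := by
  obtain ⟨C, hC, hosc⟩ := sk_osc h Finset.univ
  obtain ⟨B, hB, hsch⟩ := sk_scheme h
  refine ⟨2 * C, by positivity, ?_⟩
  intro x hxc hx0 T hT ε hε
  set δ := ε / (B + 2) with hδ
  have hδpos : 0 < δ := by positivity
  have hδε : B * δ + 2 * δ = ε := by rw [hδ]; field_simp
  have hBδ : 0 ≤ B * δ := by positivity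
  have huc := (isCompact_Icc (a := (0 : ℝ)) (b := T)).uniformContinuousOn_of_continuous
    hxc.continuousOn
  rw [Metric.uniformContinuousOn_iff] at huc
  obtain ⟨r, hr, huc⟩ := huc δ hδpos
  set τ := r / 2 with hτ
  have hτpos : 0 < τ := by positivity
  have hunif : ∀ s t, 0 ≤ s → s ≤ T → 0 ≤ t → t ≤ T → |s - t| ≤ τ → ‖x s - x t‖ ≤ δ := by
    intro s t h1 h2 h3 h4 h5
    rw [← dist_eq_norm]
    refine (huc s ⟨h1, h2⟩ t ⟨h3, h4⟩ ?_).le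
    rw [Real.dist_eq]
    linarith
  let X : ℕ → Fin d → ℝ := fun n => x (min (n * τ) T)
  have hX : ∀ n, ‖X (n + 1) - X n‖ ≤ δ := by
    intro n
    apply hunif
    · positivity
    · exact min_le_right _ _
    · positivity
    · exact min_le_right _ _
    · refine (abs_min_sub_min_le_max _ _ _ _).trans ?_
      push_cast
      have : ((n : ℝ) + 1) * τ - n * τ = τ := by ring
      rw [this, sub_self, abs_zero, abs_of_pos hτpos, max_eq_left hτpos.le]
  have hX0 : ∀ i, 0 ≤ X 0 i := by
    intro i
    simp only [X, Nat.cast_zero, zero_mul, min_eq_left hT]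
    exact hx0 i
  obtain ⟨Y, Z, hY0, hYm, hZ, hZ0, hcomp, hstep⟩ := hsch X δ hδpos.le hX0 hX
  have hXeq : ∀ k : ℕ, ∀ t, t ≤ T → (k : ℝ) * τ ≤ t → X k = x (k * τ) := by
    intro k t ht hk
    simp only [X]
    rw [min_eq_left (hk.trans ht)]
  have hfl : ∀ t, 0 ≤ t → (⌊t / τ⌋₊ : ℝ) * τ ≤ t := by
    intro t ht
    rw [← le_div_iff₀ hτpos]
    exact Nat.floor_le (by positivity)
  have hfl' : ∀ t, t < ((⌊t / τ⌋₊ : ℝ) + 1) * τ := by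
    intro t
    rw [← div_lt_iff₀ hτpos]
    exact Nat.lt_floor_add_one _
  have hflm : ∀ s t : ℝ, s ≤ t → ⌊s / τ⌋₊ ≤ ⌊t / τ⌋₊ := fun s t hst =>
    Nat.floor_le_floor (div_le_div_of_nonneg_right hst hτpos.le)
  have hfleq : ∀ (k : ℕ) t, (k : ℝ) * τ ≤ t → t < ((k : ℝ) + 1) * τ → ⌊t / τ⌋₊ = k := by
    intro k t h1 h2
    have h0 : 0 ≤ t := le_trans (by positivity) h1
    rw [Nat.floor_eq_iff (by positivity), le_div_iff₀ hτpos, div_lt_iff₀ hτpos]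
    exact ⟨h1, h2⟩
  have hcell : ∀ (k : ℕ) t, 0 ≤ t → t ≤ T → (k : ℝ) * τ ≤ t → t < ((k : ℝ) + 1) * τ →
      ‖x t - X k‖ ≤ δ := by
    intro k t h0 h1 h2 h3
    rw [hXeq k t h1 h2]
    refine hunif _ _ h0 h1 (by positivity) (h2.trans h1) ?_
    rw [abs_of_nonneg (by linarith)]
    linarith
  -- a point of `[s,t]` in the cell of index `k`
  have hpt : ∀ s t, 0 ≤ s → s ≤ t → ∀ k : ℕ, ⌊s / τ⌋₊ ≤ k → k ≤ ⌊t / τ⌋₊ →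
      ∃ u, s ≤ u ∧ u ≤ t ∧ (k : ℝ) * τ ≤ u ∧ u < ((k : ℝ) + 1) * τ := by
    intro s t h0 hst k h1 h2
    refine ⟨max s (k * τ), le_max_left _ _, ?_, le_max_right _ _, ?_⟩
    · apply max_le hst
      refine le_trans ?_ (hfl t (h0.trans hst))
      exact mul_le_mul_of_nonneg_right (Nat.cast_le.2 h2) hτpos.le
    · apply max_lt
      · refine (hfl' s).trans_le ?_
        have : (⌊s / τ⌋₊ : ℝ) ≤ k := Nat.cast_le.2 h1
        exact mul_le_mul_of_nonneg_right (by linarith) hτpos.le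
      · linarith
  have hnear : ∀ (k : ℕ) t, 0 ≤ t → t ≤ T → (k : ℝ) * τ ≤ t → t < ((k : ℝ) + 1) * τ →
      ∀ j, |(x t + R *ᵥ Y ⌊t / τ⌋₊) j - Z k j| ≤ δ := by
    intro k t h0 h1 h2 h3 j
    rw [hfleq k t h2 h3, hZ k]
    have : (x t + R *ᵥ Y k) j - (X k + R *ᵥ Y k) j = (x t - X k) j := by
      simp only [Pi.add_apply, Pi.sub_apply]; ring
    rw [this]
    exact (norm_le_pi_norm (x t - X k) j).trans (hcell k t h0 h1 h2 h3)
  refine ⟨fun t => Y ⌊t / τ⌋₊, ?_, ?_, ?_, ?_, ?_⟩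
  · simp [hY0]
  · intro s t hst
    exact hYm (hflm s t hst)
  · intro t h0 h1 j
    have h2 := (abs_le.1 (hnear ⌊t / τ⌋₊ t h0 h1 (hfl t h0) (hfl' t) j)).1
    have h3 := hZ0 ⌊t / τ⌋₊ j
    simp only
    linarith
  · intro s t η h0 hst h1 hη hosx
    have := hosc X Y Z (2 * (η + ε)) (by positivity) hYm hZ hZ0
      (fun n j hh => hcomp n j (by linarith))
      (fun n j => (hstep n j).trans (by linarith)) _ _ (hflm s t hst)
      (fun j hj => absurd (Finset.mem_univ j) hj) (by
        intro n m hn1 hn2 hm1 hm2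
        obtain ⟨u, hu1, hu2, hu3, hu4⟩ := hpt s t h0 hst n hn1 hn2
        obtain ⟨v, hv1, hv2, hv3, hv4⟩ := hpt s t h0 hst m hm1 hm2
        have a1 := hcell n u (h0.trans hu1) (hu2.trans h1) hu3 hu4
        have a2 := hcell m v (h0.trans hv1) (hv2.trans h1) hv3 hv4
        have a3 := hosx u hu1 hu2
        have a4 := hosx v hv1 hv2
        rw [norm_sub_rev] at a1 a4
        have e : X n - X m = (X n - x u) + (x u - x s) + (x s - x v) + (x v - X m) := by abel
        rw [e]
        refine (norm_add_le _ _).trans ?_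
        have b1 := norm_add_le (X n - x u + (x u - x s)) (x s - x v)
        have b2 := norm_add_le (X n - x u) (x u - x s)
        linarith)
    simp only
    linarith
  · intro j s t h0 hst h1 hpos
    have key : ∀ m, ⌊s / τ⌋₊ ≤ m → m ≤ ⌊t / τ⌋₊ → Y m j = Y ⌊s / τ⌋₊ j := by
      intro m hm
      induction m, hm using Nat.le_induction with
      | base => intro _; rfl
      | succ k hk ihk =>
        intro hkt
        rw [← ihk (by omega)]
        apply hcomp
        obtain ⟨u, hu1, hu2, hu3, hu4⟩ := hpt s t h0 hst k hk (by omega)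
        have a1 := hpos u hu1 hu2
        have a2 := (abs_le.1 (hnear k u (h0.trans hu1) (hu2.trans h1) hu3 hu4 j)).2
        simp only at a1
        linarith
    exact key _ (hflm s t hst) le_rfl

lemma sk_exists {d : ℕ} {R : Matrix (Fin d) (Fin d) ℝ} (h : SkCS R) (x : ℝ → Fin d → ℝ)
    (hx : Continuous x) (hx0 : ∀ i, 0 ≤ x 0 i) :
    ∃ y z : ℝ → Fin d → ℝ, IsSkorokhodSolution R x y z := by
  obtain ⟨C, hC, happ⟩ := sk_approx h
  obtain ⟨M, hM, hMb⟩ := sk_mulVec_bound R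
  let e : ℕ → ℝ := fun N => 1 / ((N : ℝ) + 1)
  have he : ∀ N, 0 < e N := fun N => by positivity
  have he1 : ∀ N, e N ≤ 1 := fun N => by
    simp only [e]
    rw [div_le_one (by positivity)]
    have : (0 : ℝ) ≤ N := Nat.cast_nonneg N
    linarith
  choose Y hY0 hYm hYz hYo hYc using
    fun N : ℕ => happ x hx hx0 (N : ℝ) (Nat.cast_nonneg N) (e N) (he N)
  let F : Filter ℕ := (Filter.hyperfilter ℕ : Ultrafilter ℕ)
  have hF : F ≤ atTop := Nat.hyperfilter_le_atTop
  have heF : Tendsto e F (𝓝 0) := tendsto_one_div_add_atTop_nhds_zero_nat.mono_left hF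
  have hlarge : ∀ t : ℝ, ∀ᶠ N : ℕ in F, t ≤ N := fun t =>
    hF (tendsto_natCast_atTop_atTop.eventually_ge_atTop t)
  have hlim : ∀ t : ℝ, ∃ v : Fin d → ℝ, 0 ≤ t → Tendsto (fun N => Y N t) F (𝓝 v) := by
    intro t
    by_cases ht : 0 ≤ t
    swap
    · exact ⟨0, fun hh => absurd hh ht⟩
    obtain ⟨K, hK⟩ := (isCompact_Icc (a := (0 : ℝ)) (b := t)).exists_bound_of_continuousOn
      (f := fun u => x u - x 0) (by fun_prop)
    have hK0 : 0 ≤ K := (norm_nonneg _).trans (hK 0 ⟨le_rfl, ht⟩)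
    have hb : ∀ᶠ N in F, Y N t ∈ Metric.closedBall (0 : Fin d → ℝ) (C * (K + 1)) := by
      filter_upwards [hlarge t] with N hN
      have := hYo N 0 t K le_rfl ht hN hK0 (fun u h1 h2 => hK u ⟨h1, h2⟩)
      rw [hY0, sub_zero] at this
      rw [mem_closedBall_zero_iff]
      exact this.trans (mul_le_mul_of_nonneg_left (by linarith [he1 N]) hC)
    obtain ⟨v, _, hv⟩ := (isCompact_closedBall (0 : Fin d → ℝ) (C * (K + 1))).ultrafilter_le_nhds
      ((Filter.hyperfilter ℕ).map (fun N => Y N t)) (by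
        rw [le_principal_iff]
        exact hb)
    exact ⟨v, fun _ => hv⟩
  choose y hy using hlim
  have hz : ∀ t, 0 ≤ t → Tendsto (fun N => x t + R *ᵥ Y N t) F (𝓝 (x t + R *ᵥ y t)) := by
    intro t ht
    exact tendsto_const_nhds.add (((sk_mulVec_cont R).tendsto _).comp (hy t ht))
  have hcoord : ∀ t j, 0 ≤ t → Tendsto (fun N => Y N t j) F (𝓝 (y t j)) := fun t j ht =>
    ((continuous_apply j).tendsto _).comp (hy t ht)
  have hzcoord : ∀ t j, 0 ≤ t → Tendsto (fun N => (x t + R *ᵥ Y N t) j) F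
      (𝓝 ((x t + R *ᵥ y t) j)) := fun t j ht =>
    ((continuous_apply j).tendsto _).comp (hz t ht)
  have hmono : ∀ j s t, 0 ≤ s → s ≤ t → y s j ≤ y t j := by
    intro j s t hs hst
    exact le_of_tendsto_of_tendsto' (hcoord s j hs) (hcoord t j (hs.trans hst))
      (fun N => hYm N hst j)
  have hmod : ∀ s t η, 0 ≤ s → s ≤ t → 0 ≤ η → (∀ u, s ≤ u → u ≤ t → ‖x u - x s‖ ≤ η) →
      ‖y t - y s‖ ≤ C * η := by
    intro s t η hs hst hη hu
    have l1 : Tendsto (fun N => ‖Y N t - Y N s‖) F (𝓝 ‖y t - y s‖) :=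
      ((hy t (hs.trans hst)).sub (hy s hs)).norm
    have l2 : Tendsto (fun N => C * (η + e N)) F (𝓝 (C * (η + 0))) :=
      (heF.const_add η).const_mul C
    rw [add_zero] at l2
    apply le_of_tendsto_of_tendsto l1 l2
    filter_upwards [hlarge t] with N hN
    exact hYo N s t η hs hst hN hη hu
  have hxloc : ∀ t η, 0 < η → ∃ r, 0 < r ∧ ∀ u, |u - t| < r → ‖x u - x t‖ ≤ η := by
    intro t η hη
    obtain ⟨r, hr, hh⟩ := Metric.continuous_iff.1 hx t η hη
    refine ⟨r, hr, fun u hu => ?_⟩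
    rw [← dist_eq_norm]
    exact (hh u (by rw [Real.dist_eq]; exact hu)).le
  have hycont : ContinuousOn y (Set.Ici 0) := by
    rw [Metric.continuousOn_iff]
    intro t ht ε hε
    obtain ⟨r, hr, hh⟩ := hxloc t (ε / (2 * (C + 1))) (by positivity)
    refine ⟨r, hr, fun s hs hst => ?_⟩
    rw [Real.dist_eq] at hst
    rw [dist_eq_norm]
    have key : C * (2 * (ε / (2 * (C + 1)))) < ε := by
      have : C * (2 * (ε / (2 * (C + 1)))) = C * ε / (C + 1) := by field_simp
      rw [this, div_lt_iff₀ (by positivity)]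
      linarith
    have hos : ∀ a u, |a - t| < r → |u - t| < r →
        ‖x u - x a‖ ≤ 2 * (ε / (2 * (C + 1))) := by
      intro a u h1 h2
      have e1 : x u - x a = (x u - x t) - (x a - x t) := by abel
      rw [e1]
      have := norm_sub_le (x u - x t) (x a - x t)
      linarith [hh a h1, hh u h2]
    rw [abs_lt] at hst
    rcases le_total s t with hle | hle
    · rw [norm_sub_rev]
      refine (hmod s t _ hs hle (by positivity) (fun u h1 h2 => hos s u ?_ ?_)).trans_lt key
      · rw [abs_lt]; constructor <;> linarith
      · rw [abs_lt]; constructor <;> linarith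
    · refine (hmod t s _ ht hle (by positivity) (fun u h1 h2 => hos t u ?_ ?_)).trans_lt key
      · rw [abs_lt]; constructor <;> linarith
      · rw [abs_lt]; constructor <;> linarith
  refine ⟨y, fun t => x t + R *ᵥ y t, hycont, ?_, fun t _ => rfl, ?_, ?_, ?_, ?_⟩
  · exact hx.continuousOn.add ((sk_mulVec_cont R).comp_continuousOn hycont)
  · intro t ht j
    have l1 : Tendsto (fun N => -e N) F (𝓝 (-0)) := heF.neg
    rw [neg_zero] at l1
    apply le_of_tendsto_of_tendsto l1 (hzcoord t j ht)
    filter_upwards [hlarge t] with N hN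
    exact hYz N t ht hN j
  · have l := hy 0 le_rfl
    simp only [hY0] at l
    exact tendsto_nhds_unique l tendsto_const_nhds
  · intro j s hs t _ hst
    exact hmono j s t hs hst
  · intro j s₁ s₂ hs1 hs12 hpos
    rcases hs12.eq_or_lt with rfl | hlt
    · rfl
    have hloc : ∀ t ∈ Set.Ioo s₁ s₂, HasDerivAt (fun u => y u j) 0 t := by
      intro t ht
      have ht0 : 0 < t := hs1.trans_lt ht.1
      have hzt : 0 < (x t + R *ᵥ y t) j := hpos t ht
      set ρ := (x t + R *ᵥ y t) j / 3 with hρ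
      have hρpos : 0 < ρ := by positivity
      set η := ρ / (1 + 4 * M * C) with hη
      have hηpos : 0 < η := by positivity
      have hηρ : η + 4 * M * C * η = ρ := by rw [hη]; field_simp
      obtain ⟨r, hr, hh⟩ := hxloc t η hηpos
      set δ := min (r / 2) t with hδ
      have hδpos : 0 < δ := lt_min (by positivity) ht0
      have hδr : δ < r := (min_le_left _ _).trans_lt (by linarith)
      have hδt : δ ≤ t := min_le_right _ _
      have hev : ∀ᶠ N in F, Y N (t + δ) j = Y N (t - δ) j := by
        have l1 : ∀ᶠ N in F, 2 * ρ < (x t + R *ᵥ Y N t) j :=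
          (hzcoord t j ht0.le).eventually_const_lt (by linarith)
        have l2 : Tendsto (fun N => (2 * M * C + 1) * e N) F (𝓝 ((2 * M * C + 1) * 0)) :=
          heF.const_mul _
        rw [mul_zero] at l2
        have l3 := l2.eventually_lt_const hρpos
        filter_upwards [l1, l3, hlarge (t + δ)] with N h1 h2 h3
        apply hYc N j (t - δ) (t + δ) (by linarith) (by linarith) h3
        have hos : ∀ u, t - δ ≤ u → u ≤ t + δ → ‖Y N u - Y N (t - δ)‖ ≤ C * (2 * η + e N) := by
          intro u hu1 hu2
          apply hYo N (t - δ) u (2 * η) (by linarith) hu1 (hu2.trans h3) (by positivity)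
          intro v hv1 hv2
          have a1 := hh v (by rw [abs_lt]; constructor <;> linarith)
          have a2 := hh (t - δ) (by rw [abs_lt]; constructor <;> linarith)
          have e1 : x v - x (t - δ) = (x v - x t) - (x (t - δ) - x t) := by abel
          rw [e1]
          have := norm_sub_le (x v - x t) (x (t - δ) - x t)
          linarith
        intro u hu1 hu2
        have a1 := hos u hu1 hu2
        have a2 := hos t (by linarith) (by linarith)
        have a3 : ‖Y N u - Y N t‖ ≤ 2 * (C * (2 * η + e N)) := by
          have e1 : Y N u - Y N t = (Y N u - Y N (t - δ)) - (Y N t - Y N (t - δ)) := by abel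
          rw [e1]
          have := norm_sub_le (Y N u - Y N (t - δ)) (Y N t - Y N (t - δ))
          linarith
        have a4 := (norm_le_pi_norm (R *ᵥ (Y N u - Y N t)) j).trans
          ((hMb _).trans (mul_le_mul_of_nonneg_left a3 hM))
        have a5 := (norm_le_pi_norm (x u - x t) j).trans
          (hh u (by rw [abs_lt]; constructor <;> linarith))
        rw [Real.norm_eq_abs] at a4 a5
        have a6 := (abs_le.1 a4).1
        have a7 := (abs_le.1 a5).1
        have e2 : (x u + R *ᵥ Y N u) j = (x t + R *ᵥ Y N t) j + (x u - x t) j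
            + (R *ᵥ (Y N u - Y N t)) j := by
          rw [Matrix.mulVec_sub]
          simp only [Pi.add_apply, Pi.sub_apply]
          ring
        rw [e2]
        linarith
      have heq : y (t + δ) j = y (t - δ) j := by
        refine tendsto_nhds_unique (hcoord (t + δ) j (by linarith)) ?_
        exact (hcoord (t - δ) j (by linarith)).congr' (hev.mono fun N hN => hN.symm)
      have hc : (fun u => y u j) =ᶠ[𝓝 t] fun _ => y (t - δ) j := by
        have : Set.Ioo (t - δ) (t + δ) ∈ 𝓝 t := Ioo_mem_nhds (by linarith) (by linarith)
        filter_upwards [this] with u hu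
        have b1 := hmono j (t - δ) u (by linarith) hu.1.le
        have b2 := hmono j u (t + δ) (by linarith [hu.1]) hu.2.le
        linarith
      exact (hasDerivAt_const t _).congr_of_eventuallyEq hc
    have hcont : ContinuousOn (fun u => y u j) (Set.Icc s₁ s₂) :=
      ((continuous_apply j).comp_continuousOn hycont).mono fun u hu => hs1.trans hu.1
    obtain ⟨c, _, hc⟩ := exists_hasDerivAt_eq_slope (fun u => y u j) (fun _ => 0) hlt hcont hloc
    have hne : s₂ - s₁ ≠ 0 := (sub_pos.2 hlt).ne'
    rw [eq_div_iff hne, zero_mul] at hc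
    linarith

lemma sk_necessity {d : ℕ} {R : Matrix (Fin d) (Fin d) ℝ}
    (h : ∀ x : ℝ → Fin d → ℝ, ContinuousOn x (Set.Ici 0) → (∀ i, 0 ≤ x 0 i) →
      ∃ y z : ℝ → Fin d → ℝ, IsSkorokhodSolution R x y z) : IsCompletelyS R := by
  classical
  intro I _
  obtain ⟨y, z, hyc, hzc, hz, hz0, hy0, hm, hcomp⟩ :=
    h (fun t i => if i ∈ I then -t else 1)
      (by
        apply Continuous.continuousOn
        apply continuous_pi
        intro i
        by_cases hi : i ∈ I
        · simp only [hi, if_true]; fun_prop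
        · simp only [hi, if_false]; fun_prop)
      (by intro i; by_cases hi : i ∈ I <;> simp [hi])
  have hev : ∀ᶠ t in 𝓝[Set.Ici 0] (0 : ℝ), ∀ j, j ∉ I → 0 < z t j := by
    rw [eventually_all]
    intro j
    by_cases hj : j ∈ I
    · simp [hj]
    have hcj : ContinuousWithinAt (fun t => z t j) (Set.Ici 0) 0 :=
      ((continuous_apply j).comp_continuousOn hzc) 0 (Set.mem_Ici.2 le_rfl)
    have : z 0 j = 1 := by
      rw [hz 0 le_rfl, hy0]
      simp [hj]
    filter_upwards [hcj.tendsto.eventually_const_lt (u := 0) (by simp only [this]; norm_num)]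
      with t ht _ using ht
  rw [eventually_nhdsWithin_iff, Metric.eventually_nhds_iff_ball] at hev
  obtain ⟨r, hr, hev⟩ := hev
  have hyj : ∀ j, j ∉ I → y (r / 2) j = 0 := by
    intro j hj
    have := hcomp j 0 (r / 2) le_rfl (by positivity) (fun s hs => hev s (by
      rw [Real.ball_eq_Ioo]
      constructor <;> linarith [hs.1, hs.2]) hs.1.le j hj)
    rw [this, hy0]; rfl
  refine ⟨fun a => y (r / 2) a, ?_, ?_⟩
  · intro i
    have := hm i (Set.mem_Ici.2 le_rfl) (Set.mem_Ici.2 (by positivity : (0 : ℝ) ≤ r / 2))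
      (by positivity)
    simp only [hy0] at this
    exact this
  · intro i
    rw [← sk_restrict R I (y (r / 2)) hyj i]
    have h1 := hz0 (r / 2) (by positivity) i
    rw [hz (r / 2) (by positivity)] at h1
    simp only [Pi.add_apply, i.2, if_true] at h1
    linarith

lemma sk_congr {d : ℕ} {R : Matrix (Fin d) (Fin d) ℝ} {x x' y z : ℝ → Fin d → ℝ}
    (hx : ∀ t, 0 ≤ t → x' t = x t) (h : IsSkorokhodSolution R x' y z) :
    IsSkorokhodSolution R x y z := by
  obtain ⟨h1, h2, h3, h4⟩ := h
  exact ⟨h1, h2, fun t ht => by rw [h3 t ht, hx t ht], h4⟩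

end SkorokhodHelpers

/-- A Skorokhod solution exists for every continuous input path
`x` with `x(0) ≥ 0` if and only if `R` is completely-S. -/
theorem skorokhod_solution_exists_iff_completelyS (d : ℕ)
    (R : Matrix (Fin d) (Fin d) ℝ) :
    (∀ x : ℝ → Fin d → ℝ, ContinuousOn x (Set.Ici 0) → (∀ i, 0 ≤ x 0 i) →
      ∃ y z : ℝ → Fin d → ℝ, IsSkorokhodSolution R x y z) ↔
    IsCompletelyS R := by
  constructor
  · exact sk_necessity
  · intro hR x hx hx0
    have hc : Continuous (fun t : ℝ => x (max t 0)) :=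
      hx.comp_continuous (by fun_prop) (fun t => Set.mem_Ici.2 (le_max_right t 0))
    obtain ⟨y, z, hyz⟩ := sk_exists (sk_cs_of hR) (fun t : ℝ => x (max t 0)) hc (by simpa using hx0)
    exact ⟨y, z, sk_congr (fun t ht => by simp [max_eq_left ht]) hyz⟩
end
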